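/- (Yoccoz, density theorem) For every Liouville number α ∈ T, the set O_α^∞ of C^∞-linearizable diffeomorphisms is dense in F_α^∞ for the C^∞ topology: every orientation-preserving C^∞ circle diffeomorphism with rotation number α is the C^∞-limit of a sequence of C^∞-linearizable diffeomorphisms with rotation number α. -/

import Mathlib

open Filter Topology

/-- `ρ` is the rotation (translation) number of the lift `F`. -/
def IsRotNumber (F : ℝ → ℝ) (ρ : ℝ) : Prop :=
  ∀ x : ℝ, Tendsto (fun n : ℕ => (F^[n] x - x) / (n : ℝ)) atTop (𝓝 ρ)

/-- `α` is Diophantine with exponent `σ` and constant `γ`: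
`|α - p/q| ≥ γ / q^(2+σ)` for all rationals `p/q`. -/
def IsDiophantineWith (γ σ α : ℝ) : Prop :=
  ∀ (p : ℤ) (q : ℕ), 0 < q → γ / (q : ℝ) ^ ((2 : ℝ) + σ) ≤ |α - (p : ℝ) / (q : ℝ)|

/-- `α` is a Diophantine number. -/
def IsDiophantine (α : ℝ) : Prop :=
  ∃ γ > (0 : ℝ), ∃ σ ≥ (0 : ℝ), IsDiophantineWith γ σ α

/-- A lift of an orientation-preserving `C^∞` diffeomorphism of the circle `ℝ/ℤ`. -/
structure SmoothCircleDiffeoLift where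
  toFun : ℝ → ℝ
  smooth : ContDiff ℝ (⊤ : ℕ∞) toFun
  deriv_pos : ∀ x, 0 < deriv toFun x
  map_add_one : ∀ x, toFun (x + 1) = toFun x + 1

/-- The lift `F` is `C^∞`-linearizable: there is a lift `H` of a `C^∞` circle
diffeomorphism with `H ∘ F = H + α`. -/
def SmoothlyLinearizable (F : ℝ → ℝ) (α : ℝ) : Prop :=
  ∃ H : ℝ → ℝ, ContDiff ℝ (⊤ : ℕ∞) H ∧ (∀ x, 0 < deriv H x) ∧
    (∀ x, H (x + 1) = H x + 1) ∧ ∀ x, H (F x) = H x + α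

open scoped ContDiff Nat

/-- A lift of an orientation-preserving smooth circle diffeomorphism, unbundled. -/
structure IsSmoothLift (F : ℝ → ℝ) : Prop where
  contDiff : ContDiff ℝ ∞ F
  deriv_pos : ∀ x, 0 < deriv F x
  map_add_one : ∀ x, F (x + 1) = F x + 1

/-- The nonlinearity, the derivative of the logarithm of the derivative. -/
noncomputable def nonlin (F : ℝ → ℝ) : ℝ → ℝ := deriv fun x => Real.log (deriv F x)

/-- The Schwarzian derivative. -/
noncomputable def schwarz (F : ℝ → ℝ) : ℝ → ℝ := fun x => deriv (nonlin F) x - nonlin F x ^ 2 / 2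

theorem contDiff_deriv_of_infty {F : ℝ → ℝ} (h : ContDiff ℝ ∞ F) : ContDiff ℝ ∞ (deriv F) :=
  (contDiff_infty_iff_deriv.1 h).2

theorem periodic_deriv {u : ℝ → ℝ} {c : ℝ} (h : ∀ x, u (x + 1) = u x + c) :
    Function.Periodic (deriv u) 1 := by
  intro x
  rw [← deriv_comp_add_const]
  simp only [h]
  simp

theorem periodic_iteratedDeriv {u : ℝ → ℝ} (h : Function.Periodic u 1) (n : ℕ) :
    Function.Periodic (iteratedDeriv n u) 1 := by
  induction n with
  | zero => simpa using h
  | succ n ih =>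
    rw [iteratedDeriv_succ]
    exact periodic_deriv (c := 0) (by simpa using ih)

theorem exists_bound_of_periodic {u : ℝ → ℝ} (hc : Continuous u) (h : Function.Periodic u 1) :
    ∃ C, 0 ≤ C ∧ ∀ x, |u x| ≤ C := by
  obtain ⟨C, hC⟩ := (isCompact_Icc (a := (0 : ℝ)) (b := 1)).exists_bound_of_continuousOn
    hc.continuousOn
  have hC' : ∀ x, |u x| ≤ C := by
    intro x
    obtain ⟨y, hy, hxy⟩ := h.exists_mem_Ico₀ one_pos x
    rw [hxy]
    exact hC y ⟨hy.1, hy.2.le⟩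
  exact ⟨C, (abs_nonneg _).trans (hC' 0), hC'⟩

theorem exists_max_of_periodic {u : ℝ → ℝ} (hc : Continuous u) (h : Function.Periodic u 1) :
    ∃ x, ∀ y, u y ≤ u x := by
  obtain ⟨x, -, hx⟩ := (isCompact_Icc (a := (0 : ℝ)) (b := 1)).exists_isMaxOn
    ⟨0, by simp⟩ hc.continuousOn
  refine ⟨x, fun y => ?_⟩
  obtain ⟨z, hz, hyz⟩ := h.exists_mem_Ico₀ one_pos y
  rw [hyz]
  exact hx ⟨hz.1, hz.2.le⟩

namespace IsSmoothLift

variable {F G : ℝ → ℝ}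

theorem differentiable (h : IsSmoothLift F) : Differentiable ℝ F :=
  h.contDiff.differentiable (by simp)

theorem continuous (h : IsSmoothLift F) : Continuous F := h.contDiff.continuous

theorem hasDerivAt (h : IsSmoothLift F) (x : ℝ) : HasDerivAt F (deriv F x) x :=
  (h.differentiable x).hasDerivAt

theorem strictMono (h : IsSmoothLift F) : StrictMono F := strictMono_of_deriv_pos h.deriv_pos

theorem contDiff_deriv (h : IsSmoothLift F) : ContDiff ℝ ∞ (deriv F) :=
  contDiff_deriv_of_infty h.contDiff

theorem periodic_deriv (h : IsSmoothLift F) : Function.Periodic (deriv F) 1 :=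
  _root_.periodic_deriv h.map_add_one

theorem id : IsSmoothLift (id : ℝ → ℝ) := ⟨contDiff_id, by simp, by simp⟩

theorem deriv_comp (hG : IsSmoothLift G) (hF : IsSmoothLift F) (x : ℝ) :
    deriv (G ∘ F) x = deriv G (F x) * deriv F x :=
  _root_.deriv_comp x (hG.differentiable _) (hF.differentiable _)

theorem comp (hG : IsSmoothLift G) (hF : IsSmoothLift F) : IsSmoothLift (G ∘ F) where
  contDiff := hG.contDiff.comp hF.contDiff
  deriv_pos x := by
    rw [deriv_comp hG hF]
    exact mul_pos (hG.deriv_pos _) (hF.deriv_pos _)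
  map_add_one x := by simp [hF.map_add_one, hG.map_add_one]

theorem iterate (hF : IsSmoothLift F) : ∀ n, IsSmoothLift (F^[n])
  | 0 => id
  | n + 1 => by
    rw [Function.iterate_succ]
    exact (iterate hF n).comp hF

theorem add_const (hF : IsSmoothLift F) (t : ℝ) : IsSmoothLift fun x => F x + t where
  contDiff := hF.contDiff.add contDiff_const
  deriv_pos x := by simpa using hF.deriv_pos x
  map_add_one x := by rw [hF.map_add_one]; ring

theorem map_add_nat (hF : IsSmoothLift F) (x : ℝ) (n : ℕ) : F (x + n) = F x + n := by
  induction n with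
  | zero => simp
  | succ n ih => push_cast; rw [← add_assoc, hF.map_add_one, ih, add_assoc]

theorem map_add_int (hF : IsSmoothLift F) (x : ℝ) (n : ℤ) : F (x + n) = F x + n := by
  obtain ⟨m, rfl | rfl⟩ := n.eq_nat_or_neg
  · simpa using hF.map_add_nat x m
  · have := hF.map_add_nat (x + ((-m : ℤ) : ℝ)) m
    push_cast at this ⊢
    rw [neg_add_cancel_right] at this
    linarith

theorem map_sub_int (hF : IsSmoothLift F) (x : ℝ) (n : ℤ) : F (x - n) = F x - n := by
  have := hF.map_add_int x (-n)
  push_cast at this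
  simpa [sub_eq_add_neg] using this

theorem contDiff_log_deriv (hF : IsSmoothLift F) :
    ContDiff ℝ ∞ fun x => Real.log (deriv F x) :=
  hF.contDiff_deriv.log fun x => (hF.deriv_pos x).ne'

theorem contDiff_nonlin (hF : IsSmoothLift F) : ContDiff ℝ ∞ (nonlin F) :=
  contDiff_deriv_of_infty hF.contDiff_log_deriv

theorem contDiff_schwarz (hF : IsSmoothLift F) : ContDiff ℝ ∞ (schwarz F) :=
  (contDiff_deriv_of_infty hF.contDiff_nonlin).sub ((hF.contDiff_nonlin.pow 2).div_const 2)

theorem periodic_nonlin (hF : IsSmoothLift F) : Function.Periodic (nonlin F) 1 :=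
  _root_.periodic_deriv (c := 0) fun x => by simp [hF.periodic_deriv x]

theorem periodic_schwarz (hF : IsSmoothLift F) : Function.Periodic (schwarz F) 1 := by
  intro x
  have h := _root_.periodic_deriv (u := nonlin F) (c := 0) (by simpa using hF.periodic_nonlin)
  simp [schwarz, hF.periodic_nonlin x, h x]

theorem deriv_deriv (hF : IsSmoothLift F) (x : ℝ) :
    deriv (deriv F) x = nonlin F x * deriv F x := by
  have h : HasDerivAt (fun x => Real.log (deriv F x)) (deriv (deriv F) x / deriv F x) x :=
    ((hF.contDiff_deriv.differentiable (by simp) x).hasDerivAt).log (hF.deriv_pos x).ne'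
  rw [nonlin, h.deriv]
  field_simp [(hF.deriv_pos x).ne']

theorem nonlin_comp (hG : IsSmoothLift G) (hF : IsSmoothLift F) (x : ℝ) :
    nonlin (G ∘ F) x = nonlin G (F x) * deriv F x + nonlin F x := by
  have h : (fun x => Real.log (deriv (G ∘ F) x)) =
      fun x => ((fun y => Real.log (deriv G y)) ∘ F) x + Real.log (deriv F x) := by
    ext y
    rw [deriv_comp hG hF, Real.log_mul (hG.deriv_pos _).ne' (hF.deriv_pos _).ne']
    rfl
  have h1 : DifferentiableAt ℝ (fun y => Real.log (deriv G y)) (F x) :=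
    hG.contDiff_log_deriv.differentiable (by simp) _
  rw [nonlin, h, deriv_fun_add (h1.comp x (hF.differentiable x))
    (hF.contDiff_log_deriv.differentiable (by simp) x), _root_.deriv_comp x h1 (hF.differentiable x)]
  rfl

theorem schwarz_comp (hG : IsSmoothLift G) (hF : IsSmoothLift F) (x : ℝ) :
    schwarz (G ∘ F) x = schwarz G (F x) * deriv F x ^ 2 + schwarz F x := by
  have h : nonlin (G ∘ F) = fun x => nonlin G (F x) * deriv F x + nonlin F x :=
    funext (nonlin_comp hG hF)
  have h1 : HasDerivAt (nonlin G) (deriv (nonlin G) (F x)) (F x) :=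
    (hG.contDiff_nonlin.differentiable (by simp) _).hasDerivAt
  have h2 : HasDerivAt (nonlin F) (deriv (nonlin F) x) x :=
    (hF.contDiff_nonlin.differentiable (by simp) _).hasDerivAt
  have h3 : HasDerivAt (deriv F) (nonlin F x * deriv F x) x := by
    rw [← hF.deriv_deriv]
    exact (hF.contDiff_deriv.differentiable (by simp) _).hasDerivAt
  have h4 := ((h1.comp x (hF.hasDerivAt x)).mul h3).add h2
  have h5 : deriv (nonlin (G ∘ F)) x = deriv (nonlin G) (F x) * deriv F x * deriv F x +
      nonlin G (F x) * (nonlin F x * deriv F x) + deriv (nonlin F) x := by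
    rw [h]
    exact h4.deriv
  rw [schwarz, h5, nonlin_comp hG hF, schwarz, schwarz]
  ring

theorem deriv_iterate_succ (hF : IsSmoothLift F) (n : ℕ) (x : ℝ) :
    deriv (F^[n + 1]) x = deriv F (F^[n] x) * deriv (F^[n]) x := by
  rw [Function.iterate_succ']
  exact deriv_comp hF (hF.iterate n) x

theorem deriv_iterate_add (hF : IsSmoothLift F) (m n : ℕ) (x : ℝ) :
    deriv (F^[m + n]) x = deriv (F^[m]) (F^[n] x) * deriv (F^[n]) x := by
  rw [Function.iterate_add]
  exact deriv_comp (hF.iterate m) (hF.iterate n) x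

theorem nonlin_iterate_add (hF : IsSmoothLift F) (m n : ℕ) (x : ℝ) :
    nonlin (F^[m + n]) x = nonlin (F^[m]) (F^[n] x) * deriv (F^[n]) x + nonlin (F^[n]) x := by
  rw [Function.iterate_add]
  exact nonlin_comp (hF.iterate m) (hF.iterate n) x

theorem nonlin_iterate (hF : IsSmoothLift F) (n : ℕ) (x : ℝ) :
    nonlin (F^[n]) x = ∑ j ∈ Finset.range n, nonlin F (F^[j] x) * deriv (F^[j]) x := by
  induction n with
  | zero => simp [nonlin]
  | succ n ih =>
    rw [Finset.sum_range_succ, add_comm n 1, hF.nonlin_iterate_add, ih, Function.iterate_one]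
    ring

theorem schwarz_iterate (hF : IsSmoothLift F) (n : ℕ) (x : ℝ) :
    schwarz (F^[n]) x = ∑ j ∈ Finset.range n, schwarz F (F^[j] x) * deriv (F^[j]) x ^ 2 := by
  induction n with
  | zero => simp [nonlin, schwarz]
  | succ n ih =>
    rw [Finset.sum_range_succ, Function.iterate_succ', schwarz_comp hF (hF.iterate n), ih]
    ring

theorem log_deriv_iterate (hF : IsSmoothLift F) (n : ℕ) (x : ℝ) :
    Real.log (deriv (F^[n]) x) = ∑ j ∈ Finset.range n, Real.log (deriv F (F^[j] x)) := by
  induction n with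
  | zero => simp
  | succ n ih =>
    rw [Finset.sum_range_succ, hF.deriv_iterate_succ, Real.log_mul (hF.deriv_pos _).ne'
      ((hF.iterate n).deriv_pos _).ne', ih]
    ring

/-- If the first `n` images of `[a, b]` have total length at most `A` then the distortion of
`F^[i]`, `i ≤ n`, on `[a, b]` is at most `exp (L * A)`. -/
theorem distortion (hF : IsSmoothLift F) {L A : ℝ} (hL : ∀ x, |nonlin F x| ≤ L) {n i : ℕ}
    (hi : i ≤ n) {a b : ℝ} (hA : ∑ j ∈ Finset.range n, (F^[j] b - F^[j] a) ≤ A) {y z : ℝ}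
    (hy : y ∈ Set.Icc a b) (hz : z ∈ Set.Icc a b) :
    deriv (F^[i]) y ≤ Real.exp (L * A) * deriv (F^[i]) z := by
  have hL0 : 0 ≤ L := (abs_nonneg _).trans (hL 0)
  have hlip : ∀ u v, |Real.log (deriv F u) - Real.log (deriv F v)| ≤ L * |u - v| := by
    intro u v
    have := Convex.norm_image_sub_le_of_norm_deriv_le (f := fun x => Real.log (deriv F x))
      (C := L) (s := Set.univ) (x := v) (y := u)
      (fun x _ => hF.contDiff_log_deriv.differentiable (by simp) x)
      (fun x _ => by simpa [nonlin] using hL x) convex_univ trivial trivial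
    simpa using this
  have key : Real.log (deriv (F^[i]) y) - Real.log (deriv (F^[i]) z) ≤ L * A := by
    rw [hF.log_deriv_iterate, hF.log_deriv_iterate, ← Finset.sum_sub_distrib]
    calc _ ≤ ∑ j ∈ Finset.range i, L * (F^[j] b - F^[j] a) := by
          refine Finset.sum_le_sum fun j _ => (le_abs_self _).trans ((hlip _ _).trans ?_)
          have hm := (hF.iterate j).strictMono.monotone
          have h1 := hm hy.1
          have h2 := hm hy.2
          have h3 := hm hz.1
          have h4 := hm hz.2
          exact mul_le_mul_of_nonneg_left (abs_sub_le_iff.2 ⟨by linarith, by linarith⟩) hL0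
      _ ≤ ∑ j ∈ Finset.range n, L * (F^[j] b - F^[j] a) := by
          refine Finset.sum_le_sum_of_subset_of_nonneg (by simpa using hi) fun j _ _ => ?_
          have := (hF.iterate j).strictMono.monotone (hy.1.trans hy.2)
          exact mul_nonneg hL0 (by linarith)
      _ ≤ L * A := by
          rw [← Finset.mul_sum]
          exact mul_le_mul_of_nonneg_left hA hL0
  have h1 := (hF.iterate i).deriv_pos y
  have h2 := (hF.iterate i).deriv_pos z
  rw [← Real.exp_log h1, ← Real.exp_log h2, ← Real.exp_add]
  exact Real.exp_le_exp.2 (by linarith)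

/-- Mean value form of `distortion`. -/
theorem distortion_length (hF : IsSmoothLift F) {L A : ℝ} (hL : ∀ x, |nonlin F x| ≤ L) {n i : ℕ}
    (hi : i ≤ n) {a b : ℝ} (hA : ∑ j ∈ Finset.range n, (F^[j] b - F^[j] a) ≤ A) {y u v : ℝ}
    (hy : y ∈ Set.Icc a b) (hu : a ≤ u) (huv : u ≤ v) (hv : v ≤ b) :
    deriv (F^[i]) y * (v - u) ≤ Real.exp (L * A) * (F^[i] v - F^[i] u) ∧
      F^[i] v - F^[i] u ≤ Real.exp (L * A) * (deriv (F^[i]) y * (v - u)) := by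
  rcases huv.eq_or_lt with rfl | huv
  · simp
  obtain ⟨z, hz, hzd⟩ := exists_deriv_eq_slope (F^[i]) huv
    (hF.iterate i).continuous.continuousOn (hF.iterate i).differentiable.differentiableOn
  have h0 : 0 < v - u := sub_pos.2 huv
  have hz' : z ∈ Set.Icc a b := ⟨hu.trans hz.1.le, hz.2.le.trans hv⟩
  have h1 := hF.distortion hL hi hA hy hz'
  have h2 := hF.distortion hL hi hA hz' hy
  have h3 : F^[i] v - F^[i] u = deriv (F^[i]) z * (v - u) := by
    rw [hzd]; field_simp
  rw [h3]
  constructor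
  · calc _ ≤ Real.exp (L * A) * deriv (F^[i]) z * (v - u) :=
        mul_le_mul_of_nonneg_right h1 h0.le
      _ = _ := by ring
  · calc _ ≤ Real.exp (L * A) * deriv (F^[i]) y * (v - u) :=
        mul_le_mul_of_nonneg_right h2 h0.le
      _ = _ := by ring

end IsSmoothLift

/-- An ordered, `q`-periodic orbit of rotation number `p / q` of the lift `F`. -/
structure IsOrbit (F : ℝ → ℝ) (p : ℤ) (q : ℕ) (x : ℤ → ℝ) : Prop where
  lift : IsSmoothLift F
  pos : 0 < q
  coprime : IsCoprime p (q : ℤ)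
  lt_succ : ∀ k, x k < x (k + 1)
  add_q : ∀ k, x (k + q) = x k + 1
  map : ∀ k, F (x k) = x (k + p)

/-- Length of the `k`-th gap. -/
def gap (x : ℤ → ℝ) (k : ℤ) : ℝ := x (k + 1) - x k

namespace IsOrbit

variable {F : ℝ → ℝ} {p : ℤ} {q : ℕ} {x : ℤ → ℝ}

theorem strictMono (h : IsOrbit F p q x) : StrictMono x := strictMono_int_of_lt_succ h.lt_succ

theorem gap_pos (h : IsOrbit F p q x) (k : ℤ) : 0 < gap x k := sub_pos.2 (h.lt_succ k)

theorem add_mul_q (h : IsOrbit F p q x) (k m : ℤ) : x (k + m * q) = x k + m := by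
  induction m using Int.induction_on with
  | zero => simp
  | succ i ih =>
    have := h.add_q (k + i * q)
    rw [ih] at this
    rw [show k + ((i : ℤ) + 1) * q = k + i * q + q by ring, this]
    push_cast; ring
  | pred i ih =>
    have := h.add_q (k + (-(i : ℤ) - 1) * q)
    rw [show k + (-(i : ℤ) - 1) * q + q = k + (-i) * q by ring, ih] at this
    push_cast at this ⊢
    linarith

theorem iterate (h : IsOrbit F p q x) (i : ℕ) (k : ℤ) : F^[i] (x k) = x (k + i * p) := by
  induction i with
  | zero => simp
  | succ i ih =>
    rw [Function.iterate_succ_apply', ih, h.map]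
    congr 1
    push_cast; ring

theorem gap_add_mul_q (h : IsOrbit F p q x) (k m : ℤ) : gap x (k + m * q) = gap x k := by
  have := h.add_mul_q (k + 1) m
  rw [gap, show k + m * q + 1 = k + 1 + m * q by ring, this, h.add_mul_q, gap]
  ring

theorem gap_eq_of_modEq (h : IsOrbit F p q x) {k l : ℤ} (hkl : k ≡ l [ZMOD q]) :
    gap x k = gap x l := by
  obtain ⟨m, hm⟩ := hkl.dvd
  rw [show l = k + m * q by linarith, h.gap_add_mul_q]

theorem sum_gap_le_one (h : IsOrbit F p q x) {ι : Type*} (S : Finset ι) (k : ι → ℤ)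
    (hk : ∀ i ∈ S, ∀ j ∈ S, k i ≡ k j [ZMOD q] → i = j) : ∑ i ∈ S, gap x (k i) ≤ 1 := by
  have hq : (0 : ℤ) < q := by exact_mod_cast h.pos
  have h1 : ∑ i ∈ S, gap x (k i) = ∑ i ∈ S, gap x ((k i % q).toNat : ℕ) := by
    refine Finset.sum_congr rfl fun i _ => ?_
    rw [Int.toNat_of_nonneg (Int.emod_nonneg _ hq.ne')]
    exact h.gap_eq_of_modEq (Int.mod_modEq _ _).symm
  have hinj : Set.InjOn (fun i => (k i % q).toNat) S := by
    intro i hi j hj hij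
    refine hk i hi j hj ?_
    have a := Int.toNat_of_nonneg (Int.emod_nonneg (k i) hq.ne')
    have b := Int.toNat_of_nonneg (Int.emod_nonneg (k j) hq.ne')
    have : (k i % q).toNat = (k j % q).toNat := hij
    show k i % q = k j % q
    rw [← a, ← b, this]
  rw [h1, ← Finset.sum_image (f := fun r : ℕ => gap x (r : ℤ)) hinj]
  calc _ ≤ ∑ r ∈ Finset.range q, gap x (r : ℤ) := by
        refine Finset.sum_le_sum_of_subset_of_nonneg ?_ fun _ _ _ => (h.gap_pos _).le
        intro r hr
        obtain ⟨i, -, rfl⟩ := Finset.mem_image.1 hr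
        have a := Int.emod_nonneg (k i) hq.ne'
        have b := Int.emod_lt_of_pos (k i) hq
        simp only [Finset.mem_range]
        omega
    _ = 1 := by
        have := Finset.sum_range_sub (fun r : ℕ => x (r : ℤ)) q
        simp only [gap]
        push_cast at this
        rw [this]
        have := h.add_q 0
        simp only [zero_add] at this
        rw [this]; simp

theorem sub_eq_sum_gap (x : ℤ → ℝ) (k : ℤ) (d : ℕ) :
    x (k + d) - x k = ∑ s ∈ Finset.range d, gap x (k + s) := by
  have := Finset.sum_range_sub (fun r : ℕ => x (k + r)) d
  simp only [gap]
  push_cast at this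
  simp only [add_zero] at this
  rw [← this]
  exact Finset.sum_congr rfl fun s _ => by rw [add_assoc]

theorem sum_arc_le_one (h : IsOrbit F p q x) {N d : ℕ} (hd : d ≤ q)
    (hN : ∀ i : ℕ, 0 < i → i < N → ∀ m : ℤ, (d : ℤ) ≤ |i * p - m * q|) (k : ℤ) :
    ∑ i ∈ Finset.range N, (x (k + i * p + d) - x (k + i * p)) ≤ 1 := by
  have h1 : ∑ i ∈ Finset.range N, (x (k + i * p + d) - x (k + i * p)) =
      ∑ a ∈ Finset.range N ×ˢ Finset.range d, gap x (k + a.1 * p + a.2) := by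
    rw [Finset.sum_product]
    exact Finset.sum_congr rfl fun i _ => sub_eq_sum_gap x _ d
  rw [h1]
  refine h.sum_gap_le_one _ _ ?_
  rintro ⟨i, s⟩ hi ⟨j, t⟩ hj hij
  simp only [Finset.mem_product, Finset.mem_range] at hi hj
  obtain ⟨m, hm⟩ := hij.dvd
  simp only at hm
  rcases lt_trichotomy i j with hlt | heq | hlt
  · have := hN (j - i) (by omega) (by omega) m
    rw [Nat.cast_sub hlt.le, show ((j : ℤ) - i) * p - m * q = (s : ℤ) - t by linarith] at this
    have : |(s : ℤ) - t| < d := by rw [abs_lt]; constructor <;> omega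
    omega
  · subst heq
    have h2 : (t : ℤ) - s = q * m := by linarith
    have h3 : |(q : ℤ) * m| < q := by rw [← h2, abs_lt]; constructor <;> omega
    rw [abs_mul, Nat.abs_cast] at h3
    have h4 : |m| < 1 := by
      by_contra hc
      have : (q : ℤ) * 1 ≤ q * |m| := by
        apply mul_le_mul_of_nonneg_left (by omega) (by omega)
      omega
    have h5 : m = 0 := by simpa using Int.abs_lt_one_iff.1 h4
    rw [h5] at h2
    simp only [Prod.mk.injEq, true_and]
    omega
  · have := hN (i - j) (by omega) (by omega) (-m)
    rw [Nat.cast_sub hlt.le, show ((i : ℤ) - j) * p - -m * q = (t : ℤ) - s by linarith] at this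
    have : |(t : ℤ) - s| < d := by rw [abs_lt]; constructor <;> omega
    omega

theorem one_le_abs (h : IsOrbit F p q x) {i : ℕ} (hi : 0 < i) (hiq : i < q) (m : ℤ) :
    1 ≤ |i * p - m * q| := by
  refine Int.one_le_abs fun h0 => ?_
  have hdvd : (q : ℤ) ∣ i * p := ⟨m, by linarith⟩
  have := (h.coprime.symm.dvd_of_dvd_mul_right hdvd)
  have := Int.le_of_dvd (by omega) this
  omega

theorem exists_mem_gap (h : IsOrbit F p q x) (y : ℝ) : ∃ k, x k ≤ y ∧ y < x (k + 1) := by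
  obtain ⟨k, hk, hmax⟩ := Int.exists_greatest_of_bdd (P := fun k => x k ≤ y)
    ⟨(⌊y - x 0⌋ + 1) * q, fun z hz => by
      have h1 := h.add_mul_q 0 (⌊y - x 0⌋ + 1)
      rw [zero_add] at h1
      have h2 := Int.lt_floor_add_one (y - x 0)
      push_cast at h1
      exact (h.strictMono.lt_iff_lt.1 (by linarith : x z < x ((⌊y - x 0⌋ + 1) * q))).le⟩
    ⟨⌊y - x 0⌋ * q, by
      have h1 := h.add_mul_q 0 ⌊y - x 0⌋
      rw [zero_add] at h1
      have h2 := Int.floor_le (y - x 0)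
      linarith⟩
  exact ⟨k, hk, by_contra fun hc => by have := hmax (k + 1) (not_lt.1 hc); omega⟩

theorem sum_images_gap (h : IsOrbit F p q x) (k : ℤ) :
    ∑ j ∈ Finset.range q, (F^[j] (x (k + 1)) - F^[j] (x k)) ≤ 1 := by
  have := h.sum_arc_le_one (N := q) (d := 1) h.pos (fun i hi hiq m => by
    simpa using h.one_le_abs hi hiq m) k
  refine le_of_eq_of_le (Finset.sum_congr rfl fun j _ => ?_) this
  rw [h.iterate, h.iterate]
  push_cast
  rw [show k + 1 + j * p = k + j * p + 1 by ring]

theorem deriv_mul_gap_le (h : IsOrbit F p q x) {L : ℝ} (hL : ∀ x, |nonlin F x| ≤ L) {i : ℕ}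
    (hi : i ≤ q) {k : ℤ} {y : ℝ} (hy : y ∈ Set.Icc (x k) (x (k + 1))) :
    deriv (F^[i]) y * gap x k ≤ Real.exp L * gap x (k + i * p) ∧
      gap x (k + i * p) ≤ Real.exp L * (deriv (F^[i]) y * gap x k) := by
  have := h.lift.distortion_length hL hi (h.sum_images_gap k) hy le_rfl
    (h.lt_succ k).le le_rfl
  rw [h.iterate, h.iterate, mul_one, show k + 1 + i * p = k + i * p + 1 by ring] at this
  exact this

theorem sum_gap_orbit_le_one (h : IsOrbit F p q x) (k : ℤ) :
    ∑ i ∈ Finset.range q, gap x (k + i * p) ≤ 1 := by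
  refine le_of_eq_of_le (Finset.sum_congr rfl fun j _ => ?_) (h.sum_images_gap k)
  rw [h.iterate, h.iterate, gap, show k + 1 + j * p = k + j * p + 1 by ring]

end IsOrbit

namespace IsSmoothLift

variable {G : ℝ → ℝ}

theorem abs_log_deriv_sub_le (hG : IsSmoothLift G) {U : ℝ} (hU : ∀ x, |nonlin G x| ≤ U) (u v : ℝ) :
    |Real.log (deriv G u) - Real.log (deriv G v)| ≤ U * |u - v| := by
  have := Convex.norm_image_sub_le_of_norm_deriv_le (f := fun x => Real.log (deriv G x))
    (C := U) (s := Set.univ) (x := v) (y := u)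
    (fun x _ => hG.contDiff_log_deriv.differentiable (by simp) x)
    (fun x _ => by simpa [nonlin] using hU x) convex_univ trivial trivial
  simpa using this

theorem inv_sqrt_step (hG : IsSmoothLift G) {U : ℝ} (hU0 : 0 < U) (hU : ∀ x, |nonlin G x| ≤ U)
    (hpos : ∀ y, y < G y) (y : ℝ) :
    1 / √(G y - y) ≤ 1 / √(G (G y) - G y) + 3 / 2 * √U := by
  set a := G y - y with ha
  set a' := G (G y) - G y with ha'
  have ha0 : 0 < a := sub_pos.2 (hpos y)
  have ha'0 : 0 < a' := sub_pos.2 (hpos (G y))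
  set s := √(U * a) with hs
  have hs2 : s ^ 2 = U * a := Real.sq_sqrt (by positivity)
  have hs0 : 0 ≤ s := Real.sqrt_nonneg _
  have hsa : s / √a = √U := by
    rw [hs, Real.sqrt_mul hU0.le]
    field_simp
  have hsqa : 0 < √a := Real.sqrt_pos.2 ha0
  have hsqa' : 0 < √a' := Real.sqrt_pos.2 ha'0
  rcases le_total 1 s with h1 | h1
  · have : 1 / √a ≤ s / √a := by gcongr
    have h3 : 0 ≤ 1 / √a' := by positivity
    have := Real.sqrt_nonneg U
    linarith
  set κ := Real.log (deriv G y) with hκ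
  have hκs : κ ≤ 2 * s := by
    rcases le_or_gt κ 0 with h0 | h0
    · linarith
    have hlt : y - κ / (2 * U) < y := by
      have : 0 < κ / (2 * U) := by positivity
      linarith
    have hd : Differentiable ℝ fun z => G z - z := hG.differentiable.sub differentiable_id
    obtain ⟨z, hz, hzd⟩ := exists_deriv_eq_slope (fun z => G z - z) hlt hd.continuous.continuousOn
      hd.differentiableOn
    have hdz : deriv (fun z => G z - z) z = deriv G z - 1 := by
      rw [deriv_fun_sub (hG.differentiable z) differentiableAt_fun_id]
      simp
    have hlz : κ / 2 ≤ Real.log (deriv G z) := by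
      have h2 := (abs_le.1 (hG.abs_log_deriv_sub_le hU z y)).1
      have h3 : |z - y| ≤ κ / (2 * U) := by
        rw [abs_of_nonpos (by linarith [hz.2])]
        linarith [hz.1]
      have h4 : U * |z - y| ≤ κ / 2 := by
        calc _ ≤ U * (κ / (2 * U)) := by gcongr
          _ = κ / 2 := by field_simp
      linarith
    have hge : κ / 2 ≤ deriv G z - 1 :=
      hlz.trans (Real.log_le_sub_one_of_pos (hG.deriv_pos z))
    rw [hdz] at hzd
    have hp := hpos (y - κ / (2 * U))
    have h5 : κ / 2 * (κ / (2 * U)) ≤ a := by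
      have hk : 0 < κ / (2 * U) := by positivity
      have h6 : (deriv G z - 1) * (κ / (2 * U)) =
          a - (G (y - κ / (2 * U)) - (y - κ / (2 * U))) := by
        rw [hzd, sub_sub_cancel]
        field_simp
        rw [ha]
        ring
      have h7 : κ / 2 * (κ / (2 * U)) ≤ (deriv G z - 1) * (κ / (2 * U)) := by gcongr
      linarith
    have h8 : κ ^ 2 ≤ (2 * s) ^ 2 := by
      rw [mul_pow, hs2]
      have h9 : κ / 2 * (κ / (2 * U)) * (4 * U) = κ ^ 2 := by field_simp; ring
      nlinarith
    exact (abs_le_of_sq_le_sq' h8 (by positivity)).2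
  obtain ⟨z, hz, hzd⟩ := exists_deriv_eq_slope G (hpos y) hG.continuous.continuousOn
    hG.differentiable.differentiableOn
  have hlz : Real.log (deriv G z) ≤ 3 * s := by
    have h2 := (abs_le.1 (hG.abs_log_deriv_sub_le hU z y)).2
    have h3 : |z - y| ≤ a := by
      rw [abs_of_nonneg (by linarith [hz.1])]
      linarith [hz.2]
    have h4 : U * |z - y| ≤ s := by
      calc _ ≤ U * a := by gcongr
        _ ≤ s := by rw [← hs2]; nlinarith
    linarith
  have hder : deriv G z ≤ Real.exp (3 * s) := by
    rw [← Real.exp_log (hG.deriv_pos z)]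
    exact Real.exp_le_exp.2 hlz
  have haa : a' ≤ a * Real.exp (3 * s) := by
    rw [hzd, div_le_iff₀ ha0] at hder
    linarith
  have hsq : √a' ≤ √a * Real.exp (3 / 2 * s) := by
    rw [← Real.sqrt_sq (Real.exp_pos (3 / 2 * s)).le, ← Real.sqrt_mul ha0.le]
    apply Real.sqrt_le_sqrt
    rw [← Real.exp_nat_mul]
    convert haa using 3
    push_cast; ring
  have he : 1 - 3 / 2 * s ≤ Real.exp (-(3 / 2 * s)) := by
    have := Real.add_one_le_exp (-(3 / 2 * s))
    linarith
  have h10 : Real.exp (-(3 / 2 * s)) / √a ≤ 1 / √a' := by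
    rw [div_le_div_iff₀ hsqa hsqa', Real.exp_neg]
    calc _ ≤ (Real.exp (3 / 2 * s))⁻¹ * (√a * Real.exp (3 / 2 * s)) := by gcongr
      _ = 1 * √a := by field_simp
  have h11 : (1 - 3 / 2 * s) / √a ≤ 1 / √a' := by
    refine le_trans ?_ h10
    gcongr
  have h12 : (1 - 3 / 2 * s) / √a = 1 / √a - 3 / 2 * √U := by
    rw [← hsa]; ring
  linarith

/-- If `T` steps of `G` cover a length `A`, the first step cannot be too short. -/
theorem inv_sqrt_march (hG : IsSmoothLift G) {U : ℝ} (hU0 : 0 < U) (hU : ∀ x, |nonlin G x| ≤ U)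
    (hpos : ∀ y, y < G y) (y : ℝ) {T : ℕ} (hT : 0 < T) {A : ℝ} (hA0 : 0 < A)
    (hA : A ≤ G^[T] y - y) :
    1 / √(G y - y) ≤ √(T / A) + 3 / 2 * T * √U := by
  have hstep : ∀ i, 1 / √(G y - y) ≤ 1 / √(G^[i + 1] y - G^[i] y) + 3 / 2 * i * √U := by
    intro i
    induction i with
    | zero => simp
    | succ i ih =>
      have := hG.inv_sqrt_step hU0 hU hpos (G^[i] y)
      simp only [Function.iterate_succ_apply'] at ih ⊢
      push_cast
      linarith
  have hsum : A ≤ ∑ i ∈ Finset.range T, (G^[i + 1] y - G^[i] y) := by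
    rw [Finset.sum_range_sub (fun i => G^[i] y)]
    simpa using hA
  obtain ⟨i, hi, hiA⟩ : ∃ i ∈ Finset.range T, A / T ≤ G^[i + 1] y - G^[i] y := by
    refine Finset.exists_le_of_sum_le ⟨0, by simpa using hT⟩ ?_
    rw [Finset.sum_const, Finset.card_range, nsmul_eq_mul]
    have : (T : ℝ) ≠ 0 := by positivity
    field_simp
    exact hsum
  have hT' : (0 : ℝ) < T := by exact_mod_cast hT
  have h1 : 1 / √(G^[i + 1] y - G^[i] y) ≤ √(T / A) := by
    rw [one_div, ← Real.sqrt_inv]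
    apply Real.sqrt_le_sqrt
    rw [← inv_div]
    exact inv_anti₀ (by positivity) hiA
  have h2 : (i : ℝ) ≤ T := by exact_mod_cast (Finset.mem_range.1 hi).le
  have h3 : 3 / 2 * (i : ℝ) * √U ≤ 3 / 2 * T * √U := by gcongr
  linarith [hstep i]

theorem reflect (hG : IsSmoothLift G) : IsSmoothLift fun x => -G (-x) where
  contDiff := (hG.contDiff.comp contDiff_neg).neg
  deriv_pos x := by
    have : deriv (fun x => -G (-x)) x = deriv G (-x) := by
      rw [deriv.fun_neg, deriv_comp_neg]; simp
    rw [this]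
    exact hG.deriv_pos _
  map_add_one x := by
    have := hG.map_sub_int (-x) 1
    rw [neg_add, ← sub_eq_add_neg]
    push_cast at this
    rw [this]; ring

theorem nonlin_reflect (G : ℝ → ℝ) (x : ℝ) : nonlin (fun x => -G (-x)) x = -nonlin G (-x) := by
  have : (fun x => Real.log (deriv (fun x => -G (-x)) x)) =
      fun x => (fun y => Real.log (deriv G y)) (-x) := by
    ext x
    rw [deriv.fun_neg, deriv_comp_neg]; simp
  rw [nonlin, this, deriv_comp_neg (f := fun y => Real.log (deriv G y))]
  rfl

theorem nonlin_add_const (G : ℝ → ℝ) (t : ℝ) : nonlin (fun x => G x + t) = nonlin G := by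
  simp only [nonlin, deriv_add_const]

theorem schwarz_add_const (G : ℝ → ℝ) (t : ℝ) : schwarz (fun x => G x + t) = schwarz G := by
  unfold schwarz
  rw [nonlin_add_const]

end IsSmoothLift

namespace IsOrbit

variable {F : ℝ → ℝ} {p : ℤ} {q : ℕ} {x : ℤ → ℝ}

theorem exists_return_time (h : IsOrbit F p q x) {d : ℕ} (hd : 2 ≤ d) (hdq : d ≤ q) :
    ∃ (n : ℕ) (m : ℤ), n ≤ q ∧ 0 < |n * p - m * q| ∧ 2 * |n * p - m * q| ≤ d ∧
      ∀ i : ℕ, 0 < i → i < n → ∀ m : ℤ, (d : ℤ) < 2 * |i * p - m * q| := by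
  have hq : (0 : ℤ) < q := by exact_mod_cast h.pos
  have hex : ∃ n : ℕ, n ≤ q ∧ ∃ m : ℤ, 0 < |n * p - m * q| ∧ 2 * |n * p - m * q| ≤ d := by
    obtain ⟨a, b, hab⟩ := h.coprime
    refine ⟨(a % q).toNat, ?_, -b - (a / q) * p, ?_⟩
    · have := Int.emod_lt_of_pos a hq
      omega
    · have h1 := Int.toNat_of_nonneg (Int.emod_nonneg a hq.ne')
      have h2 := Int.emod_add_mul_ediv a q
      have h3 : ((a % q).toNat : ℤ) * p - (-b - (a / q) * p) * q = 1 := by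
        rw [h1, ← hab]
        linear_combination p * h2
      rw [h3]
      norm_num
      exact_mod_cast hd
  classical
  obtain ⟨hn, m, hm⟩ := Nat.find_spec hex
  refine ⟨Nat.find hex, m, hn, hm.1, hm.2, fun i hi hin m' => ?_⟩
  have h1 := Nat.find_min hex hin
  have h2 := h.one_le_abs hi (lt_of_lt_of_le hin hn) m'
  by_contra hc
  exact h1 ⟨by omega, m', by omega, by omega⟩

theorem abs_nonlin_iterate_le (h : IsOrbit F p q x) {L : ℝ} (hL0 : 0 < L)
    (hL : ∀ x, |nonlin F x| ≤ L) {d : ℕ} (hd : 2 ≤ d) (hdq : d ≤ q) {n : ℕ}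
    (hn : ∀ i : ℕ, 0 < i → i < n → ∀ m : ℤ, (d : ℤ) < 2 * |i * p - m * q|) {μ : ℝ} (hμ0 : 0 < μ)
    (hμ : ∀ k, μ ≤ x (k + d) - x k) (y : ℝ) :
    |nonlin (F^[n]) y| ≤ L * (2 * Real.exp (L * 2) / μ) := by
  obtain ⟨k, hk1, hk2⟩ := h.exists_mem_gap y
  have hy : y ∈ Set.Icc (x k) (x (k + d)) :=
    ⟨hk1, hk2.le.trans (h.strictMono.monotone (by omega))⟩
  have hsum : ∑ i ∈ Finset.range n, (F^[i] (x (k + d)) - F^[i] (x k)) ≤ 2 := by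
    have harc := h.sum_arc_le_one (N := n) (d := d / 2 + 1) (by omega) (fun i hi hin m => by
      have := hn i hi hin m
      push_cast
      omega)
    calc _ ≤ ∑ i ∈ Finset.range n,
          ((x (k + i * p + (d / 2 + 1 : ℕ)) - x (k + i * p)) +
          (x (k + (d / 2 + 1 : ℕ) + i * p + (d / 2 + 1 : ℕ)) - x (k + (d / 2 + 1 : ℕ) + i * p))) := by
          refine Finset.sum_le_sum fun i _ => ?_
          rw [h.iterate, h.iterate, add_right_comm k (i * p)]
          have : x (k + d + i * p) ≤ x (k + (d / 2 + 1 : ℕ) + i * p + (d / 2 + 1 : ℕ)) :=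
            h.strictMono.monotone (by omega)
          linarith
      _ ≤ 2 := by
          rw [Finset.sum_add_distrib]
          linarith [harc k, harc (k + (d / 2 + 1 : ℕ))]
  have hD : ∑ i ∈ Finset.range n, deriv (F^[i]) y ≤ 2 * Real.exp (L * 2) / μ := by
    rw [le_div_iff₀ hμ0, Finset.sum_mul]
    calc _ ≤ ∑ i ∈ Finset.range n,
          Real.exp (L * 2) * (F^[i] (x (k + d)) - F^[i] (x k)) := by
          refine Finset.sum_le_sum fun i hi => ?_
          refine le_trans ?_ (h.lift.distortion_length hL (Finset.mem_range.1 hi).le hsum hy le_rfl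
            (h.strictMono.monotone (by omega : k ≤ k + d)) le_rfl).1
          exact mul_le_mul_of_nonneg_left (hμ k) ((h.lift.iterate i).deriv_pos y).le
      _ ≤ 2 * Real.exp (L * 2) := by
          rw [← Finset.mul_sum, mul_comm]
          gcongr
  rw [h.lift.nonlin_iterate]
  calc _ ≤ ∑ j ∈ Finset.range n, |nonlin F (F^[j] y) * deriv (F^[j]) y| :=
        Finset.abs_sum_le_sum_abs _ _
    _ ≤ ∑ j ∈ Finset.range n, L * deriv (F^[j]) y := by
        refine Finset.sum_le_sum fun j _ => ?_
        rw [abs_mul, abs_of_pos ((h.lift.iterate j).deriv_pos y)]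
        exact mul_le_mul_of_nonneg_right (hL _) ((h.lift.iterate j).deriv_pos y).le
    _ ≤ _ := by
        rw [← Finset.mul_sum]
        gcongr

theorem lt_of_shift {G : ℝ → ℝ} (h : IsOrbit F p q x) (hG : StrictMono G) {e : ℤ} (he : 0 < e)
    (hGx : ∀ k, G (x k) = x (k + e)) (y : ℝ) : y < G y := by
  obtain ⟨k, hk1, hk2⟩ := h.exists_mem_gap y
  have h1 := hG.monotone hk1
  rw [hGx] at h1
  have h2 : x (k + 1) ≤ x (k + e) := h.strictMono.monotone (by omega)
  linarith

theorem gt_of_shift {G : ℝ → ℝ} (h : IsOrbit F p q x) (hG : StrictMono G) {e : ℤ} (he : e < 0)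
    (hGx : ∀ k, G (x k) = x (k + e)) (y : ℝ) : G y < y := by
  obtain ⟨k, hk1, hk2⟩ := h.exists_mem_gap y
  have h1 := hG hk2
  rw [hGx] at h1
  have h2 : x (k + 1 + e) ≤ x k := h.strictMono.monotone (by omega)
  linarith

theorem iterate_shift {G : ℝ → ℝ} {x : ℤ → ℝ} {e : ℤ} (hGx : ∀ k, G (x k) = x (k + e)) (i : ℕ)
    (k : ℤ) : G^[i] (x k) = x (k + i * e) := by
  induction i with
  | zero => simp
  | succ i ih =>
    rw [Function.iterate_succ_apply', ih, hGx]
    congr 1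
    push_cast; ring

theorem halving_march (h : IsOrbit F p q x) {L : ℝ} (hL0 : 0 < L)
    (hL : ∀ x, |nonlin F x| ≤ L) {d : ℕ} (hd : 2 ≤ d) (hdq : d ≤ q) {μ : ℝ} (hμ0 : 0 < μ)
    (hμ : ∀ k, μ ≤ x (k + d) - x k) :
    ∃ d' : ℕ, 1 ≤ d' ∧ 2 * d' ≤ d ∧ ∀ (T : ℕ), d ≤ T * d' → ∀ k,
      1 / √(x (k + d') - x k) ≤ √(T / μ) + 3 / 2 * T * √(L * (2 * Real.exp (L * 2) / μ)) := by
  obtain ⟨n, m, hnq, hpos, hle, hmin⟩ := h.exists_return_time hd hdq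
  have hUn := h.abs_nonlin_iterate_le hL0 hL hd hdq hmin hμ0 hμ
  set U := L * (2 * Real.exp (L * 2) / μ) with hU
  have hU0 : 0 < U := by positivity
  set e := n * p - m * q with he
  have hG : IsSmoothLift fun z => F^[n] z + ((-m : ℤ) : ℝ) := (h.lift.iterate n).add_const _
  set G := fun z => F^[n] z + ((-m : ℤ) : ℝ) with hGdef
  have hGU : ∀ y, |nonlin G y| ≤ U := by
    intro y
    rw [hGdef, IsSmoothLift.nonlin_add_const]
    exact hUn y
  have hGx : ∀ k, G (x k) = x (k + e) := by
    intro k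
    simp only [hGdef]
    rw [h.iterate, ← h.add_mul_q]
    congr 1
    rw [he]; ring
  have habs := Int.abs_eq_natAbs e
  refine ⟨e.natAbs, by omega, by omega, fun T hT k => ?_⟩
  have hT0 : 0 < T := by
    rcases Nat.eq_zero_or_pos T with rfl | h0
    · simp at hT; omega
    · exact h0
  rcases lt_or_gt_of_ne (abs_pos.1 hpos) with hneg | hpos'
  · have hval : (e.natAbs : ℤ) = -e := by omega
    have hm := hG.reflect.inv_sqrt_march hU0 (fun y => by
        rw [IsSmoothLift.nonlin_reflect, abs_neg]; exact hGU _)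
      (fun y => by linarith [h.gt_of_shift hG.strictMono hneg hGx (-y)]) (-x (k + -e)) hT0 hμ0 ?_
    · simp only [neg_neg] at hm
      rw [hGx, neg_add_cancel_right] at hm
      rw [hval]
      convert hm using 3
      ring_nf
    · have h1 : ∀ i : ℕ, (fun z => -G (-z))^[i] (-x (k + -e)) = -G^[i] (x (k + -e)) := by
        intro i
        induction i with
        | zero => simp
        | succ i ih =>
          rw [Function.iterate_succ_apply', ih, Function.iterate_succ_apply', neg_neg]
      rw [h1, iterate_shift hGx]
      have h2 := hμ (k + -e + T * e)
      have h3 : x (k + -e + T * e + d) ≤ x (k + -e) := by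
        apply h.strictMono.monotone
        have : (d : ℤ) ≤ T * (-e) := by rw [← hval]; exact_mod_cast hT
        linarith
      linarith
  · have hval : (e.natAbs : ℤ) = e := by omega
    have hm := hG.inv_sqrt_march hU0 hGU (h.lt_of_shift hG.strictMono hpos' hGx) (x k) hT0 hμ0 ?_
    · rw [hGx] at hm
      rwa [hval]
    · rw [iterate_shift hGx]
      have h2 := hμ k
      have h3 : x (k + d) ≤ x (k + T * e) := by
        apply h.strictMono.monotone
        have : (d : ℤ) ≤ T * e := by rw [← hval]; exact_mod_cast hT
        linarith
      linarith

theorem exists_halving {L : ℝ} (hL0 : 0 < L) : ∃ c : ℕ, ∀ {F : ℝ → ℝ} {p : ℤ} {q : ℕ} {x : ℤ → ℝ},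
    IsOrbit F p q x → (∀ x, |nonlin F x| ≤ L) → ∀ {d : ℕ}, 2 ≤ d → d ≤ q → ∀ {μ : ℝ}, 0 < μ →
    (∀ k, μ ≤ x (k + d) - x k) → ∃ d' : ℕ, 1 ≤ d' ∧ d' < d ∧
      ∀ k, μ ≤ ((d : ℝ) / d') ^ c * (x (k + d') - x k) := by
  set K := 1 + 3 / 2 * √(L * (2 * Real.exp (L * 2))) with hK
  have hK0 : 0 < K := by positivity
  obtain ⟨c, hc⟩ := pow_unbounded_of_one_lt ((2 * K) ^ 2) (one_lt_two (α := ℝ))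
  refine ⟨c + 2, fun {F p q x} h hL {d} hd hdq {μ} hμ0 hμ => ?_⟩
  obtain ⟨d', hd1, hd2, hm⟩ := h.halving_march hL0 hL hd hdq hμ0 hμ
  refine ⟨d', hd1, by omega, fun k => ?_⟩
  have hd'0 : (0 : ℝ) < d' := by exact_mod_cast hd1
  set R := (d : ℝ) / d' with hR
  have hR2 : 2 ≤ R := by
    rw [hR, le_div_iff₀ hd'0]
    exact_mod_cast hd2
  set T := d / d' + 1 with hT
  have hTd : d ≤ T * d' := by
    have := Nat.div_add_mod d d'
    have := Nat.mod_lt d hd1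
    rw [hT]; nlinarith
  have hTR : (T : ℝ) ≤ 2 * R := by
    have : ((d / d' : ℕ) : ℝ) ≤ R := Nat.cast_div_le
    rw [hT]; push_cast; linarith
  have hT1 : (1 : ℝ) ≤ T := by rw [hT]; push_cast; linarith [Nat.cast_nonneg (α := ℝ) (d / d')]
  have hlen : 0 < x (k + d') - x k := sub_pos.2 (h.strictMono (by omega))
  have hsμ : 0 < √μ := Real.sqrt_pos.2 hμ0
  have h1 : 1 / √(x (k + d') - x k) ≤ T * K / √μ := by
    refine (hm T hTd k).trans ?_
    have h2 : √(T / μ) ≤ T / √μ := by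
      rw [Real.sqrt_div' _ hμ0.le]
      gcongr
      rw [Real.sqrt_le_left (by linarith)]
      nlinarith
    have h3 : √(L * (2 * Real.exp (L * 2) / μ)) = √(L * (2 * Real.exp (L * 2))) / √μ := by
      rw [← Real.sqrt_div' _ hμ0.le]
      congr 1
      ring
    rw [h3, hK]
    have h4 : (T : ℝ) * (1 + 3 / 2 * √(L * (2 * Real.exp (L * 2)))) / √μ =
      T / √μ + 3 / 2 * T * (√(L * (2 * Real.exp (L * 2))) / √μ) := by ring
    linarith
  have hsl : 0 < √(x (k + d') - x k) := Real.sqrt_pos.2 hlen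
  have h5 : √μ ≤ T * K * √(x (k + d') - x k) := by
    rw [div_le_div_iff₀ hsl hsμ] at h1
    linarith
  have h6 : μ ≤ (T * K) ^ 2 * (x (k + d') - x k) := by
    calc μ = √μ ^ 2 := (Real.sq_sqrt hμ0.le).symm
      _ ≤ (T * K * √(x (k + d') - x k)) ^ 2 := by gcongr
      _ = _ := by rw [mul_pow, Real.sq_sqrt hlen.le]
  refine h6.trans (mul_le_mul_of_nonneg_right ?_ hlen.le)
  calc (T * K) ^ 2 ≤ (2 * R * K) ^ 2 := by gcongr
    _ = (2 * K) ^ 2 * R ^ 2 := by ring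
    _ ≤ R ^ c * R ^ 2 := by
        gcongr
        exact hc.le.trans (by gcongr)
    _ = _ := by rw [pow_add]

/-- The gaps of a periodic orbit are at least polynomially large in the period. -/
theorem exists_gap_lower_bound {L : ℝ} (hL0 : 0 < L) : ∃ c : ℕ, ∀ {F : ℝ → ℝ} {p : ℤ} {q : ℕ}
    {x : ℤ → ℝ}, IsOrbit F p q x → (∀ x, |nonlin F x| ≤ L) → ∀ k, 1 ≤ (q : ℝ) ^ c * gap x k := by
  obtain ⟨c, hc⟩ := exists_halving hL0
  refine ⟨c, fun {F p q x} h hL => ?_⟩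
  have hq0 : (0 : ℝ) < q := by exact_mod_cast h.pos
  have main : ∀ d : ℕ, 1 ≤ d → d ≤ q → (∀ k, ((d : ℝ) / q) ^ c ≤ x (k + d) - x k) →
      ∀ k, 1 ≤ (q : ℝ) ^ c * gap x k := by
    intro d
    induction d using Nat.strong_induction_on with
    | _ d ih =>
      intro hd1 hdq hd k
      have hd0 : (0 : ℝ) < d := by exact_mod_cast hd1
      rcases Nat.lt_or_ge d 2 with h2 | h2
      · obtain rfl : d = 1 := by omega
        have := hd k
        push_cast at this
        rw [gap]
        calc 1 = (q : ℝ) ^ c * (1 / q) ^ c := by rw [← mul_pow]; field_simp; simp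
          _ ≤ _ := by gcongr
      · obtain ⟨d', hd'1, hd'd, hd'⟩ := hc h hL h2 hdq (by positivity) hd
        have hd'0 : (0 : ℝ) < d' := by exact_mod_cast hd'1
        refine ih d' hd'd hd'1 (by omega) (fun k => ?_) k
        have := hd' k
        have h3 : ((d : ℝ) / q) ^ c = (d / d' : ℝ) ^ c * (d' / q : ℝ) ^ c := by
          rw [← mul_pow]; field_simp
        rw [h3] at this
        exact le_of_mul_le_mul_left this (by positivity)
  refine main q h.pos le_rfl fun k => ?_
  rw [h.add_q, div_self hq0.ne']
  simp

end IsOrbit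

namespace IsSmoothLift

variable {F : ℝ → ℝ}

theorem iterate_mul_int (hF : IsSmoothLift F) {q : ℕ} {p : ℤ} {y : ℝ} (h : F^[q] y = y + p)
    (s : ℕ) : F^[s * q] y = y + ((s * p : ℤ) : ℝ) := by
  induction s with
  | zero => simp
  | succ s ih =>
    rw [add_mul, one_mul, add_comm, Function.iterate_add_apply, ih,
      (hF.iterate q).map_add_int, h]
    push_cast; ring

theorem exists_isOrbit (hF : IsSmoothLift F) {p : ℤ} {q : ℕ} (hq : 0 < q)
    (hpq : IsCoprime p (q : ℤ)) {y : ℝ} (hy : F^[q] y = y + p) : ∃ x, IsOrbit F p q x := by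
  have hq' : (0 : ℤ) < q := by exact_mod_cast hq
  have hrep : ∀ k : ℤ, ∃ (n : ℕ) (m : ℤ), n * p + m * q = k := by
    intro k
    obtain ⟨a, b, hab⟩ := hpq
    refine ⟨((k * a) % q).toNat, k * b + (k * a) / q * p, ?_⟩
    rw [Int.toNat_of_nonneg (Int.emod_nonneg _ hq'.ne')]
    have := Int.emod_add_mul_ediv (k * a) q
    linear_combination p * this + k * hab
  have hwd' : ∀ (n n' : ℕ) (m m' : ℤ), n ≤ n' → n * p + m * q = n' * p + m' * q →
      F^[n] y + m = F^[n'] y + m' := by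
    intro n n' m m' hn h
    have hd : (q : ℤ) ∣ (n' - n : ℕ) := by
      have : (q : ℤ) ∣ (n' - n : ℕ) * p := ⟨m - m', by
        rw [Nat.cast_sub hn]; linear_combination -h⟩
      exact hpq.symm.dvd_of_dvd_mul_right this
    obtain ⟨s, hs⟩ := Int.natCast_dvd_natCast.1 hd
    have hn' : n' = n + s * q := by rw [mul_comm s, ← hs]; omega
    subst hn'
    have hm : m = m' + s * p := by
      have : (m - (m' + s * p)) * q = 0 := by push_cast at h; linear_combination h
      rcases mul_eq_zero.1 this with h0 | h0
      · linarith
      · exact absurd h0 hq'.ne'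
    rw [Function.iterate_add_apply, hF.iterate_mul_int hy, (hF.iterate n).map_add_int, hm]
    push_cast; ring
  have hwd : ∀ (n n' : ℕ) (m m' : ℤ), n * p + m * q = n' * p + m' * q →
      F^[n] y + m = F^[n'] y + m' := by
    intro n n' m m' h
    rcases le_total n n' with hn | hn
    · exact hwd' n n' m m' hn h
    · exact (hwd' n' n m' m hn h.symm).symm
  choose n m hnm using hrep
  set x : ℤ → ℝ := fun k => F^[n k] y + m k with hx
  have hshift : ∀ (j : ℕ) (l k : ℤ), F^[j] (x k) + l = x (k + (j * p + l * q)) := by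
    intro j l k
    have := hwd (j + n k) (n (k + (j * p + l * q))) (m k + l) (m (k + (j * p + l * q))) (by
      rw [hnm]; push_cast; linear_combination hnm k)
    simp only [hx]
    rw [← this, (hF.iterate j).map_add_int, Function.iterate_add_apply]
    push_cast; ring
  have haddq : ∀ k, x (k + q) = x k + 1 := by
    intro k
    have := hshift 0 1 k
    simp at this
    exact this.symm
  refine ⟨x, hF, hq, hpq, fun k => ?_, haddq, fun k => ?_⟩
  · set G := fun z => F^[n 1] z + (m 1 : ℝ) with hG
    have hGm : IsSmoothLift G := (hF.iterate _).add_const _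
    have hGx : ∀ k, G (x k) = x (k + 1) := by
      intro k
      have := hshift (n 1) (m 1) k
      rwa [hnm] at this
    have hit := IsOrbit.iterate_shift hGx
    by_contra hc
    rw [not_lt, ← hGx] at hc
    have hle : ∀ i, G^[i] (x k) ≤ x k := by
      intro i
      induction i with
      | zero => simp
      | succ i ih =>
        rw [Function.iterate_succ_apply']
        exact (hGm.strictMono.monotone ih).trans hc
    have := hle q
    rw [hit, mul_one, haddq] at this
    linarith
  · have := hshift 1 0 k
    simpa using this

theorem isRotNumber_reflect {α : ℝ} (h : IsRotNumber F α) :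
    IsRotNumber (fun x => -F (-x)) (-α) := by
  intro y
  have := (h (-y)).neg
  refine this.congr fun n => ?_
  have h1 : ∀ i : ℕ, (fun z => -F (-z))^[i] y = -F^[i] (-y) := by
    intro i
    induction i with
    | zero => simp
    | succ i ih =>
      rw [Function.iterate_succ_apply', ih, Function.iterate_succ_apply', neg_neg]
  rw [h1]
  ring

theorem le_rot_of_forall {α : ℝ} (hρ : IsRotNumber F α) {q : ℕ} (hq : 0 < q) {s : ℝ} {y : ℝ}
    (h : ∀ i : ℕ, i * s ≤ F^[i * q] y - y) : s ≤ q * α := by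
  have hq' : (0 : ℝ) < q := by exact_mod_cast hq
  have h1 : Tendsto (fun i : ℕ => i * q) atTop atTop :=
    tendsto_id.atTop_mul_const' hq
  have h2 := (hρ y).comp h1
  have h3 : s / q ≤ α := by
    refine ge_of_tendsto h2 ?_
    filter_upwards [eventually_gt_atTop 0] with i hi
    have hi' : (0 : ℝ) < i := by exact_mod_cast hi
    simp only [Function.comp]
    push_cast
    rw [div_le_div_iff₀ hq' (by positivity)]
    nlinarith [h i]
  rw [div_le_iff₀ hq'] at h3
  linarith

theorem rot_le_of_forall {α : ℝ} (hρ : IsRotNumber F α) {q : ℕ} (hq : 0 < q) {s : ℝ} {y : ℝ}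
    (h : ∀ i : ℕ, F^[i * q] y - y ≤ i * s) : q * α ≤ s := by
  have hq' : (0 : ℝ) < q := by exact_mod_cast hq
  have h1 : Tendsto (fun i : ℕ => i * q) atTop atTop :=
    tendsto_id.atTop_mul_const' hq
  have h2 := (hρ y).comp h1
  have h3 : α ≤ s / q := by
    refine le_of_tendsto h2 ?_
    filter_upwards [eventually_gt_atTop 0] with i hi
    have hi' : (0 : ℝ) < i := by exact_mod_cast hi
    simp only [Function.comp]
    push_cast
    rw [div_le_div_iff₀ (by positivity) hq']
    nlinarith [h i]
  rw [le_div_iff₀ hq'] at h3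
  linarith

theorem exists_periodic_of_lt (hF : IsSmoothLift F) {α : ℝ} (hρ : IsRotNumber F α) {q : ℕ}
    (hq : 0 < q) {p : ℤ} (hp : (p : ℝ) < q * α) :
    ∃ t y : ℝ, |t| ≤ 2 * |q * α - p| ∧ (fun z => F z + t)^[q] y = y + p := by
  set δ := q * α - p with hδ
  have hδ0 : 0 < δ := by rw [hδ]; linarith
  obtain ⟨y, hy⟩ : ∃ y, F^[q] y ≤ y + (p + 2 * δ) := by
    by_contra hc
    push Not at hc
    have := le_rot_of_forall hρ hq (s := p + 2 * δ) (y := 0) (by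
      intro i
      induction i with
      | zero => simp
      | succ i ih =>
        have h1 := hc (F^[i * q] 0)
        rw [← Function.iterate_add_apply] at h1
        rw [show (i + 1) * q = q + i * q by ring]
        push_cast
        linarith)
    rw [hδ] at this
    linarith
  have hgt : y + p < F^[q] y := by
    by_contra hc
    rw [not_lt] at hc
    have := rot_le_of_forall hρ hq (s := p) (y := y) (by
      intro i
      induction i with
      | zero => simp
      | succ i ih =>
        have h1 : F^[i * q] y ≤ y + ((i * p : ℤ) : ℝ) := by push_cast; linarith
        have h2 := (hF.iterate q).strictMono.monotone h1
        rw [(hF.iterate q).map_add_int, ← Function.iterate_add_apply] at h2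
        rw [show (i + 1) * q = q + i * q by ring]
        push_cast at h2 ⊢
        linarith)
    linarith
  have hcont : ∀ n : ℕ, Continuous fun t : ℝ => (fun z => F z + t)^[n] y := by
    intro n
    induction n with
    | zero => simpa using continuous_const
    | succ n ih =>
      simp only [Function.iterate_succ_apply']
      exact (hF.continuous.comp ih).add continuous_id
  have hle : ∀ n : ℕ, ∀ t ≤ (0 : ℝ), (fun z => F z + t)^[n] y ≤ F^[n] y := by
    intro n t ht
    induction n with
    | zero => simp
    | succ n ih =>
      simp only [Function.iterate_succ_apply']
      have := hF.strictMono.monotone ih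
      linarith
  have hlow : (fun z => F z + -(2 * δ))^[q] y ≤ y + p := by
    obtain ⟨n, rfl⟩ : ∃ n, q = n + 1 := ⟨q - 1, by omega⟩
    have h1 := hF.strictMono.monotone (hle n (-(2 * δ)) (by linarith))
    rw [Function.iterate_succ_apply'] at hy ⊢
    linarith
  obtain ⟨t, ht, hty⟩ := intermediate_value_Icc (by linarith : -(2 * δ) ≤ 0)
    (hcont q).continuousOn (show y + (p : ℝ) ∈ _ from ⟨hlow, by simpa using hgt.le⟩)
  refine ⟨t, y, ?_, hty⟩
  rw [abs_of_pos hδ0, abs_le]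
  exact ⟨ht.1, by linarith [ht.2]⟩

theorem exists_periodic (hF : IsSmoothLift F) {α : ℝ} (hρ : IsRotNumber F α) {q : ℕ}
    (hq : 0 < q) {p : ℤ} (hp : (q * α : ℝ) ≠ p) :
    ∃ t y : ℝ, |t| ≤ 2 * |q * α - p| ∧ (fun z => F z + t)^[q] y = y + p := by
  rcases lt_or_gt_of_ne hp with h | h
  · obtain ⟨t, y, ht, hy⟩ := hF.reflect.exists_periodic_of_lt (isRotNumber_reflect hρ) hq (p := -p)
      (by push_cast; linarith)
    refine ⟨-t, -y, ?_, ?_⟩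
    · rw [abs_neg]
      refine ht.trans_eq ?_
      rw [← abs_neg]
      congr 2
      push_cast; ring
    · have h1 : ∀ i : ℕ, (fun z => -F (-z) + t)^[i] y = -(fun z => F z + -t)^[i] (-y) := by
        intro i
        induction i with
        | zero => simp
        | succ i ih =>
          rw [Function.iterate_succ_apply', ih, Function.iterate_succ_apply', neg_neg]
          ring
      rw [h1] at hy
      push_cast at hy
      linarith
  · exact hF.exists_periodic_of_lt hρ hq h

end IsSmoothLift

theorem exists_good_approx {α : ℝ} (hirr : Irrational α) (hL : ¬ IsDiophantine α) (N Q : ℕ)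
    {ε : ℝ} (hε : 0 < ε) : ∃ (p : ℤ) (q : ℕ), Q < q ∧ IsCoprime p (q : ℤ) ∧
      |α - p / q| < ε ∧ |α - p / q| ≤ 1 / (q : ℝ) ^ N := by
  obtain ⟨γ, hγ0, hγ⟩ : ∃ γ > (0 : ℝ), ∀ (p : ℤ) (q : ℕ), 0 < q → q ≤ Q → γ ≤ |α - p / q| := by
    have : ∀ q : ℕ, ∃ γ > (0 : ℝ), ∀ p : ℤ, 0 < q → γ ≤ |α - p / q| := by
      intro q
      rcases Nat.eq_zero_or_pos q with rfl | hq
      · exact ⟨1, one_pos, fun p h => absurd h (lt_irrefl _)⟩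
      have hq' : (0 : ℝ) < q := by exact_mod_cast hq
      refine ⟨|q * α - round (q * α)| / q, ?_, fun p _ => ?_⟩
      · have : (q * α : ℝ) - round (q * α) ≠ 0 := by
          have := (hirr.natCast_mul hq.ne').ne_int (round (q * α))
          exact sub_ne_zero.2 this
        positivity
      · rw [div_le_iff₀ hq', ← abs_of_pos hq', ← abs_mul, abs_of_pos hq', sub_mul,
          div_mul_cancel₀ _ hq'.ne', mul_comm α]
        exact round_le _ p
    choose g hg0 hg using this
    obtain ⟨γ, hγ0, hγ⟩ : ∃ γ > (0 : ℝ), ∀ q ∈ Finset.range (Q + 1), γ ≤ g q := by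
      refine ⟨(Finset.range (Q + 1)).inf' ⟨0, by simp⟩ g, ?_, fun q hq => Finset.inf'_le _ hq⟩
      exact (Finset.lt_inf'_iff _).2 fun q _ => hg0 q
    exact ⟨γ, hγ0, fun p q hq hqQ => (hγ q (by simp; omega)).trans (hg q p hq)⟩
  set η := min (min γ ε) 1 with hη
  have hη0 : 0 < η := by simp [hη, hγ0, hε]
  have hnot : ¬ IsDiophantineWith η N α := fun h => hL ⟨η, hη0, N, by positivity, h⟩
  unfold IsDiophantineWith at hnot
  push Not at hnot
  obtain ⟨p, q, hq, hpq⟩ := hnot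
  have hq1 : (1 : ℝ) ≤ q := by exact_mod_cast hq
  rw [show (2 : ℝ) + N = ((2 + N : ℕ) : ℝ) by push_cast; ring, Real.rpow_natCast] at hpq
  have hpq' : |α - p / q| < η / (q : ℝ) ^ N := by
    refine hpq.trans_le ?_
    gcongr
    omega
  set r : ℚ := (p : ℚ) / q with hr
  have hrr : (r.num : ℝ) / (r.den : ℝ) = (p : ℝ) / q := by
    have : ((r : ℚ) : ℝ) = (p : ℝ) / q := by rw [hr]; push_cast; rfl
    rw [← this, Rat.cast_def]
  have hden : r.den ≤ q := by
    have h1 : (r.den : ℤ) ∣ q := by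
      have := Rat.den_dvd p q
      rw [hr]
      exact_mod_cast this
    exact Nat.le_of_dvd hq (by exact_mod_cast h1)
  have hd1 : (1 : ℝ) ≤ r.den := by exact_mod_cast r.den_pos
  have hbd : |α - r.num / r.den| < η := by
    rw [hrr]
    refine hpq'.trans_le (div_le_self hη0.le (one_le_pow₀ hq1))
  refine ⟨r.num, r.den, ?_, ?_, ?_, ?_⟩
  · by_contra hc
    have := hγ r.num r.den r.den_pos (not_lt.1 hc)
    have : η ≤ γ := (min_le_left _ _).trans (min_le_left _ _)
    linarith
  · exact Int.isCoprime_iff_nat_coprime.2 (by simpa using r.reduced)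
  · exact hbd.trans_le ((min_le_left _ _).trans (min_le_right _ _))
  · rw [hrr]
    refine hpq'.le.trans ?_
    have : η ≤ 1 := min_le_right _ _
    have hde : (r.den : ℝ) ≤ q := by exact_mod_cast hden
    gcongr

/-- Distance to the nearest integer. -/
noncomputable def distInt (y : ℝ) : ℝ := |y - round y|

theorem continuous_distInt : Continuous distInt := by
  have : distInt = fun y : ℝ => ‖(y : UnitAddCircle)‖ := by
    ext y
    rw [UnitAddCircle.norm_eq, distInt]
  rw [this]
  exact continuous_norm.comp (AddCircle.continuous_mk' 1)

theorem exists_best_approx {α : ℝ} (hirr : Irrational α) (K₀ : ℕ) :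
    ∃ K, K₀ < K ∧ ∀ i, 0 < i → i < K → distInt (K * α) < distInt (i * α) := by
  have hpos : ∀ i : ℕ, 0 < i → 0 < distInt (i * α) := by
    intro i hi
    have := (hirr.natCast_mul hi.ne').ne_int (round (i * α))
    exact abs_pos.2 (sub_ne_zero.2 this)
  obtain ⟨β, hβ0, hβ⟩ : ∃ β > (0 : ℝ), ∀ i : ℕ, 0 < i → i ≤ K₀ → β ≤ distInt (i * α) := by
    refine ⟨(Finset.range (K₀ + 1)).inf' ⟨0, by simp⟩
      (fun i => if i = 0 then 1 else distInt (i * α)), ?_, fun i hi hiK => ?_⟩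
    · refine (Finset.lt_inf'_iff _).2 fun i _ => ?_
      split_ifs with h0
      · exact one_pos
      · exact hpos i (Nat.pos_of_ne_zero h0)
    · refine (Finset.inf'_le _ (by simp; omega : i ∈ Finset.range (K₀ + 1))).trans ?_
      rw [if_neg hi.ne']
  have hex : ∃ K : ℕ, 0 < K ∧ distInt (K * α) < β := by
    obtain ⟨n, hn⟩ := exists_nat_gt (1 / β)
    have hn0 : 0 < n := by
      have : (0 : ℝ) < n := lt_trans (by positivity) hn
      exact_mod_cast this
    obtain ⟨k, hk0, -, hk⟩ := Real.exists_nat_abs_mul_sub_round_le α hn0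
    refine ⟨k, hk0, lt_of_le_of_lt hk ?_⟩
    rw [div_lt_iff₀ (by positivity)]
    rw [div_lt_iff₀ hβ0] at hn
    linarith
  classical
  obtain ⟨h0, h1⟩ := Nat.find_spec hex
  refine ⟨Nat.find hex, ?_, fun i hi hiK => ?_⟩
  · by_contra hc
    exact absurd (hβ _ h0 (not_lt.1 hc)) (not_le.2 h1)
  · have := Nat.find_min hex hiK
    push Not at this
    exact h1.trans_le (this hi)

namespace IsOrbit

variable {F : ℝ → ℝ} {p : ℤ} {q : ℕ} {x : ℤ → ℝ}

theorem sq_gap_le (h : IsOrbit F p q x) {L : ℝ} (hL : ∀ x, |nonlin F x| ≤ L) {K : ℕ} {e : ℤ}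
    (he : (q : ℤ) ∣ K * p - e) (heq : |e| + 1 ≤ q)
    (hN : ∀ i : ℕ, 0 < i → i < K → ∀ m : ℤ, |e| + 1 ≤ |i * p - m * q|) (k : ℤ) :
    gap x k ^ 2 ≤ Real.exp L ^ 2 * (gap x (k - e) * gap x (k + e)) := by
  set d : ℕ := e.natAbs + 1 with hd
  have hd' : (d : ℤ) = |e| + 1 := by rw [hd, Int.abs_eq_natAbs]; push_cast; rfl
  obtain ⟨a, ha1, ha2, ha3, ha4⟩ : ∃ a : ℤ, a ≤ k ∧ k + 1 ≤ a + d ∧ a ≤ k - e ∧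
      k - e + 1 ≤ a + d := by
    refine ⟨min k (k - e), min_le_left _ _, ?_, min_le_right _ _, ?_⟩ <;> omega
  have hsum : ∑ i ∈ Finset.range K, (F^[i] (x (a + d)) - F^[i] (x a)) ≤ 1 := by
    refine le_of_eq_of_le (Finset.sum_congr rfl fun i _ => ?_)
      (h.sum_arc_le_one (N := K) (d := d) (by omega) (fun i hi hiK m => by
        rw [hd']; exact hN i hi hiK m) a)
    rw [h.iterate, h.iterate, add_right_comm]
  have hm := h.strictMono.monotone
  have hy : x k ∈ Set.Icc (x a) (x (a + d)) := ⟨hm ha1, hm (by omega)⟩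
  have h1 := (h.lift.distortion_length hL le_rfl hsum hy (hm ha1) (h.lt_succ k).le (hm ha2)).1
  have h2 := (h.lift.distortion_length hL le_rfl hsum hy (hm ha3) (h.lt_succ (k - e)).le
    (hm ha4)).2
  have h3 : F^[K] (x (k + 1)) - F^[K] (x k) = gap x (k + e) := by
    rw [h.iterate, h.iterate, ← add_right_comm]
    refine h.gap_eq_of_modEq ?_
    exact (Int.modEq_iff_dvd.2 (by simpa using he)).symm
  have h4 : F^[K] (x (k - e + 1)) - F^[K] (x (k - e)) = gap x k := by
    rw [h.iterate, h.iterate, ← add_right_comm]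
    refine h.gap_eq_of_modEq ?_
    refine (Int.modEq_iff_dvd.2 ?_).symm
    rwa [show k - e + K * p - k = K * p - e by ring]
  rw [h3, mul_one] at h1
  rw [h4, mul_one] at h2
  set D := deriv (F^[K]) (x k)
  change D * gap x k ≤ _ at h1
  change gap x k ≤ Real.exp L * (D * gap x (k - e)) at h2
  have g0 := h.gap_pos k
  have g1 := h.gap_pos (k - e)
  calc gap x k ^ 2 = gap x k * gap x k := sq _
    _ ≤ Real.exp L * (D * gap x (k - e)) * gap x k := by gcongr
    _ = Real.exp L * gap x (k - e) * (D * gap x k) := by ring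
    _ ≤ Real.exp L * gap x (k - e) * (Real.exp L * gap x (k + e)) := by gcongr
    _ = _ := by ring

theorem exists_max_gap (h : IsOrbit F p q x) : ∃ k, ∀ l, gap x l ≤ gap x k := by
  have hq : (0 : ℤ) < q := by exact_mod_cast h.pos
  obtain ⟨k, -, hk⟩ := (Finset.Ico (0 : ℤ) q).exists_max_image (gap x) ⟨0, by simpa using h.pos⟩
  refine ⟨k, fun l => ?_⟩
  rw [h.gap_eq_of_modEq (Int.mod_modEq l q).symm]
  exact hk _ (by simpa using ⟨Int.emod_nonneg _ hq.ne', Int.emod_lt_of_pos _ hq⟩)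

theorem exists_min_gap (h : IsOrbit F p q x) : ∃ k, ∀ l, gap x k ≤ gap x l := by
  have hq : (0 : ℤ) < q := by exact_mod_cast h.pos
  obtain ⟨k, -, hk⟩ := (Finset.Ico (0 : ℤ) q).exists_min_image (gap x) ⟨0, by simpa using h.pos⟩
  refine ⟨k, fun l => ?_⟩
  rw [h.gap_eq_of_modEq (Int.mod_modEq l q).symm]
  exact hk _ (by simpa using ⟨Int.emod_nonneg _ hq.ne', Int.emod_lt_of_pos _ hq⟩)

theorem exists_large_gap (h : IsOrbit F p q x) {L : ℝ} (hL : ∀ x, |nonlin F x| ≤ L) {K : ℕ}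
    (hK : 0 < K) (hKq : 2 * K < q)
    (hbest : ∀ i, 0 < i → i < K → distInt (K * (p / q : ℝ)) < distInt (i * (p / q : ℝ))) (k : ℤ) :
    gap x k ≤ Real.exp L * gap x (k + K * p) ∨ gap x k ≤ Real.exp L * gap x (k + (-K : ℤ) * p) := by
  have hq0 : (0 : ℝ) < q := by exact_mod_cast h.pos
  set m := round (K * (p / q : ℝ)) with hm
  set e : ℤ := K * p - m * q with he
  have hel : ((|e| : ℤ) : ℝ) = q * distInt (K * (p / q : ℝ)) := by
    rw [distInt, ← hm, ← abs_of_pos hq0, ← abs_mul, abs_of_pos hq0, Int.cast_abs, he]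
    congr 1
    push_cast
    field_simp
  have hdist : ∀ (i : ℕ) (m : ℤ), q * distInt (i * (p / q : ℝ)) ≤ (|i * p - m * q| : ℤ) := by
    intro i m
    have := round_le (i * (p / q : ℝ)) m
    rw [distInt]
    calc (q : ℝ) * _ ≤ q * |i * (p / q : ℝ) - m| := by gcongr
      _ = _ := by
        rw [← abs_of_pos hq0, ← abs_mul, abs_of_pos hq0]
        push_cast
        congr 1
        field_simp
  have heq : |e| + 1 ≤ q := by
    have h1 : distInt (K * (p / q : ℝ)) ≤ 1 / 2 := abs_sub_round _
    have h2 : (2 * (|e| : ℤ) : ℝ) ≤ q := by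
      rw [hel]; nlinarith
    have : 2 * |e| ≤ q := by exact_mod_cast h2
    omega
  have hsq := h.sq_gap_le hL (K := K) (e := e) ⟨m, by rw [he]; ring⟩ heq (fun i hi hiK m' => by
    have h1 := hbest i hi hiK
    have h2 := hdist i m'
    have h3 : ((|e| : ℤ) : ℝ) < (|i * p - m' * q| : ℤ) := by
      rw [hel]
      exact lt_of_lt_of_le (by gcongr) h2
    have : |e| < |i * p - m' * q| := by exact_mod_cast h3
    omega) k
  have e1 : gap x (k + e) = gap x (k + K * p) :=
    h.gap_eq_of_modEq (Int.modEq_iff_dvd.2 ⟨m, by rw [he]; ring⟩)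
  have e2 : gap x (k - e) = gap x (k + (-K : ℤ) * p) :=
    h.gap_eq_of_modEq (Int.modEq_iff_dvd.2 ⟨-m, by rw [he]; ring⟩)
  rw [e1, e2] at hsq
  by_contra hc
  push Not at hc
  have g0 := h.gap_pos k
  have g1 := h.gap_pos (k + K * p)
  have : (Real.exp L * gap x (k + K * p)) * (Real.exp L * gap x (k + (-K : ℤ) * p)) <
      gap x k * gap x k := by
    apply mul_lt_mul'' hc.1 hc.2 <;> [positivity; exact (mul_pos (Real.exp_pos L) (h.gap_pos _)).le]
  nlinarith

/-- The gaps of periodic orbits shrink as the rotation number tends to an irrational number. -/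
theorem exists_gap_upper_bound {α : ℝ} (hirr : Irrational α) (L : ℝ) {η : ℝ} (hη : 0 < η) :
    ∃ ε > (0 : ℝ), ∃ Q : ℕ, ∀ {F : ℝ → ℝ} {p : ℤ} {q : ℕ} {x : ℤ → ℝ}, IsOrbit F p q x →
      (∀ x, |nonlin F x| ≤ L) → |α - p / q| < ε → Q < q → ∀ k, gap x k ≤ η := by
  set B : Set ℕ := {K | 0 < K ∧ ∀ i, 0 < i → i < K → distInt (K * α) < distInt (i * α)} with hB
  have hBinf : B.Infinite := by
    refine Set.infinite_of_forall_exists_gt fun K₀ => ?_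
    obtain ⟨K, hK, h⟩ := exists_best_approx hirr K₀
    exact ⟨K, ⟨by omega, h⟩, hK⟩
  obtain ⟨n, hn⟩ := exists_nat_gt (Real.exp L / η)
  obtain ⟨S, hSB, hScard⟩ := hBinf.exists_subset_card_eq n
  have hev : ∀ᶠ y in 𝓝 α, ∀ K ∈ S, ∀ i ∈ Finset.range K, 0 < i →
      distInt (K * y) < distInt (i * y) := by
    rw [Filter.eventually_all_finset]
    intro K hK
    rw [Filter.eventually_all_finset]
    intro i hi
    by_cases hi0 : 0 < i
    · have h1 : Continuous fun y : ℝ => distInt (K * y) :=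
        continuous_distInt.comp (continuous_const.mul continuous_id)
      have h2 : Continuous fun y : ℝ => distInt (i * y) :=
        continuous_distInt.comp (continuous_const.mul continuous_id)
      filter_upwards [h1.continuousAt.eventually_lt h2.continuousAt
        ((hSB hK).2 i hi0 (Finset.mem_range.1 hi))] with y hy _ using hy
    · exact Eventually.of_forall fun y h => absurd h hi0
  obtain ⟨ε, hε, hball⟩ := Metric.eventually_nhds_iff.1 hev
  refine ⟨ε, hε, 2 * S.sup id, fun {F p q x} h hL hα hq => ?_⟩
  have hbest := hball (y := p / q) (by rwa [dist_comm, Real.dist_eq])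
  obtain ⟨k, hk⟩ := h.exists_max_gap
  have hSq : ∀ K ∈ S, 2 * K < q := by
    intro K hK
    have : K ≤ S.sup id := Finset.le_sup (f := id) hK
    omega
  have hlarge : ∀ K : ℕ, ∃ s : ℤ, (s = K ∨ s = -K) ∧
      (K ∈ S → gap x k ≤ Real.exp L * gap x (k + s * p)) := by
    intro K
    by_cases hK : K ∈ S
    · rcases h.exists_large_gap hL (hSB hK).1 (hSq K hK)
        (fun i hi hiK => hbest K hK i (Finset.mem_range.2 hiK) hi) k with h1 | h1
      · exact ⟨K, Or.inl rfl, fun _ => h1⟩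
      · exact ⟨-K, Or.inr rfl, fun _ => h1⟩
    · exact ⟨K, Or.inl rfl, fun h => absurd h hK⟩
  choose s hs hsl using hlarge
  have hsum := h.sum_gap_le_one S (fun K => k + s K * p) (by
    intro K hK K' hK' hmod
    obtain ⟨c, hc⟩ := hmod.dvd
    have hd : (q : ℤ) ∣ s K' - s K := by
      refine h.coprime.symm.dvd_of_dvd_mul_right (z := p) ⟨c, by linarith⟩
    have h1 := hSq K hK
    have h2 := hSq K' hK'
    have h3 : s K' - s K = 0 := by
      refine Int.eq_zero_of_abs_lt_dvd hd ?_
      rw [abs_lt]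
      rcases hs K with e | e <;> rcases hs K' with e' | e' <;> rw [e, e'] <;> constructor <;> omega
    have h4 := (hSB hK).1
    have h5 := (hSB hK').1
    rcases hs K with e | e <;> rcases hs K' with e' | e' <;> omega)
  have h6 : (n : ℝ) * gap x k ≤ Real.exp L := by
    calc (n : ℝ) * gap x k = ∑ K ∈ S, gap x k := by rw [Finset.sum_const, hScard, nsmul_eq_mul]
      _ ≤ ∑ K ∈ S, Real.exp L * gap x (k + s K * p) := Finset.sum_le_sum fun K hK => hsl K hK
      _ ≤ Real.exp L := by
        rw [← Finset.mul_sum]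
        exact mul_le_of_le_one_right (Real.exp_pos L).le hsum
  intro l
  refine (hk l).trans ?_
  rw [div_lt_iff₀ hη] at hn
  have hn0 : (0 : ℝ) < n := by
    by_contra hc
    have : Real.exp L ≤ 0 := hn.le.trans (mul_nonpos_of_nonpos_of_nonneg (not_lt.1 hc) hη.le)
    linarith [Real.exp_pos L]
  have : (n : ℝ) * gap x k ≤ n * η := by linarith
  exact le_of_mul_le_mul_left this hn0

end IsOrbit

/-- The derivatives of `u` at `x` up to order `n` grow at most like `A * Λ ^ i`. -/
def WtAt (n : ℕ) (u : ℝ → ℝ) (x A Λ : ℝ) : Prop := ∀ i ≤ n, |iteratedDeriv i u x| ≤ A * Λ ^ i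

namespace WtAt

variable {n : ℕ} {u v : ℝ → ℝ} {x A B Λ : ℝ}

theorem mono (h : WtAt n u x A Λ) (hAB : A ≤ B) (hΛ : 0 ≤ Λ) : WtAt n u x B Λ :=
  fun i hi => (h i hi).trans (by gcongr)

theorem of_le {m : ℕ} (h : WtAt n u x A Λ) (hm : m ≤ n) : WtAt m u x A Λ :=
  fun i hi => h i (hi.trans hm)

theorem add (hu : ContDiff ℝ ∞ u) (hv : ContDiff ℝ ∞ v) (h : WtAt n u x A Λ)
    (h' : WtAt n v x B Λ) : WtAt n (fun y => u y + v y) x (A + B) Λ := by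
  intro i hi
  rw [iteratedDeriv_fun_add (hu.contDiffAt.of_le (by exact_mod_cast le_top))
    (hv.contDiffAt.of_le (by exact_mod_cast le_top)), add_mul]
  exact (abs_add_le _ _).trans (add_le_add (h i hi) (h' i hi))

theorem sum {ι : Type*} (S : Finset ι) {u : ι → ℝ → ℝ} {A : ι → ℝ}
    (hu : ∀ j ∈ S, ContDiff ℝ ∞ (u j)) (h : ∀ j ∈ S, WtAt n (u j) x (A j) Λ) :
    WtAt n (fun y => ∑ j ∈ S, u j y) x (∑ j ∈ S, A j) Λ := by
  intro i hi
  rw [iteratedDeriv_fun_sum fun j hj => (hu j hj).contDiffAt.of_le (by exact_mod_cast le_top),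
    Finset.sum_mul]
  exact (Finset.abs_sum_le_sum_abs _ _).trans (Finset.sum_le_sum fun j hj => h j hj i hi)

theorem mul (hu : ContDiff ℝ ∞ u) (hv : ContDiff ℝ ∞ v) (hA : 0 ≤ A) (hB : 0 ≤ B) (hΛ : 0 ≤ Λ)
    (h : WtAt n u x A Λ) (h' : WtAt n v x B Λ) :
    WtAt n (fun y => u y * v y) x (2 ^ n * A * B) Λ := by
  intro i hi
  rw [iteratedDeriv_fun_mul (hu.contDiffAt.of_le (by exact_mod_cast le_top))
    (hv.contDiffAt.of_le (by exact_mod_cast le_top))]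
  calc _ ≤ ∑ j ∈ Finset.range (i + 1),
        |(i.choose j : ℝ) * iteratedDeriv j u x * iteratedDeriv (i - j) v x| :=
        Finset.abs_sum_le_sum_abs _ _
    _ ≤ ∑ j ∈ Finset.range (i + 1), (i.choose j : ℝ) * (A * B * Λ ^ i) := by
        refine Finset.sum_le_sum fun j hj => ?_
        have hji : j ≤ i := Nat.lt_succ_iff.1 (Finset.mem_range.1 hj)
        rw [abs_mul, abs_mul, Nat.abs_cast, mul_assoc]
        refine mul_le_mul_of_nonneg_left ?_ (Nat.cast_nonneg _)
        calc _ ≤ (A * Λ ^ j) * (B * Λ ^ (i - j)) := by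
              exact mul_le_mul (h j (hji.trans hi)) (h' (i - j) ((Nat.sub_le _ _).trans hi))
                (abs_nonneg _) (by positivity)
          _ = A * B * Λ ^ i := by
              rw [← Nat.add_sub_cancel' hji, pow_add]
              simp; ring
    _ = 2 ^ i * (A * B * Λ ^ i) := by
        rw [← Finset.sum_mul]
        norm_cast
        rw [Nat.sum_range_choose]
    _ ≤ 2 ^ n * (A * B * Λ ^ i) := by
        gcongr
        exact one_le_two
    _ = _ := by ring

theorem const_mul (h : WtAt n u x A Λ) (c : ℝ) :
    WtAt n (fun y => c * u y) x (|c| * A) Λ := by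
  intro i hi
  rw [iteratedDeriv_const_mul_field, abs_mul, mul_assoc]
  gcongr
  exact h i hi

theorem of_deriv (h0 : |u x| ≤ A) (h : WtAt n (deriv u) x (A * Λ) Λ) : WtAt (n + 1) u x A Λ := by
  intro i hi
  rcases i with _ | i
  · simpa using h0
  · rw [iteratedDeriv_succ']
    have := h i (by omega)
    rwa [mul_assoc, ← pow_succ'] at this

theorem comp {c : ℝ} (hu : ContDiff ℝ ∞ u) (hv : ContDiff ℝ ∞ v) (hA : 1 ≤ A) (hΛ : 0 ≤ Λ)
    (hc : ∀ i ≤ n, |iteratedDeriv i u (v x)| ≤ c) (h : ∀ i, 1 ≤ i → i ≤ n →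
      |iteratedDeriv i v x| ≤ A * Λ ^ i) :
    WtAt n (fun y => u (v y)) x (n ! * c * A ^ n) Λ := by
  have hc0 : 0 ≤ c := (abs_nonneg _).trans (hc 0 (Nat.zero_le _))
  intro i hi
  have key := norm_iteratedFDeriv_comp_le (n := i) (N := ∞) (C := c) (D := A * Λ) hu hv
    (by exact_mod_cast le_top) x (fun j hj => by
      rw [norm_iteratedFDeriv_eq_norm_iteratedDeriv]
      exact hc j (hj.trans hi)) (fun j hj1 hj => by
      rw [norm_iteratedFDeriv_eq_norm_iteratedDeriv]
      refine (h j hj1 (hj.trans hi)).trans ?_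
      rw [mul_pow]
      gcongr
      exact le_self_pow₀ hA (by omega))
  rw [norm_iteratedFDeriv_eq_norm_iteratedDeriv] at key
  refine key.trans ?_
  rw [mul_pow, ← mul_assoc]
  gcongr

end WtAt

/-- Uniform control of the nonlinearity and of the Schwarzian derivative. -/
structure Ctrl (F : ℝ → ℝ) (L : ℝ) (c : ℕ → ℝ) : Prop where
  lift : IsSmoothLift F
  pos : 0 < L
  nonlin_le : ∀ x, |nonlin F x| ≤ L
  schwarz_le : ∀ i x, |iteratedDeriv i (schwarz F) x| ≤ c i

theorem IsSmoothLift.exists_ctrl {f : ℝ → ℝ} (hf : IsSmoothLift f) :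
    ∃ L c, ∀ t, Ctrl (fun x => f x + t) L c := by
  obtain ⟨L, hL0, hL⟩ := exists_bound_of_periodic hf.contDiff_nonlin.continuous hf.periodic_nonlin
  have : ∀ i, ∃ C, 0 ≤ C ∧ ∀ x, |iteratedDeriv i (schwarz f) x| ≤ C := fun i =>
    exists_bound_of_periodic (hf.contDiff_schwarz.continuous_iteratedDeriv i
      (by exact_mod_cast le_top)) (periodic_iteratedDeriv hf.periodic_schwarz i)
  choose c hc0 hc using this
  refine ⟨L + 1, c, fun t => ⟨hf.add_const t, by linarith, fun x => ?_, fun i x => ?_⟩⟩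
  · rw [IsSmoothLift.nonlin_add_const]
    linarith [hL x]
  · rw [IsSmoothLift.schwarz_add_const]
    exact hc i x

theorem exists_wtAt_deriv (n : ℕ) {C : ℝ} (hC : 1 ≤ C) : ∃ C' : ℝ, 1 ≤ C' ∧ ∀ {G : ℝ → ℝ},
    IsSmoothLift G → ∀ {x Λ : ℝ}, 0 ≤ Λ → WtAt n (nonlin G) x (C * Λ) Λ →
      WtAt (n + 1) (deriv G) x (C' * deriv G x) Λ := by
  induction n with
  | zero =>
    refine ⟨C, hC, fun {G} hG {x Λ} hΛ h => ?_⟩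
    have hD := hG.deriv_pos x
    refine WtAt.of_deriv ?_ ?_
    · rw [abs_of_pos hD]; nlinarith
    · intro i hi
      obtain rfl : i = 0 := by omega
      have := h 0 le_rfl
      simp only [iteratedDeriv_zero, pow_zero, mul_one] at this ⊢
      rw [hG.deriv_deriv, abs_mul, abs_of_pos hD]
      nlinarith
  | succ n ih =>
    obtain ⟨C₁, hC₁, h₁⟩ := ih
    refine ⟨2 ^ (n + 1) * C * C₁, ?_, fun {G} hG {x Λ} hΛ h => ?_⟩
    · have : (1 : ℝ) ≤ 2 ^ (n + 1) := one_le_pow₀ one_le_two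
      nlinarith [mul_le_mul this hC zero_le_one (by positivity)]
    have hD := hG.deriv_pos x
    refine WtAt.of_deriv ?_ ?_
    · rw [abs_of_pos hD]
      have : (1 : ℝ) ≤ 2 ^ (n + 1) := one_le_pow₀ one_le_two
      have h2 : 1 ≤ 2 ^ (n + 1) * C * C₁ := by
        nlinarith [mul_le_mul this hC zero_le_one (by positivity)]
      nlinarith
    · have h2 := h₁ hG hΛ (h.of_le (Nat.le_succ n))
      have h3 := WtAt.mul hG.contDiff_nonlin hG.contDiff_deriv (by positivity) (by positivity) hΛ
        h h2
      have : deriv (deriv G) = fun y => nonlin G y * deriv G y := funext hG.deriv_deriv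
      rw [this]
      refine h3.mono (le_of_eq ?_) hΛ
      ring

theorem exists_wtAt_nonlin (c : ℕ → ℝ) (n : ℕ) : ∃ C : ℝ, 1 ≤ C ∧ ∀ {F : ℝ → ℝ}
    {L : ℝ}, Ctrl F L c → ∀ {x Λ : ℝ} {N : ℕ}, 0 ≤ Λ → (∀ l ≤ N, |nonlin (F^[l]) x| ≤ Λ) →
      ∑ j ∈ Finset.range N, deriv (F^[j]) x ^ 2 ≤ Λ ^ 2 → ∀ l ≤ N,
      WtAt n (nonlin (F^[l])) x (C * Λ) Λ := by
  induction n with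
  | zero =>
    refine ⟨1, le_rfl, fun {F L} _ {x Λ N} hΛ h1 h2 l hl i hi => ?_⟩
    obtain rfl : i = 0 := by omega
    simpa using h1 l hl
  | succ n ih =>
    obtain ⟨C, hC, hw⟩ := ih
    obtain ⟨C₁, hC₁, hD⟩ := exists_wtAt_deriv n hC
    set c' := ∑ i ∈ Finset.range (n + 1), |c i| with hc'
    have hc'0 : 0 ≤ c' := Finset.sum_nonneg fun _ _ => abs_nonneg _
    set K₁ := 2 ^ n * (n ! * c' * C₁ ^ n) * (2 ^ n * C₁ * C₁) with hK₁
    have hK₁0 : 0 ≤ K₁ := by positivity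
    set K := 1 + 2⁻¹ * (2 ^ n * C * C) + K₁ with hK
    have hKpos : 0 ≤ 2⁻¹ * (2 ^ n * C * C) := by positivity
    refine ⟨K, by linarith, fun {F L} hF {x Λ N} hΛ h1 h2 l hl => ?_⟩
    have hlift := hF.lift.iterate l
    refine WtAt.of_deriv ((h1 l hl).trans ?_) ?_
    · nlinarith
    have hwl := hw hF hΛ h1 h2
    have hfun : deriv (nonlin (F^[l])) = fun y =>
        2⁻¹ * (nonlin (F^[l]) y * nonlin (F^[l]) y) + ∑ j ∈ Finset.range l,
          schwarz F (F^[j] y) * (deriv (F^[j]) y * deriv (F^[j]) y) := by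
      ext y
      have := hF.lift.schwarz_iterate l y
      simp only [← sq]
      rw [← this, schwarz]
      ring
    rw [hfun]
    have hcd := hlift.contDiff_nonlin
    have hsq := ((hwl l hl).mul hcd hcd (by positivity) (by positivity) hΛ (hwl l hl)).const_mul 2⁻¹
    have hterm : ∀ j ∈ Finset.range l, WtAt n
        (fun y => schwarz F (F^[j] y) * (deriv (F^[j]) y * deriv (F^[j]) y)) x
        (K₁ * deriv (F^[j]) x ^ 2) Λ := by
      intro j hj
      have hjN : j < N := (Finset.mem_range.1 hj).trans_le hl
      have hjl := hF.lift.iterate j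
      have hDj := hD hjl hΛ (hwl j hjN.le)
      have hpos := hjl.deriv_pos x
      have hDΛ : deriv (F^[j]) x ≤ Λ := by
        have h3 := Finset.single_le_sum (f := fun j => deriv (F^[j]) x ^ 2)
          (fun _ _ => sq_nonneg _) (Finset.mem_range.2 hjN)
        exact abs_le_of_sq_le_sq' (h3.trans h2) hΛ |>.2
      have hDn : WtAt n (deriv (F^[j])) x (C₁ * deriv (F^[j]) x) Λ := hDj.of_le (Nat.le_succ n)
      have hσ : WtAt n (fun y => schwarz F (F^[j] y)) x (n ! * c' * C₁ ^ n) Λ := by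
        refine WtAt.comp hF.lift.contDiff_schwarz hjl.contDiff hC₁ hΛ (fun i hi => ?_)
          (fun i hi1 hi => ?_)
        · refine (hF.schwarz_le i _).trans ((le_abs_self _).trans ?_)
          exact Finset.single_le_sum (f := fun i => |c i|) (fun _ _ => abs_nonneg _)
            (Finset.mem_range.2 (by omega))
        · obtain ⟨i, rfl⟩ : ∃ i', i = i' + 1 := ⟨i - 1, by omega⟩
          rw [iteratedDeriv_succ']
          refine (hDn i (by omega)).trans ?_
          rw [pow_succ', ← mul_assoc]
          gcongr
      have hp := WtAt.mul (hF.lift.contDiff_schwarz.comp hjl.contDiff)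
        (hjl.contDiff_deriv.mul hjl.contDiff_deriv) (by positivity) (by positivity) hΛ hσ
        (WtAt.mul hjl.contDiff_deriv hjl.contDiff_deriv (by positivity) (by positivity) hΛ hDn hDn)
      refine hp.mono (le_of_eq ?_) hΛ
      rw [hK₁]; ring
    have hsum := WtAt.sum (Finset.range l) (fun j _ => (hF.lift.contDiff_schwarz.comp
      (hF.lift.iterate j).contDiff).mul ((hF.lift.iterate j).contDiff_deriv.mul
        (hF.lift.iterate j).contDiff_deriv)) hterm
    refine (WtAt.add (contDiff_const.mul (hcd.mul hcd)) (ContDiff.sum fun j _ =>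
      (hF.lift.contDiff_schwarz.comp (hF.lift.iterate j).contDiff).mul
        ((hF.lift.iterate j).contDiff_deriv.mul (hF.lift.iterate j).contDiff_deriv))
      hsq hsum).mono ?_ hΛ
    rw [← Finset.mul_sum]
    have h4 : ∑ j ∈ Finset.range l, deriv (F^[j]) x ^ 2 ≤ Λ ^ 2 := by
      refine le_trans ?_ h2
      exact Finset.sum_le_sum_of_subset_of_nonneg (by simpa using hl) fun _ _ _ => sq_nonneg _
    have h5 := mul_le_mul_of_nonneg_left h4 hK₁0
    rw [abs_of_pos (by norm_num : (0 : ℝ) < 2⁻¹), hK]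
    nlinarith [sq_nonneg Λ]

namespace IsOrbit

variable {F : ℝ → ℝ} {p : ℤ} {q : ℕ} {x : ℤ → ℝ} {L : ℝ} {c : ℕ → ℝ} {M μ : ℝ}

theorem exists_index (h : IsOrbit F p q x) (k l : ℤ) : ∃ i : ℕ, i < q ∧ k + i * p ≡ l [ZMOD q] := by
  have hq' : (0 : ℤ) < q := by exact_mod_cast h.pos
  obtain ⟨a, b, hab⟩ := h.coprime
  refine ⟨(((l - k) * a) % q).toNat, ?_, ?_⟩
  · have := Int.emod_nonneg ((l - k) * a) hq'.ne'
    have := Int.emod_lt_of_pos ((l - k) * a) hq'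
    omega
  · rw [Int.toNat_of_nonneg (Int.emod_nonneg _ hq'.ne')]
    have := Int.emod_add_mul_ediv ((l - k) * a) q
    refine Int.modEq_iff_dvd.2 ⟨(l - k) * b + (l - k) * a / q * p, ?_⟩
    linear_combination (-p) * this - (l - k) * hab

theorem gap_le_one (h : IsOrbit F p q x) (k : ℤ) : gap x k ≤ 1 := by
  simpa using h.sum_gap_le_one {()} (fun _ => k) (by simp)

theorem deriv_iterate_le (h : IsOrbit F p q x) (hF : Ctrl F L c) {k : ℤ} {y : ℝ}
    (hy : y ∈ Set.Icc (x k) (x (k + 1))) {i : ℕ} (hi : i ≤ q) :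
    deriv (F^[i]) y ≤ Real.exp L * gap x (k + i * p) / gap x k := by
  rw [le_div_iff₀ (h.gap_pos k)]
  exact (h.deriv_mul_gap_le hF.nonlin_le hi hy).1

theorem le_deriv_iterate (h : IsOrbit F p q x) (hF : Ctrl F L c) {k : ℤ} {y : ℝ}
    (hy : y ∈ Set.Icc (x k) (x (k + 1))) {i : ℕ} (hi : i ≤ q) :
    gap x (k + i * p) / (Real.exp L * gap x k) ≤ deriv (F^[i]) y := by
  rw [div_le_iff₀ (mul_pos (Real.exp_pos L) (h.gap_pos k))]
  have := (h.deriv_mul_gap_le hF.nonlin_le hi hy).2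
  linarith

theorem sum_sq_gap_le (h : IsOrbit F p q x) (hM : ∀ k, gap x k ≤ M) (k : ℤ) {l : ℕ} (hl : l ≤ q) :
    ∑ i ∈ Finset.range l, gap x (k + i * p) ^ 2 ≤ M := by
  have hM0 : 0 ≤ M := (h.gap_pos 0).le.trans (hM 0)
  calc _ ≤ ∑ i ∈ Finset.range q, gap x (k + i * p) ^ 2 :=
        Finset.sum_le_sum_of_subset_of_nonneg (by simpa using hl) fun _ _ _ => sq_nonneg _
    _ ≤ ∑ i ∈ Finset.range q, M * gap x (k + i * p) := by
        refine Finset.sum_le_sum fun i _ => ?_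
        rw [sq]
        exact mul_le_mul_of_nonneg_right (hM _) (h.gap_pos _).le
    _ ≤ M := by
        rw [← Finset.mul_sum]
        exact mul_le_of_le_one_right hM0 (h.sum_gap_orbit_le_one k)

theorem sum_sq_deriv_le (h : IsOrbit F p q x) (hF : Ctrl F L c) (hM : ∀ k, gap x k ≤ M) {k : ℤ}
    {y : ℝ} (hy : y ∈ Set.Icc (x k) (x (k + 1))) {l : ℕ} (hl : l ≤ q) :
    ∑ i ∈ Finset.range l, deriv (F^[i]) y ^ 2 ≤ (Real.exp L * √M / gap x k) ^ 2 := by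
  have hM0 : 0 ≤ M := (h.gap_pos 0).le.trans (hM 0)
  calc _ ≤ ∑ i ∈ Finset.range l, (Real.exp L / gap x k) ^ 2 * gap x (k + i * p) ^ 2 := by
        refine Finset.sum_le_sum fun i hi => ?_
        rw [← mul_pow]
        refine pow_le_pow_left₀ ((h.lift.iterate i).deriv_pos y).le ?_ 2
        refine (h.deriv_iterate_le hF hy ((Finset.mem_range.1 hi).le.trans hl)).trans_eq ?_
        ring
    _ ≤ (Real.exp L / gap x k) ^ 2 * M := by
        rw [← Finset.mul_sum]
        exact mul_le_mul_of_nonneg_left (h.sum_sq_gap_le hM k hl) (sq_nonneg _)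
    _ = _ := by
        rw [div_pow, div_pow, mul_pow, Real.sq_sqrt hM0]
        ring

theorem abs_schwarz_iterate_le (hF : Ctrl F L c) (l : ℕ) (y : ℝ) :
    |schwarz (F^[l]) y| ≤ c 0 * ∑ i ∈ Finset.range l, deriv (F^[i]) y ^ 2 := by
  rw [hF.lift.schwarz_iterate, Finset.mul_sum]
  refine (Finset.abs_sum_le_sum_abs _ _).trans (Finset.sum_le_sum fun i _ => ?_)
  rw [abs_mul, abs_of_nonneg (sq_nonneg (deriv (F^[i]) y))]
  have := hF.schwarz_le 0 (F^[i] y)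
  rw [iteratedDeriv_zero] at this
  exact mul_le_mul_of_nonneg_right this (sq_nonneg _)

theorem _root_.Ctrl.c_nonneg (hF : Ctrl F L c) (i : ℕ) : 0 ≤ c i :=
  (abs_nonneg _).trans (hF.schwarz_le i 0)

theorem abs_nonlin_le_const (h : IsOrbit F p q x) (hF : Ctrl F L c) (hM : ∀ k, gap x k ≤ M)
    (hμ0 : 0 < μ) (hμ : ∀ k, μ ≤ gap x k) {l : ℕ} (hl : l ≤ q) (y : ℝ) :
    |nonlin (F^[l]) y| ≤ √(2 * c 0) * Real.exp L * (√M / μ) := by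
  have hG := h.lift.iterate l
  have hc0 := hF.c_nonneg 0
  obtain ⟨z, hz⟩ := exists_max_of_periodic (u := fun y => nonlin (F^[l]) y ^ 2)
    (hG.contDiff_nonlin.continuous.pow 2) (fun y => by simp [hG.periodic_nonlin y])
  have hmax : nonlin (F^[l]) z ^ 2 ≤ (√(2 * c 0) * Real.exp L * (√M / μ)) ^ 2 := by
    by_cases h0 : nonlin (F^[l]) z = 0
    · rw [h0, zero_pow two_ne_zero]; exact sq_nonneg _
    have hd : HasDerivAt (nonlin (F^[l])) (deriv (nonlin (F^[l])) z) z :=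
      (hG.contDiff_nonlin.differentiable (by simp) z).hasDerivAt
    have hd2 := (hd.pow 2).deriv
    have hloc : IsLocalMax (nonlin (F^[l]) ^ 2) z := Eventually.of_forall fun y => hz y
    rw [hloc.deriv_eq_zero] at hd2
    have hd0 : deriv (nonlin (F^[l])) z = 0 := by
      simpa [h0] using hd2.symm
    have hs : schwarz (F^[l]) z = - (nonlin (F^[l]) z ^ 2 / 2) := by
      rw [schwarz, hd0]; ring
    have hS := abs_schwarz_iterate_le hF l z
    rw [hs, abs_neg, abs_of_nonneg (by positivity)] at hS
    obtain ⟨k, hk1, hk2⟩ := h.exists_mem_gap z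
    have hsum := h.sum_sq_deriv_le hF hM ⟨hk1, hk2.le⟩ hl
    have h1 : (Real.exp L * √M / gap x k) ^ 2 ≤ (Real.exp L * √M / μ) ^ 2 := by
      have := hμ k
      have := h.gap_pos k
      gcongr
    have h2 := mul_le_mul_of_nonneg_left (hsum.trans h1) hc0
    have h3 : (√(2 * c 0) * Real.exp L * (√M / μ)) ^ 2 =
        2 * (c 0 * (Real.exp L * √M / μ) ^ 2) := by
      rw [mul_assoc, mul_pow, Real.sq_sqrt (by positivity)]
      ring
    rw [h3]
    linarith
  exact abs_le_of_sq_le_sq ((hz y).trans hmax) (by positivity)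

theorem abs_nonlin_le_deriv (h : IsOrbit F p q x) (hF : Ctrl F L c) (hM : ∀ k, gap x k ≤ M)
    (hμ0 : 0 < μ) (hμ : ∀ k, μ ≤ gap x k) {l : ℕ} (hl : l ≤ q) (y : ℝ) :
    |nonlin (F^[l]) y| ≤ √(2 * c 0) * Real.exp L ^ 2 * (√M / μ) * deriv (F^[l]) y := by
  have hG := h.lift.iterate l
  have hM0 : 0 ≤ M := (h.gap_pos 0).le.trans (hM 0)
  have hc0 := hF.c_nonneg 0
  obtain ⟨z, hz⟩ := exists_max_of_periodic (u := fun y => (nonlin (F^[l]) y / deriv (F^[l]) y) ^ 2)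
    ((hG.contDiff_nonlin.continuous.div hG.contDiff_deriv.continuous
      fun y => (hG.deriv_pos y).ne').pow 2)
    (fun y => by simp [hG.periodic_nonlin y, hG.periodic_deriv y])
  have hDz := hG.deriv_pos z
  have hmax : (nonlin (F^[l]) z / deriv (F^[l]) z) ^ 2 ≤
      (√(2 * c 0) * Real.exp L ^ 2 * (√M / μ)) ^ 2 := by
    by_cases h0 : nonlin (F^[l]) z = 0
    · rw [h0, zero_div, zero_pow two_ne_zero]; exact sq_nonneg _
    have hd : HasDerivAt (nonlin (F^[l])) (deriv (nonlin (F^[l])) z) z :=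
      (hG.contDiff_nonlin.differentiable (by simp) z).hasDerivAt
    have hdD : HasDerivAt (deriv (F^[l])) (nonlin (F^[l]) z * deriv (F^[l]) z) z := by
      rw [← hG.deriv_deriv]
      exact (hG.contDiff_deriv.differentiable (by simp) z).hasDerivAt
    have hd2 := ((hd.div hdD hDz.ne').pow 2).deriv
    have hloc : IsLocalMax ((nonlin (F^[l]) / deriv (F^[l])) ^ 2) z :=
      Eventually.of_forall fun y => hz y
    rw [hloc.deriv_eq_zero] at hd2
    have hd0 : deriv (nonlin (F^[l])) z = nonlin (F^[l]) z ^ 2 := by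
      simp [h0, hDz.ne'] at hd2
      have h5 : deriv (F^[l]) z * (deriv (nonlin (F^[l])) z - nonlin (F^[l]) z ^ 2) = 0 := by
        linarith
      rcases mul_eq_zero.1 h5 with h6 | h6
      · exact absurd h6 hDz.ne'
      · linarith
    have hs : schwarz (F^[l]) z = nonlin (F^[l]) z ^ 2 / 2 := by
      rw [schwarz, hd0]; ring
    have hS := abs_schwarz_iterate_le hF l z
    rw [hs, abs_of_nonneg (by positivity)] at hS
    obtain ⟨k, hk1, hk2⟩ := h.exists_mem_gap z
    have hk : z ∈ Set.Icc (x k) (x (k + 1)) := ⟨hk1, hk2.le⟩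
    have hDl := h.le_deriv_iterate hF hk hl
    have hgl := hμ (k + l * p)
    have hsum : ∑ i ∈ Finset.range l, deriv (F^[i]) z ^ 2 ≤
        (Real.exp L ^ 2 * √M / μ) ^ 2 * deriv (F^[l]) z ^ 2 := by
      refine (h.sum_sq_deriv_le hF hM hk hl).trans ?_
      rw [← mul_pow]
      have hgk := h.gap_pos k
      have hE := Real.exp_pos L
      gcongr
      calc Real.exp L * √M / gap x k = Real.exp L ^ 2 * √M / μ * (μ / (Real.exp L * gap x k)) := by
            field_simp
        _ ≤ Real.exp L ^ 2 * √M / μ * deriv (F^[l]) z := by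
            gcongr
            refine le_trans ?_ hDl
            gcongr
    have h2 := mul_le_mul_of_nonneg_left hsum hc0
    have h3 : (√(2 * c 0) * Real.exp L ^ 2 * (√M / μ)) ^ 2 =
        2 * (c 0 * (Real.exp L ^ 2 * √M / μ) ^ 2) := by
      rw [mul_assoc, mul_pow, Real.sq_sqrt (by positivity)]
      ring
    rw [h3, div_pow, div_le_iff₀ (by positivity)]
    linarith
  have hDy := hG.deriv_pos y
  have h7 := abs_le_of_sq_le_sq ((hz y).trans hmax) (by positivity)
  rw [abs_div, abs_of_pos hDy, div_le_iff₀ hDy] at h7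
  exact h7

/-- The nonlinearity of iterates up to the period, compared with the length of the gap. -/
theorem abs_nonlin_le_gap (h : IsOrbit F p q x) (hF : Ctrl F L c) (hM : ∀ k, gap x k ≤ M)
    {k : ℤ} {y : ℝ} (hy : y ∈ Set.Icc (x k) (x (k + 1))) {l : ℕ} (hl : l ≤ q) :
    |nonlin (F^[l]) y| ≤ 2 * √(2 * c 0) * Real.exp L ^ 3 * √M / gap x k := by
  obtain ⟨m, hm⟩ := h.exists_min_gap
  set μ := gap x m with hμ
  have hμ0 : 0 < μ := h.gap_pos m
  obtain ⟨i, hi, him⟩ := h.exists_index k m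
  have hgap : gap x (k + i * p) = μ := h.gap_eq_of_modEq him
  have hDi := h.deriv_iterate_le hF hy hi.le
  rw [hgap] at hDi
  have hgk := h.gap_pos k
  have hE1 : 1 ≤ Real.exp L := Real.one_le_exp hF.pos.le
  have hA := Real.sqrt_nonneg (2 * c 0)
  set B := √(2 * c 0) * Real.exp L ^ 2 * (√M / μ) with hB
  have hB0 : 0 ≤ B := by positivity
  have hfin : B * deriv (F^[i]) y ≤ √(2 * c 0) * Real.exp L ^ 3 * √M / gap x k := by
    calc _ ≤ B * (Real.exp L * μ / gap x k) := by gcongr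
      _ = _ := by rw [hB]; field_simp
  have hDpos := (h.lift.iterate i).deriv_pos y
  have hwi := h.abs_nonlin_le_deriv hF hM hμ0 hm hi.le y
  rw [← hB] at hwi
  have htot : |nonlin (F^[l]) y| ≤ 2 * (B * deriv (F^[i]) y) := by
    rcases le_total i l with hil | hli
    · have hw := h.abs_nonlin_le_const hF hM hμ0 hm (l := l - i) (by omega) (F^[i] y)
      have hw' : |nonlin (F^[l - i]) (F^[i] y)| ≤ B := by
        refine hw.trans ?_
        rw [hB]
        have : Real.exp L ≤ Real.exp L ^ 2 := le_self_pow₀ hE1 (by norm_num)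
        gcongr
      have hco := h.lift.nonlin_iterate_add (l - i) i y
      rw [Nat.sub_add_cancel hil] at hco
      rw [hco]
      refine (abs_add_le _ _).trans ?_
      rw [abs_mul, abs_of_pos hDpos]
      nlinarith
    · have hw := h.abs_nonlin_le_deriv hF hM hμ0 hm (l := i - l) (by omega) (F^[l] y)
      have hDl := (h.lift.iterate l).deriv_pos y
      have hco := h.lift.nonlin_iterate_add (i - l) l y
      have hD := h.lift.deriv_iterate_add (i - l) l y
      rw [Nat.sub_add_cancel hli] at hco hD
      have h1 : nonlin (F^[l]) y = nonlin (F^[i]) y -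
          nonlin (F^[i - l]) (F^[l] y) * deriv (F^[l]) y := by linarith
      rw [h1]
      refine (abs_sub _ _).trans ?_
      rw [abs_mul, abs_of_pos hDl]
      have h2 := mul_le_mul_of_nonneg_right hw hDl.le
      rw [mul_assoc _ (deriv (F^[i - l]) (F^[l] y)), ← hD] at h2
      linarith
  refine htot.trans ((mul_le_mul_of_nonneg_left hfin zero_le_two).trans_eq ?_)
  ring

/-- Derivative bounds for the iterates up to the period. -/
theorem exists_wtAt_deriv_iterate (L : ℝ) (c : ℕ → ℝ) : ∃ E : ℝ, 1 ≤ E ∧ Real.exp L ≤ E ∧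
    ∀ n : ℕ, ∃ C : ℝ, 1 ≤ C ∧
    ∀ {F : ℝ → ℝ} {p : ℤ} {q : ℕ} {x : ℤ → ℝ} {M : ℝ}, IsOrbit F p q x → Ctrl F L c →
      (∀ k, gap x k ≤ M) → ∀ {k : ℤ} {y : ℝ}, y ∈ Set.Icc (x k) (x (k + 1)) → ∀ {l : ℕ}, l ≤ q →
      WtAt n (deriv (F^[l])) y (C * deriv (F^[l]) y) (E * √M / gap x k) := by
  refine ⟨max (2 * √(2 * c 0) * Real.exp L ^ 3) (max (Real.exp L) 1), ?_, ?_, fun n => ?_⟩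
  · exact (le_max_right _ _).trans (le_max_right _ _)
  · exact (le_max_left _ _).trans (le_max_right _ _)
  set E := max (2 * √(2 * c 0) * Real.exp L ^ 3) (max (Real.exp L) 1) with hE
  obtain ⟨C₁, hC₁, h₁⟩ := exists_wtAt_nonlin c n
  obtain ⟨C₂, hC₂, h₂⟩ := exists_wtAt_deriv n hC₁
  refine ⟨C₂, hC₂, fun {F p q x M} h hF hM {k y} hy {l} hl => ?_⟩
  have hgk := h.gap_pos k
  have hE1 : Real.exp L ≤ E := (le_max_left _ _).trans (le_max_right _ _)
  have hE0 : 0 ≤ E := (Real.exp_pos L).le.trans hE1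
  have hw : ∀ l ≤ q, |nonlin (F^[l]) y| ≤ E * √M / gap x k := fun l hl => by
    refine (h.abs_nonlin_le_gap hF hM hy hl).trans ?_
    have : 2 * √(2 * c 0) * Real.exp L ^ 3 ≤ E := le_max_left _ _
    gcongr
  have hs : ∑ j ∈ Finset.range q, deriv (F^[j]) y ^ 2 ≤ (E * √M / gap x k) ^ 2 := by
    refine (h.sum_sq_deriv_le hF hM hy le_rfl).trans ?_
    gcongr
  have hΛ : 0 ≤ E * √M / gap x k := by positivity
  exact (h₂ (h.lift.iterate l) hΛ (h₁ hF hΛ hw hs l hl)).of_le (Nat.le_succ n)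

end IsOrbit

/-- Iterated Rolle theorem. -/
theorem exists_iteratedDeriv_eq_zero (m : ℕ) : ∀ {u : ℝ → ℝ} {z : ℕ → ℝ}, ContDiff ℝ ∞ u →
    (∀ i < m, z i < z (i + 1)) → (∀ i ≤ m, u (z i) = 0) → ∀ j ≤ m,
    ∃ w ∈ Set.Icc (z 0) (z m), iteratedDeriv j u w = 0 := by
  induction m with
  | zero =>
    intro u z hu hz h0 j hj
    obtain rfl : j = 0 := by omega
    exact ⟨z 0, by simp, by simpa using h0 0 le_rfl⟩
  | succ m ih =>
    intro u z hu hz h0 j hj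
    have hmono : ∀ i ≤ m + 1, z 0 ≤ z i := by
      intro i
      induction i with
      | zero => exact fun _ => le_rfl
      | succ i ih' => exact fun hi => (ih' (by omega)).trans (hz i (by omega)).le
    rcases j with _ | j
    · exact ⟨z 0, ⟨le_rfl, hmono _ le_rfl⟩, by simpa using h0 0 (by omega)⟩
    have : ∀ i, ∃ w, i < m + 1 → w ∈ Set.Ioo (z i) (z (i + 1)) ∧ deriv u w = 0 := fun i => by
      by_cases hi : i < m + 1
      · obtain ⟨w, hw, hw'⟩ := exists_deriv_eq_zero (hz i hi) hu.continuous.continuousOn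
          ((h0 i hi.le).trans (h0 (i + 1) hi).symm)
        exact ⟨w, fun _ => ⟨hw, hw'⟩⟩
      · exact ⟨0, fun h => absurd h hi⟩
    choose w hw using this
    obtain ⟨v, hv, hv'⟩ := ih (u := deriv u) (z := w) (contDiff_infty_iff_deriv.1 hu).2
      (fun i hi => (hw i (by omega)).1.2.trans (hw (i + 1) (by omega)).1.1)
      (fun i hi => (hw i (by omega)).2) j (by omega)
    refine ⟨v, ⟨(hw 0 (by omega)).1.1.le.trans hv.1, hv.2.trans (hw m (by omega)).1.2.le⟩, ?_⟩
    rwa [iteratedDeriv_succ']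

/-- A function with many zeros in a short interval is small together with its derivatives. -/
theorem abs_iteratedDeriv_le_of_zeros {u : ℝ → ℝ} {a b S : ℝ} {m : ℕ} (hu : ContDiff ℝ ∞ u)
    (h0 : ∀ j ≤ m, ∃ w ∈ Set.Icc a b, iteratedDeriv j u w = 0)
    (hS : ∀ y ∈ Set.Icc a b, |iteratedDeriv (m + 1) u y| ≤ S) (d : ℕ) :
    ∀ j, j + d = m + 1 → ∀ y ∈ Set.Icc a b, |iteratedDeriv j u y| ≤ S * (b - a) ^ d := by
  induction d with
  | zero =>
    intro j hj y hy
    obtain rfl : j = m + 1 := by omega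
    simpa using hS y hy
  | succ d ih =>
    intro j hj y hy
    obtain ⟨w, hw, hw0⟩ := h0 j (by omega)
    have hd : ∀ y ∈ Set.Icc a b, DifferentiableAt ℝ (iteratedDeriv j u) y := fun y _ =>
      (hu.differentiable_iteratedDeriv j (by exact_mod_cast ENat.natCast_lt_top j)) y
    have hb : ∀ y ∈ Set.Icc a b, ‖deriv (iteratedDeriv j u) y‖ ≤ S * (b - a) ^ d := by
      intro y hy
      rw [← iteratedDeriv_succ]
      exact ih (j + 1) (by omega) y hy
    have h1 := Convex.norm_image_sub_le_of_norm_deriv_le hd hb (convex_Icc a b) hw hy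
    rw [hw0, sub_zero, Real.norm_eq_abs, Real.norm_eq_abs] at h1
    have hSd : 0 ≤ S * (b - a) ^ d := (norm_nonneg _).trans (hb y hy)
    have h2 : |y - w| ≤ b - a := abs_sub_le_iff.2 ⟨by linarith [hy.2, hw.1], by linarith [hy.1, hw.2]⟩
    calc _ ≤ S * (b - a) ^ d * (b - a) := h1.trans (by gcongr)
      _ = _ := by ring

namespace IsOrbit

variable {F : ℝ → ℝ} {p : ℤ} {q : ℕ} {x : ℤ → ℝ} {L : ℝ} {c : ℕ → ℝ} {M : ℝ}

theorem shift (h : IsOrbit F p q x) (m : ℤ) : IsOrbit F p q (fun k => x (k + m)) where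
  lift := h.lift
  pos := h.pos
  coprime := h.coprime
  lt_succ k := h.strictMono (by omega)
  add_q k := by rw [← h.add_q, add_right_comm]
  map k := by rw [h.map, add_right_comm]

theorem gap_shift (x : ℤ → ℝ) (m k : ℤ) : gap (fun k => x (k + m)) k = gap x (k + m) := by
  simp only [gap, add_right_comm]

theorem sq_gap_le_neighbours (h : IsOrbit F p q x) (hL : ∀ x, |nonlin F x| ≤ L) (hq : 2 ≤ q)
    (k : ℤ) : gap x k ^ 2 ≤ Real.exp L ^ 2 * (gap x (k - 1) * gap x (k + 1)) := by
  have hex : ∃ K : ℕ, 0 < K ∧ ((q : ℤ) ∣ K * p - 1 ∨ (q : ℤ) ∣ K * p - (-1)) := by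
    obtain ⟨i, hi, him⟩ := h.exists_index 0 1
    refine ⟨i, ?_, Or.inl ?_⟩
    · rcases Nat.eq_zero_or_pos i with rfl | h0
      · have := him.symm.dvd
        simp at this
        have := Int.le_of_dvd one_pos (by simpa using (Int.dvd_neg.2 this))
        omega
      · exact h0
    · simpa using him.symm.dvd
  classical
  have hspec := Nat.find_spec hex
  have hmin := fun {m} => Nat.find_min hex (m := m)
  set K := Nat.find hex
  have hKq : K ≤ q := by
    obtain ⟨i, hi, him⟩ := h.exists_index 0 1
    by_contra hcon
    refine hmin (m := i) (by omega) ⟨?_, Or.inl (by simpa using him.symm.dvd)⟩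
    rcases Nat.eq_zero_or_pos i with rfl | h0
    · have := him.symm.dvd
      simp at this
      have := Int.le_of_dvd one_pos (by simpa using (Int.dvd_neg.2 this))
      omega
    · exact h0
  have hN : ∀ i : ℕ, 0 < i → i < K → ∀ m : ℤ, 2 ≤ |i * p - m * q| := by
    intro i hi0 hiK m
    have h1 := h.one_le_abs hi0 (by omega) m
    have h2 := hmin hiK
    by_contra hcon
    refine h2 ⟨hi0, ?_⟩
    have h3 : |(i : ℤ) * p - m * q| = 1 := by omega
    rcases (abs_eq zero_le_one).1 h3 with h4 | h4
    · exact Or.inl ⟨m, by linarith⟩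
    · exact Or.inr ⟨m, by linarith⟩
  rcases hspec.2 with hd | hd
  · exact h.sq_gap_le hL hd (by norm_num; omega) (by simpa using hN) k
  · have := h.sq_gap_le hL hd (by norm_num; omega) (by simpa using hN) k
    rw [sub_neg_eq_add, ← sub_eq_add_neg, mul_comm (gap x (k + 1))] at this
    exact this

theorem exists_neighbour_gap (L : ℝ) (K : ℕ) : ∃ θ : ℝ, 0 < θ ∧ θ ≤ 1 ∧
    ∀ {F : ℝ → ℝ} {p : ℤ} {q : ℕ} {x : ℤ → ℝ}, IsOrbit F p q x → (∀ x, |nonlin F x| ≤ L) → 2 ≤ q →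
      (∀ k, gap x k ≤ gap x 0) → ∀ k : ℤ, |k| ≤ K → θ * gap x 0 ≤ gap x k := by
  induction K with
  | zero =>
    refine ⟨1, one_pos, le_rfl, fun {F p q x} h hL hq hM k hk => ?_⟩
    obtain rfl : k = 0 := by simpa using hk
    simp
  | succ K ih =>
    obtain ⟨θ, hθ, hθ1, H⟩ := ih
    have hE := Real.exp_pos L
    set E := max (Real.exp L) 1 with hEd
    have hE1 : 1 ≤ E := le_max_right _ _
    have hEL : Real.exp L ≤ E := le_max_left _ _
    have hle : θ ^ 2 / E ^ 2 ≤ θ := by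
      rw [div_le_iff₀ (by positivity)]
      have : 1 ≤ E ^ 2 := one_le_pow₀ hE1
      nlinarith
    refine ⟨θ ^ 2 / E ^ 2, by positivity, hle.trans hθ1, fun {F p q x} h hL hq hM k hk => ?_⟩
    have h0 := h.gap_pos 0
    by_cases hkK : |k| ≤ K
    · exact (mul_le_mul_of_nonneg_right hle h0.le).trans (H h hL hq hM k hkK)
    have key : ∀ l l' : ℤ, |l| ≤ K → gap x l ^ 2 ≤ Real.exp L ^ 2 * (gap x l' * gap x k) →
        θ ^ 2 / E ^ 2 * gap x 0 ≤ gap x k := by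
      intro l l' hl hsq
      have h1 := H h hL hq hM l hl
      have h2 : (θ * gap x 0) ^ 2 ≤ gap x l ^ 2 := pow_le_pow_left₀ (by positivity) h1 2
      have h3 : Real.exp L ^ 2 * (gap x l' * gap x k) ≤ E ^ 2 * (gap x 0 * gap x k) := by
        have := hM l'
        have := h.gap_pos k
        have := h.gap_pos l'
        gcongr
      rw [div_mul_eq_mul_div, div_le_iff₀ (by positivity)]
      have h4 : gap x 0 * (θ ^ 2 * gap x 0) ≤ gap x 0 * (gap x k * E ^ 2) := by nlinarith
      exact le_of_mul_le_mul_left h4 h0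
    rcases abs_cases k with ⟨hka, hk0⟩ | ⟨hka, hk0⟩
    · have hs := h.sq_gap_le_neighbours hL hq (k - 1)
      rw [sub_add_cancel] at hs
      refine key (k - 1) _ ?_ hs
      rw [abs_le]
      push_cast at hk
      constructor <;> omega
    · have hs := h.sq_gap_le_neighbours hL hq (k + 1)
      rw [add_sub_cancel_right, mul_comm (gap x k)] at hs
      refine key (k + 1) _ ?_ hs
      rw [abs_le]
      push_cast at hk
      constructor <;> omega

theorem iterate_period (h : IsOrbit F p q x) (k : ℤ) : F^[q] (x k) = x k + p := by
  rw [h.iterate, mul_comm, h.add_mul_q]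

theorem one_le_mul_gap (h : IsOrbit F p q x) (hM : ∀ k, gap x k ≤ M) : 1 ≤ q * M := by
  have h1 := sub_eq_sum_gap x 0 q
  rw [h.add_q] at h1
  have h2 : ∑ s ∈ Finset.range q, gap x (0 + s) ≤ ∑ _s ∈ Finset.range q, M :=
    Finset.sum_le_sum fun s _ => hM _
  rw [Finset.sum_const, Finset.card_range, nsmul_eq_mul] at h2
  linarith

theorem sub_le_mul (hM : ∀ k, gap x k ≤ M) (k : ℤ) (d : ℕ) : x (k + d) - x k ≤ d * M := by
  rw [sub_eq_sum_gap]
  refine (Finset.sum_le_sum fun s _ => hM _).trans_eq ?_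
  rw [Finset.sum_const, Finset.card_range, nsmul_eq_mul]

theorem exists_mem_Icc_gap (h : IsOrbit F p q x) {a b : ℤ} {y : ℝ}
    (hy : y ∈ Set.Icc (x a) (x b)) (hab : a < b) :
    ∃ k, a ≤ k ∧ k < b ∧ y ∈ Set.Icc (x k) (x (k + 1)) := by
  obtain ⟨k, hk1, hk2⟩ := h.exists_mem_gap y
  have h1 : a < k + 1 := h.strictMono.lt_iff_lt.1 (hy.1.trans_lt hk2)
  have h2 : k ≤ b := h.strictMono.le_iff_le.1 (hk1.trans hy.2)
  rcases h2.lt_or_eq with h3 | rfl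
  · exact ⟨k, by omega, h3, hk1, hk2.le⟩
  · have : y = x k := le_antisymm hy.2 hk1
    refine ⟨k - 1, by omega, by omega, ?_⟩
    rw [this, sub_add_cancel]
    exact ⟨(h.strictMono (by omega)).le, le_rfl⟩

/-- Near the longest gap, the `q`-th iterate is close to the translation by `p`. -/
theorem exists_iterate_sub_le (L : ℝ) (c : ℕ → ℝ) (r J : ℕ) : ∃ C : ℝ, 1 ≤ C ∧
    ∀ {F : ℝ → ℝ} {p : ℤ} {q : ℕ} {x : ℤ → ℝ}, IsOrbit F p q x → Ctrl F L c → 2 ≤ q →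
      (∀ k, gap x k ≤ gap x 0) → ∀ y ∈ Set.Icc (x (-3)) (x 4),
      WtAt r (fun z => F^[q] z - z - p) y (C * gap x 0 ^ J) 1 := by
  obtain ⟨E, hE1, hEL, hE⟩ := exists_wtAt_deriv_iterate L c
  set s := r + J + 4 with hs
  set m := 2 * s with hm
  obtain ⟨C₁, hC₁, h₁⟩ := hE m
  obtain ⟨θ, hθ, hθ1, hθ'⟩ := exists_neighbour_gap L m
  set C := C₁ * E * (E / θ) ^ m * (m : ℝ) ^ (m + 1) with hC
  have hm1 : (1 : ℝ) ≤ m := by exact_mod_cast (by omega : 1 ≤ m)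
  have hEθ : 1 ≤ E / θ := by rw [le_div_iff₀ hθ]; linarith
  have hC1 : 1 ≤ C := by
    rw [hC]
    have h1 := one_le_mul_of_one_le_of_one_le hC₁ hE1
    have h2 := one_le_mul_of_one_le_of_one_le h1 (one_le_pow₀ hEθ (n := m))
    exact one_le_mul_of_one_le_of_one_le h2 (one_le_pow₀ hm1)
  refine ⟨C, hC1, fun {F p q x} h hF hq hM y hy i hi => ?_⟩
  set M := gap x 0 with hMd
  have hM0 : 0 < M := h.gap_pos 0
  have hM1 : M ≤ 1 := h.gap_le_one 0
  have hG := h.lift.iterate q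
  set u : ℝ → ℝ := fun z => F^[q] z - z - p with hu
  have hucd : ContDiff ℝ ∞ u := (hG.contDiff.sub contDiff_id).sub contDiff_const
  have hzero : ∀ j ≤ m, ∃ w ∈ Set.Icc (x (-3)) (x (-3 + m)), iteratedDeriv j u w = 0 := by
    have := exists_iteratedDeriv_eq_zero m (u := u) (z := fun i => x (-3 + i)) hucd
      (fun i _ => h.strictMono (by push_cast; omega)) (fun i _ => by
        simp only [hu]; rw [h.iterate_period]; ring)
    simpa using this
  have hsup : ∀ y ∈ Set.Icc (x (-3)) (x (-3 + m)),
      |iteratedDeriv (m + 1) u y| ≤ C₁ * E * (E / θ) ^ m * (1 / M) ^ s := by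
    intro y hy
    obtain ⟨k, hk1, hk2, hk⟩ := h.exists_mem_Icc_gap hy (by omega)
    have hd : deriv u = fun z => deriv (F^[q]) z + (-1) := by
      ext z
      exact (((hG.hasDerivAt z).sub (hasDerivAt_id z)).sub_const (p : ℝ)).deriv
    have hit : iteratedDeriv (m + 1) u y = iteratedDeriv m (deriv (F^[q])) y := by
      rw [iteratedDeriv_succ', hd, iteratedDeriv_fun_add
        (hG.contDiff_deriv.contDiffAt.of_le (by exact_mod_cast le_top)) contDiffAt_const,
        iteratedDeriv_const, if_neg (by omega), add_zero]
    rw [hit]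
    refine (h₁ h hF hM hk le_rfl m le_rfl).trans ?_
    have hgk := h.gap_pos k
    have hDq : deriv (F^[q]) y ≤ E := by
      refine (h.deriv_iterate_le hF hk le_rfl).trans ?_
      rw [mul_comm (q : ℤ), h.gap_add_mul_q, mul_div_cancel_right₀ _ hgk.ne']
      exact hEL
    have hg := hθ' h hF.nonlin_le hq hM k (by rw [abs_le]; constructor <;> omega)
    have hw : E * √M / gap x k ≤ E / θ * (1 / √M) := by
      have hsq : √M * √M = M := Real.mul_self_sqrt hM0.le
      have hs0 : 0 < √M := Real.sqrt_pos.2 hM0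
      calc _ ≤ E * √M / (θ * M) := by gcongr
        _ = E * √M / (θ * (√M * √M)) := by rw [hsq]
        _ = _ := by field_simp
    have hDpos := hG.deriv_pos y
    calc _ ≤ C₁ * E * (E / θ * (1 / √M)) ^ m := by gcongr
      _ = _ := by
        rw [mul_pow, hm, pow_mul (1 / √M), div_pow 1 (√M), Real.sq_sqrt hM0.le]
        ring
  have hlen : x (-3 + m) - x (-3) ≤ m * M := sub_le_mul hM (-3) m
  have hy' : y ∈ Set.Icc (x (-3)) (x (-3 + m)) :=
    ⟨hy.1, hy.2.trans (h.strictMono.monotone (by omega))⟩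
  have hlen0 : 0 ≤ x (-3 + m) - x (-3) := by linarith [hy'.1, hy'.2]
  have hfin := abs_iteratedDeriv_le_of_zeros hucd hzero hsup (m + 1 - i) i (by omega) y hy'
  refine hfin.trans ?_
  rw [one_pow, mul_one]
  have hpow : (m : ℝ) ^ (m + 1 - i) ≤ (m : ℝ) ^ (m + 1) := pow_le_pow_right₀ hm1 (by omega)
  calc _ ≤ C₁ * E * (E / θ) ^ m * (1 / M) ^ s * (m * M) ^ (m + 1 - i) := by gcongr
    _ = C₁ * E * (E / θ) ^ m * (m : ℝ) ^ (m + 1 - i) * M ^ (m + 1 - i - s) := by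
      rw [mul_pow, ← Nat.sub_add_cancel (show s ≤ m + 1 - i by omega), pow_add M, one_div, inv_pow,
        Nat.add_sub_cancel]
      field_simp
    _ ≤ C * M ^ J := by
      rw [hC]
      have : M ^ (m + 1 - i - s) ≤ M ^ J := pow_le_pow_of_le_one hM0.le hM1 (by omega)
      gcongr

end IsOrbit

/-- Derivatives of the increment of `u` along a small displacement field `ξ`. -/
theorem exists_wtAt_comp_sub (k : ℕ) : ∃ C : ℝ, 1 ≤ C ∧ ∀ {u ξ : ℝ → ℝ} {z P η : ℝ},
    ContDiff ℝ ∞ u → ContDiff ℝ ∞ ξ → η ≤ 1 → WtAt k ξ z η 1 →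
    (∀ y ∈ Set.uIcc z (z + ξ z), WtAt k (deriv u) y P 1) →
    WtAt k (fun y => u (y + ξ y) - u y) z (C * P * η) 1 := by
  have base : ∀ {u ξ : ℝ → ℝ} {z P η : ℝ}, ContDiff ℝ ∞ u → |ξ z| ≤ η →
      (∀ y ∈ Set.uIcc z (z + ξ z), |deriv u y| ≤ P) → |u (z + ξ z) - u z| ≤ P * η := by
    intro u ξ z P η hu hξ hP
    have h1 := Convex.norm_image_sub_le_of_norm_deriv_le (C := P) (s := Set.uIcc z (z + ξ z))
      (fun y _ => hu.differentiable (by simp) y) hP (convex_uIcc _ _) Set.left_mem_uIcc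
      Set.right_mem_uIcc
    have hP0 : 0 ≤ P := (abs_nonneg _).trans (hP z Set.left_mem_uIcc)
    rw [add_sub_cancel_left] at h1
    exact h1.trans (mul_le_mul_of_nonneg_left hξ hP0)
  induction k with
  | zero =>
    refine ⟨1, le_rfl, fun {u ξ z P η} hu hξ hη h hP i hi => ?_⟩
    obtain rfl : i = 0 := by omega
    simp only [iteratedDeriv_zero, pow_zero, mul_one, one_mul]
    exact base hu (by simpa using h 0 le_rfl) fun y hy => by simpa using hP y hy 0 le_rfl
  | succ k ih =>
    obtain ⟨C, hC, H⟩ := ih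
    refine ⟨C + 2 ^ k * (C + 1), ?_, fun {u ξ z P η} hu hξ hη h hP => ?_⟩
    · have : 0 ≤ 2 ^ k * (C + 1) := by positivity
      linarith
    have hη0 : 0 ≤ η := by simpa using (abs_nonneg _).trans (h 0 (by omega))
    have hP0 : 0 ≤ P := by
      simpa using (abs_nonneg _).trans (hP z Set.left_mem_uIcc 0 (by omega))
    have hK : 1 ≤ C + 2 ^ k * (C + 1) := by
      have : 0 ≤ 2 ^ k * (C + 1) := by positivity
      linarith
    have hu' : ContDiff ℝ ∞ (deriv u) := (contDiff_infty_iff_deriv.1 hu).2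
    have hξ' : ContDiff ℝ ∞ (deriv ξ) := (contDiff_infty_iff_deriv.1 hξ).2
    have hψ : ContDiff ℝ ∞ (fun y => y + ξ y) := contDiff_id.add hξ
    have hcomp : ContDiff ℝ ∞ (fun y => deriv u (y + ξ y)) := hu'.comp hψ
    have hd : deriv (fun y => u (y + ξ y) - u y) = fun y =>
        (deriv u (y + ξ y) - deriv u y) + deriv u (y + ξ y) * deriv ξ y := by
      ext y
      have h1 : HasDerivAt (fun y => y + ξ y) (1 + deriv ξ y) y :=
        (hasDerivAt_id y).add (hξ.differentiable (by simp) y).hasDerivAt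
      have h2 := ((hu.differentiable (by simp) (y + ξ y)).hasDerivAt.comp y h1).sub
        (hu.differentiable (by simp) y).hasDerivAt
      refine h2.deriv.trans ?_
      ring
    have h1 : WtAt k (fun y => deriv u (y + ξ y) - deriv u y) z (C * P * η) 1 := by
      refine H hu' hξ hη (h.of_le (Nat.le_succ k)) fun y hy i hi => ?_
      have := hP y hy (i + 1) (by omega)
      rw [iteratedDeriv_succ'] at this
      simpa using this
    have h2 : WtAt k (fun y => deriv u (y + ξ y)) z ((C + 1) * P) 1 := by
      have := h1.add (hcomp.sub hu') hu' ((hP z Set.left_mem_uIcc).of_le (Nat.le_succ k))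
      simp only [sub_add_cancel] at this
      refine this.mono ?_ zero_le_one
      have : C * P * η ≤ C * P := mul_le_of_le_one_right (by positivity) hη
      linarith
    have h3 : WtAt k (deriv ξ) z η 1 := fun i hi => by
      have := h (i + 1) (by omega)
      rw [iteratedDeriv_succ'] at this
      simpa using this
    have h4 := h2.mul hcomp hξ' (by positivity) hη0 zero_le_one h3
    refine WtAt.of_deriv ?_ ?_
    · refine (base hu (by simpa using h 0 (by omega)) fun y hy => by
        simpa using hP y hy 0 (by omega)).trans ?_
      rw [mul_assoc]
      exact le_mul_of_one_le_left (by positivity) hK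
    · rw [hd]
      refine (h1.add (hcomp.sub hu') (hcomp.mul hξ') h4).mono (le_of_eq ?_) zero_le_one
      ring

/-- Solving `h (z + ξ z) - h z = e z` for `ξ` with estimates. -/
theorem exists_wtAt_displacement {κ : ℝ} (hκ : 0 < κ) (r : ℕ) : ∃ C : ℝ, 1 ≤ C ∧
    ∀ {h e ξ : ℝ → ℝ} {z P η : ℝ},
    ContDiff ℝ ∞ h → ContDiff ℝ ∞ e → ContDiff ℝ ∞ ξ → (∀ y, κ ≤ deriv h y) →
    (∀ y, h (y + ξ y) - h y = e y) → 1 ≤ P →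
    (∀ y ∈ Set.uIcc z (z + ξ z), WtAt r (deriv h) y P 1) → WtAt r e z η 1 →
    (C * P) ^ (r + 1) * η ≤ 1 → WtAt r ξ z ((C * P) ^ (r + 1) * η) 1 := by
  induction r with
  | zero =>
    refine ⟨max κ⁻¹ 1, le_max_right _ _, fun {h e ξ z P η} hh he hξ hκh heq hP1 hP hη hle i hi => ?_⟩
    obtain rfl : i = 0 := by omega
    have hη' : |e z| ≤ η := by simpa using hη 0 le_rfl
    have hη0 : 0 ≤ η := (abs_nonneg _).trans hη'
    simp only [iteratedDeriv_zero, pow_zero, mul_one, zero_add, pow_one]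
    have h1 : κ * |ξ z| ≤ |e z| := by
      rw [← heq z]
      have hd : Differentiable ℝ h := hh.differentiable (by simp)
      rcases le_total 0 (ξ z) with h0 | h0
      · rw [abs_of_nonneg h0]
        refine le_trans ?_ (le_abs_self _)
        have := mul_sub_le_image_sub_of_le_deriv hd hκh (x := z) (y := z + ξ z) (by linarith)
        simpa using this
      · rw [abs_of_nonpos h0, abs_sub_comm]
        refine le_trans ?_ (le_abs_self _)
        have := mul_sub_le_image_sub_of_le_deriv hd hκh (x := z + ξ z) (y := z) (by linarith)
        simpa using this
    have h2 : κ⁻¹ ≤ max κ⁻¹ 1 * P := (le_max_left _ _).trans (le_mul_of_one_le_right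
      (by positivity) hP1)
    calc |ξ z| = κ⁻¹ * (κ * |ξ z|) := by field_simp
      _ ≤ κ⁻¹ * η := by gcongr; exact h1.trans hη'
      _ ≤ _ := by gcongr
  | succ r ih =>
    obtain ⟨C, hC, H⟩ := ih
    obtain ⟨D, hD, HD⟩ := exists_wtAt_comp_sub r
    set C' := max C (κ⁻¹ * (1 + D + 2 ^ r * (D + 1))) with hC'
    have hCC' : C ≤ C' := le_max_left _ _
    refine ⟨C', hC.trans hCC', fun {h e ξ z P η} hh he hξ hκh heq hP1 hP hη hle => ?_⟩
    have hη0 : 0 ≤ η := by simpa using (abs_nonneg _).trans (hη 0 (by omega))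
    have hC'1 : 1 ≤ C' := hC.trans hCC'
    have hCP : 1 ≤ C' * P := one_le_mul_of_one_le_of_one_le hC'1 hP1
    set η₁ := (C' * P) ^ (r + 1) * η with hη₁
    have hη₁0 : 0 ≤ η₁ := by positivity
    have hηη₁ : η ≤ η₁ := le_mul_of_one_le_left hη0 (one_le_pow₀ hCP)
    have hη₂ : (C' * P) ^ (r + 1 + 1) * η = C' * P * η₁ := by rw [hη₁]; ring
    rw [hη₂] at hle ⊢
    have hη₁le : η₁ ≤ 1 := (le_mul_of_one_le_left hη₁0 hCP).trans hle
    have hcmp : (C * P) ^ (r + 1) * η ≤ η₁ := by rw [hη₁]; gcongr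
    have hξr : WtAt r ξ z η₁ 1 := (H hh he hξ hκh heq hP1 (fun y hy => (hP y hy).of_le
      (Nat.le_succ r)) (hη.of_le (Nat.le_succ r)) (hcmp.trans hη₁le)).mono hcmp zero_le_one
    have hh' : ContDiff ℝ ∞ (deriv h) := (contDiff_infty_iff_deriv.1 hh).2
    have hξ' : ContDiff ℝ ∞ (deriv ξ) := (contDiff_infty_iff_deriv.1 hξ).2
    have he' : ContDiff ℝ ∞ (deriv e) := (contDiff_infty_iff_deriv.1 he).2
    have hψ : ContDiff ℝ ∞ (fun y => y + ξ y) := contDiff_id.add hξ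
    have hv : ContDiff ℝ ∞ (fun y => deriv h (y + ξ y)) := hh'.comp hψ
    have h1 : WtAt r (fun y => deriv h (y + ξ y) - deriv h y) z (D * P * η₁) 1 := by
      refine HD hh' hξ hη₁le hξr fun y hy i hi => ?_
      have := hP y hy (i + 1) (by omega)
      rw [iteratedDeriv_succ'] at this
      simpa using this
    have h2 : WtAt r (fun y => deriv h (y + ξ y)) z ((D + 1) * P) 1 := by
      have := h1.add (hv.sub hh') hh' ((hP z Set.left_mem_uIcc).of_le (Nat.le_succ r))
      simp only [sub_add_cancel] at this
      refine this.mono ?_ zero_le_one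
      have : D * P * η₁ ≤ D * P := mul_le_of_le_one_right (by positivity) hη₁le
      linarith
    have hprod : (fun y => deriv h (y + ξ y) * deriv ξ y) =
        fun y => deriv e y + (-1) * (deriv h (y + ξ y) - deriv h y) := by
      ext y
      have h3 : HasDerivAt (fun y => y + ξ y) (1 + deriv ξ y) y :=
        (hasDerivAt_id y).add (hξ.differentiable (by simp) y).hasDerivAt
      have h4 := ((hh.differentiable (by simp) (y + ξ y)).hasDerivAt.comp y h3).sub
        (hh.differentiable (by simp) y).hasDerivAt
      have h5 := h4.deriv
      rw [show (h ∘ (fun y => y + ξ y) - h) = e from funext heq] at h5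
      rw [h5]; ring
    have h6 : WtAt r (deriv e) z η 1 := fun i hi => by
      have := hη (i + 1) (by omega)
      rw [iteratedDeriv_succ'] at this
      simpa using this
    have h7 : |iteratedDeriv r (fun y => deriv h (y + ξ y) * deriv ξ y) z| ≤
        (1 + D) * (P * η₁) := by
      rw [hprod]
      refine ((h6.add he' (contDiff_const.mul (hv.sub hh')) (h1.const_mul (-1))) r le_rfl).trans ?_
      rw [one_pow, mul_one, abs_neg, abs_one, one_mul]
      have : η ≤ P * η₁ := hηη₁.trans (le_mul_of_one_le_left hη₁0 hP1)
      linarith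
    intro i hi
    rcases hi.lt_or_eq with hi' | rfl
    · refine (hξr i (by omega)).trans ?_
      gcongr
      exact le_mul_of_one_le_left hη₁0 hCP
    rw [iteratedDeriv_fun_mul (hv.contDiffAt.of_le (by exact_mod_cast le_top))
      (hξ'.contDiffAt.of_le (by exact_mod_cast le_top)), Finset.sum_range_succ'] at h7
    simp only [Nat.choose_zero_right, Nat.cast_one, iteratedDeriv_zero, one_mul, Nat.sub_zero] at h7
    have h8 : |∑ j ∈ Finset.range r, (r.choose (j + 1) : ℝ) *
        iteratedDeriv (j + 1) (fun y => deriv h (y + ξ y)) z *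
        iteratedDeriv (r - (j + 1)) (deriv ξ) z| ≤ 2 ^ r * ((D + 1) * (P * η₁)) := by
      calc _ ≤ ∑ j ∈ Finset.range r, (r.choose (j + 1) : ℝ) * ((D + 1) * (P * η₁)) := by
            refine (Finset.abs_sum_le_sum_abs _ _).trans (Finset.sum_le_sum fun j hj => ?_)
            have hj' := Finset.mem_range.1 hj
            rw [abs_mul, abs_mul, Nat.abs_cast, mul_assoc]
            refine mul_le_mul_of_nonneg_left ?_ (Nat.cast_nonneg _)
            have h9 := h2 (j + 1) (by omega)
            have h10 := hξr (r - (j + 1) + 1) (by omega)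
            rw [iteratedDeriv_succ'] at h10
            rw [one_pow, mul_one] at h9 h10
            calc _ ≤ ((D + 1) * P) * η₁ := by gcongr
              _ = _ := by ring
        _ ≤ ∑ j ∈ Finset.range (r + 1), (r.choose j : ℝ) * ((D + 1) * (P * η₁)) := by
            rw [Finset.sum_range_succ']
            refine le_add_of_nonneg_right (by positivity)
        _ = _ := by
            rw [← Finset.sum_mul]
            norm_cast
            rw [Nat.sum_range_choose]
    have h11 : κ * |iteratedDeriv r (deriv ξ) z| ≤
        (1 + D + 2 ^ r * (D + 1)) * (P * η₁) := by
      have h12 : κ * |iteratedDeriv r (deriv ξ) z| ≤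
          |deriv h (z + ξ z) * iteratedDeriv r (deriv ξ) z| := by
        rw [abs_mul]
        exact mul_le_mul_of_nonneg_right ((hκh _).trans (le_abs_self _)) (abs_nonneg _)
      have h13 := abs_sub_abs_le_abs_sub (deriv h (z + ξ z) * iteratedDeriv r (deriv ξ) z)
        (-∑ j ∈ Finset.range r, (r.choose (j + 1) : ℝ) *
        iteratedDeriv (j + 1) (fun y => deriv h (y + ξ y)) z *
        iteratedDeriv (r - (j + 1)) (deriv ξ) z)
      rw [sub_neg_eq_add, abs_neg, add_comm (deriv h (z + ξ z) * _)] at h13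
      linarith
    rw [iteratedDeriv_succ', one_pow, mul_one]
    calc |iteratedDeriv r (deriv ξ) z| = κ⁻¹ * (κ * |iteratedDeriv r (deriv ξ) z|) := by field_simp
      _ ≤ κ⁻¹ * ((1 + D + 2 ^ r * (D + 1)) * (P * η₁)) := by gcongr
      _ = (κ⁻¹ * (1 + D + 2 ^ r * (D + 1))) * (P * η₁) := by ring
      _ ≤ C' * (P * η₁) := by
          gcongr
          exact le_max_right _ _
      _ = _ := by ring

theorem exists_bound_iteratedDeriv_smoothTransition (i : ℕ) :
    ∃ C : ℝ, ∀ y, |iteratedDeriv i Real.smoothTransition y| ≤ C := by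
  have hcont : Continuous (iteratedDeriv i Real.smoothTransition) :=
    (Real.smoothTransition.contDiff (n := ⊤)).continuous_iteratedDeriv i (by exact_mod_cast le_top)
  obtain ⟨C, hC⟩ := (isCompact_Icc (a := (0 : ℝ)) (b := 1)).exists_bound_of_continuousOn
    hcont.continuousOn
  refine ⟨max C 1, fun y => ?_⟩
  have hconst : ∀ a : ℝ, |a| ≤ 1 → |iteratedDeriv i (fun _ : ℝ => a) y| ≤ 1 := fun a ha => by
    rw [iteratedDeriv_const]
    split_ifs
    · exact ha
    · simp
  rcases lt_or_ge y 0 with h0 | h0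
  · refine le_trans ?_ (le_max_right _ _)
    have : Real.smoothTransition =ᶠ[𝓝 y] fun _ => (0 : ℝ) := by
      filter_upwards [Iio_mem_nhds h0] with t ht
      exact Real.smoothTransition.zero_of_nonpos (le_of_lt ht)
    rw [this.iteratedDeriv_eq]
    exact hconst 0 (by simp)
  rcases le_or_gt y 1 with h1 | h1
  · exact (hC y ⟨h0, h1⟩).trans (le_max_left _ _)
  · refine le_trans ?_ (le_max_right _ _)
    have : Real.smoothTransition =ᶠ[𝓝 y] fun _ => (1 : ℝ) := by
      filter_upwards [Ioi_mem_nhds h1] with t ht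
      exact Real.smoothTransition.one_of_one_le (le_of_lt ht)
    rw [this.iteratedDeriv_eq]
    exact hconst 1 (by simp)

theorem le_cos_sub_cos {a b : ℝ} (ha : 0 ≤ a) (hab : a ≤ b) (h : a + b ≤ 1 / 2) :
    8 * (b ^ 2 - a ^ 2) ≤ Real.cos (2 * Real.pi * a) - Real.cos (2 * Real.pi * b) := by
  have hπ := Real.pi_pos
  have h1 := Real.mul_le_sin (x := Real.pi * (a + b))
    (mul_nonneg hπ.le (by linarith)) (by nlinarith)
  have h2 := Real.mul_le_sin (x := Real.pi * (b - a))
    (mul_nonneg hπ.le (by linarith)) (by nlinarith)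
  have e1 : 2 / Real.pi * (Real.pi * (a + b)) = 2 * (a + b) := by field_simp
  have e2 : 2 / Real.pi * (Real.pi * (b - a)) = 2 * (b - a) := by field_simp
  rw [e1] at h1
  rw [e2] at h2
  rw [Real.cos_sub_cos, show (2 * Real.pi * a + 2 * Real.pi * b) / 2 = Real.pi * (a + b) by ring,
    show (2 * Real.pi * a - 2 * Real.pi * b) / 2 = -(Real.pi * (b - a)) by ring, Real.sin_neg]
  have h3 : 2 * (a + b) * (2 * (b - a)) ≤
      Real.sin (Real.pi * (a + b)) * Real.sin (Real.pi * (b - a)) :=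
    mul_le_mul h1 h2 (by linarith) (le_trans (by linarith) h1)
  nlinarith

/-- Periodic bump functions with derivative bounds polynomial in the inverse of the width. -/
theorem exists_bump {κ : ℝ} (hκ : 0 < κ) (hκ' : κ ≤ 1 / 2) (n : ℕ) : ∃ C : ℝ, 1 ≤ C ∧
    ∀ a M : ℝ, 0 < M → M ≤ 1 / 4 → ∃ β : ℝ → ℝ, ContDiff ℝ ∞ β ∧ (∀ y, β (y + 1) = β y) ∧
      (∀ y, 0 ≤ β y) ∧ (∀ y, β y ≤ 1) ∧ (∀ y, |y - a| ≤ M / 2 → β y = 1) ∧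
      (∀ y, (1 / 2 + κ) * M ≤ |y - a| → |y - a| ≤ 1 / 2 → β y = 0) ∧
      ∀ y, WtAt n β y (C * (1 / M) ^ (2 * n)) 1 := by
  have hπ := Real.pi_pos
  set g : ℝ → ℝ := fun y => Real.cos (2 * Real.pi * y) with hg
  have hgcd : ContDiff ℝ ∞ g := Real.contDiff_cos.comp (contDiff_const.mul contDiff_id)
  have hgper : ∀ y, g (y + 1) = g y := fun y => by
    simp only [hg]
    rw [mul_add, mul_one, Real.cos_add_two_pi]
  have : ∀ i, ∃ K, 0 ≤ K ∧ ∀ y, |iteratedDeriv i g y| ≤ K := fun i =>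
    exists_bound_of_periodic (hgcd.continuous_iteratedDeriv i (by exact_mod_cast le_top))
      (periodic_iteratedDeriv hgper i)
  choose K hK0 hK using this
  choose S hS using exists_bound_iteratedDeriv_smoothTransition
  have hS0 : ∀ i, 0 ≤ S i := fun i => (abs_nonneg _).trans (hS i 0)
  set K' := 1 + ∑ i ∈ Finset.range (n + 1), K i with hK'
  have hKsum : 0 ≤ ∑ i ∈ Finset.range (n + 1), K i := Finset.sum_nonneg fun i _ => hK0 i
  have hKle : ∀ i ≤ n, K i ≤ K' := fun i hi => by
    have := Finset.single_le_sum (f := K) (fun i _ => hK0 i)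
      (Finset.mem_range.2 (Nat.lt_succ_of_le hi))
    linarith
  set S' := 1 + ∑ i ∈ Finset.range (n + 1), S i with hS'
  have hSsum : 0 ≤ ∑ i ∈ Finset.range (n + 1), S i := Finset.sum_nonneg fun i _ => hS0 i
  have hSle : ∀ i ≤ n, S i ≤ S' := fun i hi => by
    have := Finset.single_le_sum (f := S) (fun i _ => hS0 i)
      (Finset.mem_range.2 (Nat.lt_succ_of_le hi))
    linarith
  have hK'1 : 1 ≤ K' := by linarith
  have hS'1 : 1 ≤ S' := by linarith
  have hKκ : 1 ≤ K' / κ := by rw [le_div_iff₀ hκ]; linarith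
  refine ⟨n ! * S' * (K' / κ) ^ n, ?_, fun a M hM0 hM => ?_⟩
  · have h1 : (1 : ℝ) ≤ n ! := by exact_mod_cast Nat.one_le_iff_ne_zero.2 (Nat.factorial_ne_zero n)
    exact one_le_mul_of_one_le_of_one_le (one_le_mul_of_one_le_of_one_le h1 hS'1)
      (one_le_pow₀ hKκ)
  set b := (1 / 2 + κ) * M with hb
  have hbM : b ≤ M := by rw [hb]; nlinarith
  have hab : M / 2 ≤ b := by rw [hb]; nlinarith
  set Δ := g (M / 2) - g b with hΔ
  have hΔle : κ * M ^ 2 ≤ Δ := by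
    have := le_cos_sub_cos (a := M / 2) (b := b) (by linarith) hab (by linarith)
    refine le_trans ?_ this
    rw [hb]
    nlinarith [mul_pos hκ (sq_pos_of_pos hM0), mul_pos (mul_pos hκ hκ) (sq_pos_of_pos hM0)]
  have hΔ0 : 0 < Δ := lt_of_lt_of_le (by positivity) hΔle
  have hgabs : ∀ y, g y = g |y| := fun y => by
    simp only [hg]
    rw [← Real.cos_abs, abs_mul, abs_of_pos (by positivity : 0 < 2 * Real.pi)]
  have hganti : ∀ s t, 0 ≤ s → s ≤ t → t ≤ 1 / 2 → g t ≤ g s := fun s t hs hst ht => by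
    refine Real.cos_le_cos_of_nonneg_of_le_pi (by positivity) (by nlinarith) (by gcongr)
  set w : ℝ → ℝ := fun y => Δ⁻¹ * (g (y - a) - g b) with hw
  have hwcd : ContDiff ℝ ∞ w :=
    contDiff_const.mul ((hgcd.comp (contDiff_id.sub contDiff_const)).sub contDiff_const)
  have hdw : deriv w = fun y => Δ⁻¹ * (fun t => deriv g (t - a)) y := by
    ext y
    have h1 := ((hgcd.differentiable (by simp) (y - a)).hasDerivAt.comp y
      ((hasDerivAt_id y).sub_const a)).sub_const (g b)
    have h2 := (h1.const_mul Δ⁻¹).deriv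
    rw [mul_one] at h2
    exact h2
  refine ⟨fun y => Real.smoothTransition (w y), Real.smoothTransition.contDiff.comp hwcd,
    fun y => ?_, fun y => Real.smoothTransition.nonneg _, fun y => Real.smoothTransition.le_one _,
    fun y hy => ?_, fun y hy hy' => ?_, fun y => ?_⟩
  · simp only [hw]
    rw [show y + 1 - a = y - a + 1 by ring, hgper]
  · refine Real.smoothTransition.one_of_one_le ?_
    simp only [hw]
    rw [le_inv_mul_iff₀ hΔ0, hgabs]
    have := hganti _ _ (abs_nonneg (y - a)) hy (by linarith)
    linarith
  · refine Real.smoothTransition.zero_of_nonpos ?_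
    simp only [hw]
    refine mul_nonpos_of_nonneg_of_nonpos (by positivity) ?_
    rw [hgabs]
    have := hganti _ _ (by positivity) hy hy'
    linarith
  · have hA : (K' / κ) * (1 / M) ^ 2 ≥ 1 := by
      refine one_le_mul_of_one_le_of_one_le hKκ (one_le_pow₀ ?_)
      rw [le_div_iff₀ hM0]
      linarith
    refine (WtAt.comp (c := S') (A := (K' / κ) * (1 / M) ^ 2) Real.smoothTransition.contDiff hwcd hA
      zero_le_one (fun i hi => (hS i _).trans (hSle i hi)) fun i hi1 hi => ?_).mono ?_ zero_le_one
    · obtain ⟨i, rfl⟩ : ∃ i', i = i' + 1 := ⟨i - 1, by omega⟩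
      rw [iteratedDeriv_succ', hdw, iteratedDeriv_const_mul_field, iteratedDeriv_comp_sub_const]
      simp only [← iteratedDeriv_succ']
      rw [abs_mul, abs_of_pos (inv_pos.2 hΔ0), one_pow, mul_one]
      calc Δ⁻¹ * |iteratedDeriv (i + 1) g (y - a)| ≤ (κ * M ^ 2)⁻¹ * K' := by
            gcongr
            exact (hK _ _).trans (hKle _ hi)
        _ = _ := by field_simp
    · rw [mul_pow, ← pow_mul]
      exact le_of_eq (by ring)

/-- The sum of `B` along an orbit segment of length `q`. -/
noncomputable def orbitSum (F B : ℝ → ℝ) (q : ℕ) (z : ℝ) : ℝ := ∑ i ∈ Finset.range q, B (F^[i + 1] z)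

theorem contDiff_orbitSum {F B : ℝ → ℝ} (hF : IsSmoothLift F) (hB : ContDiff ℝ ∞ B) (q : ℕ) :
    ContDiff ℝ ∞ (orbitSum F B q) :=
  ContDiff.sum fun i _ => hB.comp (hF.iterate (i + 1)).contDiff

theorem deriv_orbitSum {F B : ℝ → ℝ} (hF : IsSmoothLift F) (hB : ContDiff ℝ ∞ B) (q : ℕ) :
    deriv (orbitSum F B q) = fun z => ∑ i ∈ Finset.range q,
      deriv B (F^[i + 1] z) * deriv (F^[i + 1]) z := by
  ext z
  exact (HasDerivAt.fun_sum fun i _ =>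
    (hB.differentiable (by simp) (F^[i + 1] z)).hasDerivAt.comp z
      ((hF.iterate (i + 1)).hasDerivAt z)).deriv

theorem map_add_int_of_map_add_one {B : ℝ → ℝ} (hB : ∀ y, B (y + 1) = B y + 1) (y : ℝ) (m : ℤ) :
    B (y + m) = B y + m := by
  induction m using Int.induction_on with
  | zero => simp
  | succ i ih =>
    push_cast at ih ⊢
    rw [← add_assoc, hB, ih]; ring
  | pred i ih =>
    push_cast at ih ⊢
    have := hB (y + (-(i : ℝ) - 1))
    rw [show y + (-(i : ℝ) - 1) + 1 = y + -i by ring, ih] at this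
    linarith

theorem orbitSum_add_one {F B : ℝ → ℝ} (hF : IsSmoothLift F) (hB : ∀ y, B (y + 1) = B y + 1)
    (q : ℕ) (z : ℝ) : orbitSum F B q (z + 1) = orbitSum F B q z + q := by
  simp only [orbitSum, (hF.iterate _).map_add_one, hB]
  rw [Finset.sum_add_distrib]
  simp

theorem orbitSum_map {F B : ℝ → ℝ} (hB : ∀ y, B (y + 1) = B y + 1)
    (q : ℕ) (p : ℤ) (z : ℝ) :
    orbitSum F B q (F z) = orbitSum F B q z + p + (B (F^[q] (F z) - p) - B (F z)) := by
  have h1 := map_add_int_of_map_add_one hB (F^[q] (F z) - p) p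
  rw [sub_add_cancel] at h1
  have h2 : orbitSum F B q (F z) = ∑ i ∈ Finset.range q, B (F^[i + 1 + 1] z) := rfl
  have h3 := Finset.sum_range_succ' (fun i => B (F^[i + 1] z)) q
  rw [Finset.sum_range_succ] at h3
  rw [h2, orbitSum]
  have h4 : F^[q + 1] z = F^[q] (F z) := rfl
  simp only [zero_add, Function.iterate_one] at h3
  rw [h4] at h3
  linarith

namespace IsOrbit

variable {F : ℝ → ℝ} {p : ℤ} {q : ℕ} {x : ℤ → ℝ} {L : ℝ} {c : ℕ → ℝ} {M : ℝ}

/-- A degree one map constant off a neighbourhood of the longest gap. -/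
theorem exists_stair (L : ℝ) (n : ℕ) : ∃ C : ℝ, 1 ≤ C ∧
    ∀ {F : ℝ → ℝ} {p : ℤ} {q : ℕ} {x : ℤ → ℝ}, IsOrbit F p q x → (∀ x, |nonlin F x| ≤ L) → 4 ≤ q →
      (∀ k, gap x k ≤ gap x 0) → gap x 0 ≤ 1 / 4 → ∃ B : ℝ → ℝ, ContDiff ℝ ∞ B ∧
      (∀ y, B (y + 1) = B y + 1) ∧ (∀ y ∈ Set.Icc (x 2) (x (q - 1)), B y = B (x 2)) ∧
      (∀ y, 0 ≤ deriv B y) ∧ (∀ y ∈ Set.Icc (x 0) (x 1), 1 / (3 * gap x 0) ≤ deriv B y) ∧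
      ∀ y, WtAt n (deriv B) y (C * (1 / gap x 0) ^ (2 * n + 1)) 1 := by
  obtain ⟨θ, hθ, hθ1, hθ'⟩ := exists_neighbour_gap L 1
  obtain ⟨C, hC, hbump⟩ := exists_bump (κ := θ / 2) (by positivity) (by linarith) n
  refine ⟨C, hC, fun {F p q x} h hL hq hM hM4 => ?_⟩
  set M := gap x 0 with hMd
  have hM0 : 0 < M := h.gap_pos 0
  obtain ⟨β, hβ, hper, hβ0, hβ1, hone, hzero, hW⟩ := hbump ((x 0 + x 1) / 2) M hM0 hM4
  have hx01 : x 1 - x 0 = M := by simp [hMd, gap]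
  have hg1 : θ * M ≤ x 2 - x 1 := by
    have h1 : θ * M ≤ gap x 1 := hθ' h hL (by omega) hM 1 (by simp)
    have h2 : gap x 1 = x 2 - x 1 := by norm_num [gap]
    linarith
  have hgm1 : θ * M ≤ x 0 - x (-1) := by
    have h1 : θ * M ≤ gap x (-1) := hθ' h hL (by omega) hM (-1) (by simp)
    have h2 : gap x (-1) = x 0 - x (-1) := by norm_num [gap]
    linarith
  have hxq : x (q - 1) = x (-1) + 1 := by
    rw [← h.add_q, sub_eq_neg_add]
  have hx2q : x 2 ≤ x (q - 1) := h.strictMono.monotone (by omega)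
  have hx12 : x 1 ≤ x 2 := h.strictMono.monotone (by omega)
  have hxm : x (-1) ≤ x 0 := h.strictMono.monotone (by omega)
  have hθM : 0 < θ * M := by positivity
  have hβone : ∀ y ∈ Set.Icc (x 0) (x 1), β y = 1 := fun y hy => hone y (by
    rw [abs_le]; constructor <;> linarith [hy.1, hy.2])
  have hβzero : ∀ y ∈ Set.Icc (x 2) (x (q - 1)), β y = 0 := by
    intro y hy
    rw [hxq] at hy
    rcases le_total (y - (x 0 + x 1) / 2) (1 / 2) with h1 | h1
    · have h2 : 0 ≤ y - (x 0 + x 1) / 2 := by linarith [hy.1]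
      refine hzero y ?_ ?_ <;> rw [abs_of_nonneg h2]
      · linarith [hy.1]
      · exact h1
    · have h3 := hper (y - 1)
      rw [sub_add_cancel] at h3
      rw [h3]
      have h2 : y - 1 - (x 0 + x 1) / 2 ≤ 0 := by linarith [hy.2]
      refine hzero (y - 1) ?_ ?_ <;> rw [abs_of_nonpos h2]
      · linarith [hy.2]
      · linarith
  have hβc := hβ.continuous
  have hβint : ∀ s t, IntervalIntegrable β MeasureTheory.volume s t :=
    fun s t => hβc.intervalIntegrable s t
  have hperiod : Function.Periodic β 1 := hper
  set Z := ∫ t in x 0..x 0 + 1, β t with hZ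
  have hZper : ∀ y, ∫ t in y..y + 1, β t = Z := fun y => hperiod.intervalIntegral_add_eq y (x 0)
  have hvan : ∀ y ∈ Set.Icc (x 2) (x (q - 1)), ∫ t in x 2..y, β t = 0 := fun y hy => by
    rw [intervalIntegral.integral_congr (g := fun _ => (0 : ℝ)), intervalIntegral.integral_zero]
    intro t ht
    rw [Set.uIcc_of_le hy.1] at ht
    exact hβzero t ⟨ht.1, ht.2.trans hy.2⟩
  have hZM : M ≤ Z := by
    have h1 : ∫ t in x 0..x 1, β t = M := by
      rw [intervalIntegral.integral_congr (g := fun _ => (1 : ℝ))]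
      · simp [hx01]
      · intro t ht
        rw [Set.uIcc_of_le (by linarith)] at ht
        exact hβone t ht
    rw [← h1, hZ]
    exact intervalIntegral.integral_mono_interval le_rfl (by linarith) (by linarith)
      (Eventually.of_forall hβ0) (hβint _ _)
  have hZ3 : Z ≤ 3 * M := by
    rw [← hZper (x (-1)), ← hxq, ← intervalIntegral.integral_add_adjacent_intervals
      (hβint (x (-1)) (x 2)) (hβint (x 2) _), hvan _ ⟨hx2q, le_rfl⟩, add_zero]
    have h1 : ∫ t in x (-1)..x 2, β t ≤ ∫ _t in x (-1)..x 2, (1 : ℝ) :=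
      intervalIntegral.integral_mono_on (by linarith) (hβint _ _) (by simp) fun t _ => hβ1 t
    rw [intervalIntegral.integral_const, smul_eq_mul, mul_one] at h1
    have h2 := sub_le_mul hM (-1) 3
    norm_num at h2
    linarith
  have hZ0 : 0 < Z := by linarith
  have hB : ∀ y, HasDerivAt (fun y => Z⁻¹ * ∫ t in x 2..y, β t) (Z⁻¹ * β y) y := fun y =>
    (intervalIntegral.integral_hasDerivAt_right (hβint _ _)
      (hβc.stronglyMeasurableAtFilter _ _) hβc.continuousAt).const_mul _
  have hBd : deriv (fun y => Z⁻¹ * ∫ t in x 2..y, β t) = fun y => Z⁻¹ * β y :=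
    funext fun y => (hB y).deriv
  refine ⟨fun y => Z⁻¹ * ∫ t in x 2..y, β t, ?_, fun y => ?_, fun y hy => ?_, fun y => ?_,
    fun y hy => ?_, fun y => ?_⟩
  · rw [contDiff_infty_iff_deriv, hBd]
    exact ⟨fun y => (hB y).differentiableAt, contDiff_const.mul hβ⟩
  · beta_reduce
    rw [← intervalIntegral.integral_add_adjacent_intervals (hβint (x 2) y) (hβint y _), hZper, mul_add,
      inv_mul_cancel₀ hZ0.ne']
  · simp only [hvan y hy, intervalIntegral.integral_same]
  · rw [hBd]
    exact mul_nonneg (inv_nonneg.2 hZ0.le) (hβ0 y)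
  · simp only [hBd, hβone y hy, mul_one]
    rw [one_div]
    gcongr
  · rw [hBd]
    refine ((hW y).const_mul Z⁻¹).mono ?_ zero_le_one
    rw [abs_of_pos (inv_pos.2 hZ0), pow_succ]
    calc Z⁻¹ * (C * (1 / M) ^ (2 * n)) ≤ M⁻¹ * (C * (1 / M) ^ (2 * n)) := by gcongr
      _ = _ := by rw [one_div]; ring

theorem exists_conjugacy (L : ℝ) (c : ℕ → ℝ) (n : ℕ) : ∃ κ > (0 : ℝ), ∃ C : ℝ, 1 ≤ C ∧ ∃ A : ℕ,
    ∀ {F : ℝ → ℝ} {p : ℤ} {q : ℕ} {x : ℤ → ℝ}, IsOrbit F p q x → Ctrl F L c → 4 ≤ q →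
      (∀ k, gap x k ≤ gap x 0) → gap x 0 ≤ 1 / 4 → ∃ B : ℝ → ℝ, ContDiff ℝ ∞ B ∧
      (∀ y, B (y + 1) = B y + 1) ∧ (∀ y ∈ Set.Icc (x 2) (x (q - 1)), B y = B (x 2)) ∧
      (∀ y, WtAt n (deriv B) y (C * (1 / gap x 0) ^ A) 1) ∧
      (∀ z, κ ≤ deriv (orbitSum F B q) z) ∧
      ∀ k, ∀ z ∈ Set.Icc (x k) (x (k + 1)),
        WtAt n (deriv (orbitSum F B q)) z (C * (1 / gap x k) ^ A) 1 := by
  obtain ⟨Cβ, hCβ, hstair⟩ := exists_stair L n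
  obtain ⟨E, hE1, hEL, hE⟩ := exists_wtAt_deriv_iterate L c
  obtain ⟨C₁, hC₁, h₁⟩ := hE n
  have hexp := Real.exp_pos L
  have hn1 : (1 : ℝ) ≤ n ! := by exact_mod_cast Nat.one_le_iff_ne_zero.2 (Nat.factorial_ne_zero n)
  have hfac : 1 ≤ 2 ^ n * (n ! : ℝ) * C₁ ^ (n + 1) * E ^ (n + 1) :=
    one_le_mul_of_one_le_of_one_le (one_le_mul_of_one_le_of_one_le
      (one_le_mul_of_one_le_of_one_le (one_le_pow₀ one_le_two) hn1) (one_le_pow₀ hC₁))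
      (one_le_pow₀ hE1)
  refine ⟨1 / (3 * Real.exp L), by positivity, 2 ^ n * n ! * C₁ ^ (n + 1) * E ^ (n + 1) * Cβ,
    one_le_mul_of_one_le_of_one_le hfac hCβ, 2 * n + 1 + 1 + n,
    fun {F p q x} h hF hq hM hM4 => ?_⟩
  obtain ⟨B, hB, hB1, hBc, hB0, hBlow, hBW⟩ := hstair h hF.nonlin_le hq hM hM4
  set M := gap x 0 with hMd
  have hM0 : 0 < M := h.gap_pos 0
  have hM1 : M ≤ 1 := h.gap_le_one 0
  have hMinv : 1 ≤ 1 / M := by rw [le_div_iff₀ hM0]; linarith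
  have hB' : ContDiff ℝ ∞ (deriv B) := (contDiff_infty_iff_deriv.1 hB).2
  refine ⟨B, hB, hB1, hBc, fun y => (hBW y).mono ?_ zero_le_one, fun z => ?_, fun k z hz => ?_⟩
  · exact mul_le_mul (le_mul_of_one_le_left (by linarith) hfac)
      (pow_le_pow_right₀ hMinv (by omega)) (by positivity) (by positivity)
  · rw [deriv_orbitSum h.lift hB]
    obtain ⟨k, hk1, hk2⟩ := h.exists_mem_gap z
    have hk : z ∈ Set.Icc (x k) (x (k + 1)) := ⟨hk1, hk2.le⟩
    obtain ⟨i, hi, him⟩ := h.exists_index (k + p) 0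
    obtain ⟨m, hm⟩ := him.symm.dvd
    have hkm : k + (i + 1 : ℕ) * p = 0 + m * q := by push_cast; linarith
    have hD := h.le_deriv_iterate hF hk (i := i + 1) hi
    rw [hkm, h.gap_add_mul_q] at hD
    have hmono := (h.lift.iterate (i + 1)).strictMono.monotone
    have hy1 := hmono hk.1
    have hy2 := hmono hk.2
    rw [h.iterate, hkm, h.add_mul_q] at hy1
    rw [h.iterate, show k + 1 + (i + 1 : ℕ) * p = 1 + m * q by linarith, h.add_mul_q] at hy2
    have hBper : deriv B (F^[i + 1] z) = deriv B (F^[i + 1] z - m) := by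
      have h5 : B = fun y => B (y - m) + m := funext fun y => by
        rw [← map_add_int_of_map_add_one hB1, sub_add_cancel]
      conv_lhs => rw [h5]
      rw [deriv_add_const, deriv_comp_sub_const]
    have hlow := hBlow (F^[i + 1] z - m) ⟨by linarith, by linarith⟩
    rw [← hBper] at hlow
    have hgk := h.gap_pos k
    have hgk1 := h.gap_le_one k
    have hterm : 1 / (3 * Real.exp L) ≤ deriv B (F^[i + 1] z) * deriv (F^[i + 1]) z := by
      calc 1 / (3 * Real.exp L) = 1 / (3 * M) * (M / (Real.exp L * 1)) := by field_simp
        _ ≤ 1 / (3 * M) * (M / (Real.exp L * gap x k)) := by gcongr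
        _ ≤ _ := by gcongr; exact hB0 _
    refine hterm.trans (Finset.single_le_sum
      (f := fun i => deriv B (F^[i + 1] z) * deriv (F^[i + 1]) z) (fun j _ => ?_)
      (Finset.mem_range.2 hi))
    exact mul_nonneg (hB0 _) ((h.lift.iterate (j + 1)).deriv_pos z).le
  · rw [deriv_orbitSum h.lift hB]
    have hgk := h.gap_pos k
    have hgk1 := h.gap_le_one k
    have hgM := hM k
    have hs0 : 0 < √M := Real.sqrt_pos.2 hM0
    have hs1 : √M ≤ 1 := Real.sqrt_le_one.2 hM1
    have hsM : M ≤ √M := by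
      calc M = √M * √M := (Real.mul_self_sqrt hM0.le).symm
        _ ≤ √M := mul_le_of_le_one_right hs0.le hs1
    set Λ := E * √M / gap x k with hΛd
    have hΛ : 0 ≤ Λ := by positivity
    set K := Cβ * (1 / M) ^ (2 * n + 1) with hK
    have hterm : ∀ i ∈ Finset.range q, WtAt n (fun z => deriv B (F^[i + 1] z) *
        deriv (F^[i + 1]) z) z (2 ^ n * (n ! * K * C₁ ^ n) * (C₁ * deriv (F^[i + 1]) z)) Λ := by
      intro i hi
      have hi' : i + 1 ≤ q := Finset.mem_range.1 hi
      have hG := h.lift.iterate (i + 1)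
      have hDW := h₁ h hF hM hz hi'
      have hDpos := hG.deriv_pos z
      have hDΛ : deriv (F^[i + 1]) z ≤ Λ := by
        refine (h.deriv_iterate_le hF hz hi').trans ?_
        have := (hM (k + (i + 1 : ℕ) * p)).trans hsM
        rw [hΛd]
        have h9 := h.gap_pos (k + (i + 1 : ℕ) * p)
        gcongr
      refine WtAt.mul (hB'.comp hG.contDiff) hG.contDiff_deriv (by positivity) (by positivity) hΛ
        (WtAt.comp hB' hG.contDiff hC₁ hΛ (fun j hj => ?_) fun j hj1 hj => ?_) hDW
      · simpa using hBW (F^[i + 1] z) j hj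
      · obtain ⟨j, rfl⟩ : ∃ j', j = j' + 1 := ⟨j - 1, by omega⟩
        rw [iteratedDeriv_succ']
        refine (hDW j (by omega)).trans ?_
        rw [pow_succ', ← mul_assoc]
        gcongr
    have hsum : WtAt n (fun z => ∑ i ∈ Finset.range q, deriv B (F^[i + 1] z) *
        deriv (F^[i + 1]) z) z (∑ i ∈ Finset.range q,
          2 ^ n * (n ! * K * C₁ ^ n) * (C₁ * deriv (F^[i + 1]) z)) Λ := WtAt.sum (Finset.range q) (fun i _ => (hB'.comp
      (h.lift.iterate (i + 1)).contDiff).mul (h.lift.iterate (i + 1)).contDiff_deriv) hterm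
    have hDsum : ∑ i ∈ Finset.range q, deriv (F^[i + 1]) z ≤ E / gap x k := by
      calc _ ≤ ∑ i ∈ Finset.range q, E / gap x k * gap x (k + p + i * p) := by
            refine Finset.sum_le_sum fun i hi => ?_
            refine (h.deriv_iterate_le hF hz (Finset.mem_range.1 hi)).trans ?_
            rw [show k + (i + 1 : ℕ) * p = k + p + i * p by push_cast; ring]
            have := h.gap_pos (k + p + i * p)
            rw [div_mul_eq_mul_div]
            gcongr
        _ ≤ _ := by
            rw [← Finset.mul_sum]
            exact mul_le_of_le_one_right (by positivity) (h.sum_gap_orbit_le_one (k + p))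
    have hS : ∑ i ∈ Finset.range q, 2 ^ n * (n ! * K * C₁ ^ n) * (C₁ * deriv (F^[i + 1]) z) ≤
        2 ^ n * (n ! * K * C₁ ^ n) * (C₁ * (E / gap x k)) := by
      rw [← Finset.mul_sum, ← Finset.mul_sum]
      gcongr
    have hΛ' : ∀ i ≤ n, Λ ^ i ≤ (E / gap x k) ^ n := fun i hi => by
      have h1 : 1 ≤ E / gap x k := by rw [le_div_iff₀ hgk]; linarith
      have h2 : Λ ≤ E / gap x k := by
        rw [hΛd]
        gcongr
        exact mul_le_of_le_one_right (by linarith) hs1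
      exact (pow_le_pow_left₀ hΛ h2 i).trans (pow_le_pow_right₀ h1 hi)
    intro i hi
    refine (hsum i hi).trans ?_
    have hKle : K ≤ Cβ * (1 / gap x k) ^ (2 * n + 1) := by rw [hK]; gcongr
    have hC₁0 : 0 < C₁ := by linarith
    have hE0 : 0 < E := by linarith
    calc _ ≤ 2 ^ n * (n ! * K * C₁ ^ n) * (C₁ * (E / gap x k)) * (E / gap x k) ^ n := by
          gcongr
          exact hΛ' i hi
      _ ≤ 2 ^ n * (n ! * (Cβ * (1 / gap x k) ^ (2 * n + 1)) * C₁ ^ n) * (C₁ * (E / gap x k)) *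
          (E / gap x k) ^ n := by gcongr
      _ = _ := by
          rw [one_pow, mul_one]
          simp only [div_eq_mul_inv, one_mul, mul_pow, pow_add, pow_one]
          ring

end IsOrbit

theorem IsSmoothLift.exists_inverse {H : ℝ → ℝ} (hH : IsSmoothLift H) :
    ∃ G, IsSmoothLift G ∧ (∀ x, G (H x) = x) ∧ ∀ x, H (G x) = x := by
  have hsurj : Function.Surjective H := fun y => by
    refine mem_range_of_exists_le_of_exists_ge hH.continuous ⟨(⌊y - H 0⌋ : ℤ), ?_⟩
      ⟨(⌈y - H 0⌉ : ℤ), ?_⟩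
    · have := hH.map_add_int 0 ⌊y - H 0⌋
      rw [zero_add] at this
      linarith [Int.floor_le (y - H 0)]
    · have := hH.map_add_int 0 ⌈y - H 0⌉
      rw [zero_add] at this
      linarith [Int.le_ceil (y - H 0)]
  let e : ℝ ≃ₜ ℝ := (StrictMono.orderIsoOfSurjective H hH.strictMono hsurj).toHomeomorph
  have he1 : ∀ x, e.symm (H x) = x := fun x => e.symm_apply_apply x
  have he2 : ∀ x, H (e.symm x) = x := fun x => e.apply_symm_apply x
  have hG : ContDiff ℝ ∞ e.symm :=
    e.contDiff_symm_deriv (fun x => (hH.deriv_pos x).ne') hH.hasDerivAt hH.contDiff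
  refine ⟨e.symm, ⟨hG, fun y => ?_, fun y => ?_⟩, he1, he2⟩
  · have h1 : HasDerivAt (fun y => H (e.symm y)) (deriv H (e.symm y) * deriv e.symm y) y :=
      (hH.hasDerivAt (e.symm y)).comp y (hG.differentiable (by simp) y).hasDerivAt
    have h2 : HasDerivAt (fun y => H (e.symm y)) 1 y := by
      simp only [he2]
      exact hasDerivAt_id' y
    have h3 := h1.unique h2
    exact pos_of_mul_pos_right (h3 ▸ one_pos) (hH.deriv_pos _).le
  · apply hH.strictMono.injective
    rw [he2, hH.map_add_one, he2]

theorem isRotNumber_of_conj {H g : ℝ → ℝ} {α : ℝ} (hH : Continuous H)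
    (hH1 : ∀ x, H (x + 1) = H x + 1) (hg : ∀ x, H (g x) = H x + α) : IsRotNumber g α := by
  intro x
  obtain ⟨C, hC0, hC⟩ := exists_bound_of_periodic (u := fun x => H x - x) (hH.sub continuous_id)
    fun x => by simp only [hH1]; ring
  have hiter : ∀ n : ℕ, H (g^[n] x) = H x + n * α := by
    intro n
    induction n with
    | zero => simp
    | succ n ih => rw [Function.iterate_succ_apply', hg, ih]; push_cast; ring
  rw [tendsto_iff_dist_tendsto_zero]
  refine squeeze_zero' (g := fun n : ℕ => 2 * C / n) (Eventually.of_forall fun n => dist_nonneg)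
    ?_ (tendsto_const_div_atTop_nhds_zero_nat _)
  filter_upwards [eventually_gt_atTop 0] with n hn
  have hn' : (0 : ℝ) < n := by exact_mod_cast hn
  rw [Real.dist_eq, div_sub' hn'.ne', abs_div, abs_of_pos hn']
  gcongr
  have h1 := abs_le.1 (hC x)
  have h2 := abs_le.1 (hC (g^[n] x))
  rw [hiter] at h2
  rw [abs_le]
  constructor <;> linarith [h1.1, h1.2, h2.1, h2.2]

theorem exists_displacement {F B : ℝ → ℝ} (hF : IsSmoothLift F) (hB : ContDiff ℝ ∞ B)
    (hB1 : ∀ y, B (y + 1) = B y + 1) {q : ℕ} (hq : 0 < q)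
    (hpos : ∀ z, 0 < deriv (orbitSum F B q) z) (p : ℤ) (α : ℝ) :
    ∃ ξ : ℝ → ℝ, ContDiff ℝ ∞ ξ ∧ Function.Periodic ξ 1 ∧
      IsSmoothLift (fun z => F z + ξ (F z)) ∧ IsRotNumber (fun z => F z + ξ (F z)) α ∧
      SmoothlyLinearizable (fun z => F z + ξ (F z)) α ∧
      ∀ w, orbitSum F B q (w + ξ w) - orbitSum F B q w =
        q * α - p - (B (F^[q] w - p) - B w) := by
  have hq' : (0 : ℝ) < q := by exact_mod_cast hq
  have hS := contDiff_orbitSum hF hB q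
  set h := orbitSum F B q with hh
  set E : ℝ → ℝ := fun w => B (F^[q] w - p) - B w with hE
  have hEs : ContDiff ℝ ∞ E :=
    (hB.comp ((hF.iterate q).contDiff.sub contDiff_const)).sub hB
  have hE1 : ∀ w, E (w + 1) = E w := fun w => by
    simp only [hE, (hF.iterate q).map_add_one, hB1]
    rw [show F^[q] w + 1 - p = F^[q] w - p + 1 by ring, hB1]
    ring
  set H : ℝ → ℝ := fun z => h z / q with hHd
  have hH : IsSmoothLift H := ⟨hS.div_const _, fun x => by
      rw [hHd, deriv_div_const]
      exact div_pos (hpos x) hq', fun x => by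
      simp only [hHd, hh, orbitSum_add_one hF hB1]
      field_simp⟩
  obtain ⟨G, hG, hGH, hHG⟩ := hH.exists_inverse
  set ξ : ℝ → ℝ := fun w => G (H w + (q * α - p - E w) / q) - w with hξ
  have hgeq : (fun z => F z + ξ (F z)) = G ∘ fun z => H z + α := by
    ext z
    have h1 := orbitSum_map (F := F) hB1 q p z
    simp only [hξ, Function.comp, hHd, add_sub_cancel]
    congr 1
    rw [hh, h1, hE]
    field_simp
    ring
  have hconj : ∀ z, H (F z + ξ (F z)) = H z + α := fun z => by
    have := congrFun hgeq z
    simp only [Function.comp] at this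
    rw [this, hHG]
  refine ⟨ξ, ?_, fun w => ?_, hgeq ▸ hG.comp (hH.add_const α),
    isRotNumber_of_conj hH.continuous hH.map_add_one hconj,
    ⟨H, hH.contDiff, hH.deriv_pos, hH.map_add_one, hconj⟩, fun w => ?_⟩
  · exact (hG.contDiff.comp (hH.contDiff.add
      ((contDiff_const.sub hEs).div_const _))).sub contDiff_id
  · simp only [hξ, hE1, hH.map_add_one]
    rw [add_right_comm, hG.map_add_one]
    ring
  · have h1 := hHG (H w + (q * α - p - E w) / q)
    simp only [hξ, add_sub_cancel]
    change h (G (H w + (q * α - p - E w) / q)) - h w = q * α - p - E w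
    set s := G (H w + (q * α - p - E w) / q)
    simp only [hHd] at h1
    field_simp at h1
    linarith

theorem mul_abs_le_abs_sub {h : ℝ → ℝ} {κ : ℝ} (hd : Differentiable ℝ h)
    (hκ : ∀ y, κ ≤ deriv h y) (z s : ℝ) : κ * |s| ≤ |h (z + s) - h z| := by
  rcases le_total 0 s with h0 | h0
  · rw [abs_of_nonneg h0]
    refine le_trans ?_ (le_abs_self _)
    simpa using mul_sub_le_image_sub_of_le_deriv hd hκ (x := z) (y := z + s) (by linarith)
  · rw [abs_of_nonpos h0, abs_sub_comm]
    refine le_trans ?_ (le_abs_self _)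
    simpa using mul_sub_le_image_sub_of_le_deriv hd hκ (x := z + s) (y := z) (by linarith)

theorem wtAt_const (n : ℕ) (τ x : ℝ) : WtAt n (fun _ => τ) x |τ| 1 := by
  intro i _
  rw [iteratedDeriv_const, one_pow, mul_one]
  split_ifs
  · exact le_rfl
  · simp

namespace IsOrbit

theorem exists_wtAt_near (L : ℝ) (c : ℕ → ℝ) (r A : ℕ) {κ C : ℝ} (hκ : 0 < κ) (hC : 1 ≤ C) :
    ∃ K > (0 : ℝ), ∃ M₀ > (0 : ℝ), ∃ N : ℕ, ∀ {F : ℝ → ℝ} {p : ℤ} {q : ℕ} {x : ℤ → ℝ}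
      {B ξ : ℝ → ℝ} {τ : ℝ}, IsOrbit F p q x → Ctrl F L c → 2 ≤ q →
      (∀ k, gap x k ≤ gap x 0) → gap x 0 ≤ M₀ → ContDiff ℝ ∞ B →
      (∀ y, WtAt r (deriv B) y (C * (1 / gap x 0) ^ A) 1) →
      (∀ z, κ ≤ deriv (orbitSum F B q) z) →
      (∀ k, ∀ z ∈ Set.Icc (x k) (x (k + 1)),
        WtAt r (deriv (orbitSum F B q)) z (C * (1 / gap x k) ^ A) 1) →
      ContDiff ℝ ∞ ξ →
      (∀ w, orbitSum F B q (w + ξ w) - orbitSum F B q w = τ - (B (F^[q] w - p) - B w)) →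
      |τ| ≤ gap x 0 ^ N → ∀ z ∈ Set.Icc (x (-1)) (x 2), WtAt r ξ z (K * gap x 0) 1 := by
  obtain ⟨θ, hθ, hθ1, hθ'⟩ := exists_neighbour_gap L 2
  obtain ⟨CD, hCD, HD⟩ := exists_wtAt_comp_sub r
  obtain ⟨CI, hCI, HI⟩ := exists_wtAt_displacement hκ r
  set J := A * (r + 1) + 2 with hJ
  obtain ⟨CF, hCF, HF⟩ := exists_iterate_sub_le L c r (A + J)
  set K₁ := 1 + CD * C * CF with hK₁
  set K₂ := (CI * (C * (1 / θ) ^ A)) ^ (r + 1) * K₁ with hK₂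
  have hK₁0 : 0 < K₁ := by positivity
  have hK₂0 : 0 < K₂ := by positivity
  refine ⟨K₂, hK₂0, min (1 / K₂) (min (1 / CF) (κ * θ / K₁)), by positivity, J,
    fun {F p q x B ξ τ} h hF hq hM hM0 hB hBW hκB hSW hξ heq hτ z hz => ?_⟩
  set M := gap x 0 with hMd
  have hMpos : 0 < M := h.gap_pos 0
  have hM1 : M ≤ 1 := h.gap_le_one 0
  have hMK₂ : K₂ * M ≤ 1 := by
    have := hM0.trans (min_le_left _ _)
    rwa [le_div_iff₀ hK₂0, mul_comm] at this
  have hMCF : CF * M ≤ 1 := by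
    have := hM0.trans ((min_le_right _ _).trans (min_le_left _ _))
    rwa [le_div_iff₀ (by positivity), mul_comm] at this
  have hMθ : K₁ * M ≤ κ * θ := by
    have := hM0.trans ((min_le_right _ _).trans (min_le_right _ _))
    rwa [le_div_iff₀ hK₁0, mul_comm] at this
  have hmono := h.strictMono.monotone
  have hFq := (h.lift.iterate q).contDiff
  have hDs : ContDiff ℝ ∞ (fun z => F^[q] z - z - p) :=
    (hFq.sub contDiff_id).sub contDiff_const
  have hDW := HF h hF hq hM z ⟨(hmono (by norm_num)).trans hz.1, hz.2.trans (hmono (by norm_num))⟩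
  have hη1 : CF * M ^ (A + J) ≤ 1 := by
    refine le_trans ?_ hMCF
    gcongr
    exact pow_le_of_le_one hMpos.le hM1 (by omega)
  have hEW := HD hB hDs hη1 hDW fun y _ => hBW y
  have hEeq : (fun y => B (y + (F^[q] y - y - p)) - B y) = fun y => B (F^[q] y - p) - B y := by
    ext y
    congr 2
    ring
  rw [hEeq] at hEW
  have hEs : ContDiff ℝ ∞ (fun y => B (F^[q] y - p) - B y) :=
    (hB.comp (hFq.sub contDiff_const)).sub hB
  have heW : WtAt r (fun w => τ - (B (F^[q] w - p) - B w)) z (K₁ * M ^ J) 1 := by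
    have h1 := (wtAt_const r τ z).add contDiff_const (contDiff_const.mul hEs) (hEW.const_mul (-1))
    have h2 : (fun y => τ + -1 * (B (F^[q] y - p) - B y)) =
        fun w => τ - (B (F^[q] w - p) - B w) := by
      ext y
      ring
    rw [h2] at h1
    refine h1.mono ?_ zero_le_one
    rw [abs_neg, abs_one, one_mul, hK₁, add_mul, one_mul]
    refine add_le_add hτ (le_of_eq ?_)
    rw [pow_add, one_div, inv_pow]
    field_simp
  have hes : ContDiff ℝ ∞ (fun w => τ - (B (F^[q] w - p) - B w)) := contDiff_const.sub hEs
  have hS := contDiff_orbitSum h.lift hB q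
  have hξθ : |ξ z| ≤ θ * M := by
    have h1 := mul_abs_le_abs_sub (hS.differentiable (by simp)) hκB z (ξ z)
    rw [heq] at h1
    have h2 : |τ - (B (F^[q] z - p) - B z)| ≤ K₁ * M ^ J := by simpa using heW 0 (Nat.zero_le _)
    have h3 : K₁ * M ^ J ≤ κ * (θ * M) := by
      calc K₁ * M ^ J ≤ K₁ * M ^ 2 :=
            mul_le_mul_of_nonneg_left (pow_le_pow_of_le_one hMpos.le hM1 (by omega)) hK₁0.le
        _ = K₁ * M * M := by ring
        _ ≤ κ * θ * M := by gcongr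
        _ = _ := by ring
    exact le_of_mul_le_mul_left ((h1.trans h2).trans h3) hκ
  have hgl : θ * M ≤ x (-1) - x (-2) := by
    have h1 : θ * M ≤ gap x (-2) := hθ' h hF.nonlin_le hq hM (-2) (by simp)
    have h2 : gap x (-2) = x (-1) - x (-2) := by norm_num [gap]
    linarith
  have hgr : θ * M ≤ x 3 - x 2 := by
    have h1 : θ * M ≤ gap x 2 := hθ' h hF.nonlin_le hq hM 2 (by simp)
    have h2 : gap x 2 = x 3 - x 2 := by norm_num [gap]
    linarith
  have hseg : ∀ y ∈ Set.uIcc z (z + ξ z), WtAt r (deriv (orbitSum F B q)) y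
      (C * (1 / θ) ^ A * (1 / M) ^ A) 1 := by
    intro y hy
    have hξ' := abs_le.1 hξθ
    have hsub : Set.uIcc z (z + ξ z) ⊆ Set.Icc (x (-2)) (x 3) := by
      apply Set.uIcc_subset_Icc <;> constructor <;> linarith [hz.1, hz.2, hξ'.1, hξ'.2,
        mul_pos hθ hMpos]
    obtain ⟨k, hk1, hk2, hk⟩ := h.exists_mem_Icc_gap (hsub hy) (by norm_num)
    refine (hSW k y hk).mono ?_ zero_le_one
    have hgk := hθ' h hF.nonlin_le hq hM k (by rw [abs_le]; constructor <;> push_cast <;> omega)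
    have hgk0 := h.gap_pos k
    rw [mul_assoc, ← mul_pow, one_div_mul_one_div]
    gcongr
  have hθinv : 1 ≤ 1 / θ := by rw [le_div_iff₀ hθ]; linarith
  have hMinv : 1 ≤ 1 / M := by rw [le_div_iff₀ hMpos]; linarith
  have hP1 : 1 ≤ C * (1 / θ) ^ A * (1 / M) ^ A :=
    one_le_mul_of_one_le_of_one_le (one_le_mul_of_one_le_of_one_le hC (one_le_pow₀ hθinv))
      (one_le_pow₀ hMinv)
  have hval : (CI * (C * (1 / θ) ^ A * (1 / M) ^ A)) ^ (r + 1) * (K₁ * M ^ J) = K₂ * M ^ 2 := by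
    have h1 : ((1 / M) ^ A) ^ (r + 1) * M ^ (A * (r + 1)) = 1 := by
      rw [← pow_mul, ← mul_pow, one_div_mul_cancel hMpos.ne', one_pow]
    rw [hK₂, hJ, pow_add, ← mul_assoc CI, mul_pow _ ((1 / M) ^ A)]
    calc _ = (CI * (C * (1 / θ) ^ A)) ^ (r + 1) * K₁ * M ^ 2 *
          (((1 / M) ^ A) ^ (r + 1) * M ^ (A * (r + 1))) := by ring
      _ = _ := by rw [h1, mul_one]
  have hK₂M : K₂ * M ^ 2 ≤ K₂ * M := by
    gcongr
    exact pow_le_of_le_one hMpos.le hM1 two_ne_zero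
  have hres := HI hS hes hξ hκB heq hP1 hseg heW (by rw [hval]; exact hK₂M.trans hMK₂)
  rw [hval] at hres
  exact hres.mono hK₂M zero_le_one

theorem exists_wtAt_far {L : ℝ} (hL0 : 0 < L) (c : ℕ → ℝ) (r A : ℕ) {κ C : ℝ} (hκ : 0 < κ)
    (hC : 1 ≤ C) : ∃ K > (0 : ℝ), ∃ N : ℕ, ∀ {F : ℝ → ℝ} {p : ℤ} {q : ℕ} {x : ℤ → ℝ}
      {B ξ : ℝ → ℝ} {τ : ℝ}, IsOrbit F p q x → Ctrl F L c → K ≤ q → ContDiff ℝ ∞ B →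
      (∀ y ∈ Set.Icc (x 2) (x (q - 1)), B y = B (x 2)) →
      (∀ z, κ ≤ deriv (orbitSum F B q) z) →
      (∀ k, ∀ z ∈ Set.Icc (x k) (x (k + 1)),
        WtAt r (deriv (orbitSum F B q)) z (C * (1 / gap x k) ^ A) 1) →
      ContDiff ℝ ∞ ξ →
      (∀ w, orbitSum F B q (w + ξ w) - orbitSum F B q w = τ - (B (F^[q] w - p) - B w)) →
      |τ| ≤ (1 / (q : ℝ)) ^ N → ∀ z ∈ Set.Ioo (x 2) (x (q - 1)), WtAt r ξ z (K / q) 1 := by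
  obtain ⟨c₀, hc₀⟩ := exists_gap_lower_bound hL0
  obtain ⟨CI, hCI, HI⟩ := exists_wtAt_displacement hκ r
  set J := c₀ * A * (r + 1) with hJ
  set K := (CI * C) ^ (r + 1) with hK
  refine ⟨K, by positivity, J + 1,
    fun {F p q x B ξ τ} h hF hqK hB hBc hκB hSW hξ heq hτ z hz => ?_⟩
  have hq0 : (0 : ℝ) < q := by exact_mod_cast h.pos
  have hq1 : (1 : ℝ) ≤ q := by exact_mod_cast h.pos
  have hFq := (h.lift.iterate q).contDiff
  have hmono := (h.lift.iterate q).strictMono.monotone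
  have hE : ∀ y ∈ Set.Icc (x 2) (x (q - 1)), B (F^[q] y - p) - B y = 0 := fun y hy => by
    have h1 := hmono hy.1
    have h2 := hmono hy.2
    rw [h.iterate_period] at h1 h2
    rw [hBc y hy, hBc _ ⟨by linarith, by linarith⟩, sub_self]
  have heW : WtAt r (fun w => τ - (B (F^[q] w - p) - B w)) z |τ| 1 := by
    have hev : (fun w => τ - (B (F^[q] w - p) - B w)) =ᶠ[𝓝 z] fun _ => τ := by
      filter_upwards [Ioo_mem_nhds hz.1 hz.2] with y hy
      rw [hE y ⟨hy.1.le, hy.2.le⟩, sub_zero]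
    intro i hi
    rw [hev.iteratedDeriv_eq]
    exact wtAt_const r τ z i hi
  have hes : ContDiff ℝ ∞ (fun w => τ - (B (F^[q] w - p) - B w)) :=
    contDiff_const.sub ((hB.comp (hFq.sub contDiff_const)).sub hB)
  have hS := contDiff_orbitSum h.lift hB q
  have hseg : ∀ y ∈ Set.uIcc z (z + ξ z), WtAt r (deriv (orbitSum F B q)) y
      (C * ((q : ℝ) ^ c₀) ^ A) 1 := by
    intro y _
    obtain ⟨k, hk1, hk2⟩ := h.exists_mem_gap y
    refine (hSW k y ⟨hk1, hk2.le⟩).mono ?_ zero_le_one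
    have hgk := h.gap_pos k
    have h1 := hc₀ h hF.nonlin_le k
    gcongr
    rwa [div_le_iff₀ hgk]
  have hP1 : 1 ≤ C * ((q : ℝ) ^ c₀) ^ A :=
    one_le_mul_of_one_le_of_one_le hC (one_le_pow₀ (one_le_pow₀ hq1))
  have hval : (CI * (C * ((q : ℝ) ^ c₀) ^ A)) ^ (r + 1) * |τ| ≤ K / q := by
    calc _ ≤ (CI * (C * ((q : ℝ) ^ c₀) ^ A)) ^ (r + 1) * (1 / (q : ℝ)) ^ (J + 1) := by gcongr
      _ = K * ((q : ℝ) ^ J * (1 / q) ^ J) * (1 / q) := by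
        rw [hK, hJ, pow_mul, pow_mul, ← mul_assoc CI, mul_pow _ (((q : ℝ) ^ c₀) ^ A), pow_succ,
          pow_mul (1 / (q : ℝ)), pow_mul (1 / (q : ℝ))]
        ring
      _ = K / q := by
        rw [← mul_pow, mul_one_div_cancel hq0.ne', one_pow, mul_one, mul_one_div]
  have hKq : K / q ≤ 1 := by rwa [div_le_one hq0]
  exact (HI hS hes hξ hκB heq hP1 hseg heW (hval.trans hKq)).mono hval zero_le_one

end IsOrbit

theorem IsOrbit.exists_small_displacement {L : ℝ} (hL0 : 0 < L) (c : ℕ → ℝ) (r : ℕ) {ε : ℝ}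
    (hε : 0 < ε) : ∃ M₀ > (0 : ℝ), ∃ N Q : ℕ, ∀ {F : ℝ → ℝ} {p : ℤ} {q : ℕ} {x : ℤ → ℝ} {α : ℝ},
      IsOrbit F p q x → Ctrl F L c → Q < q → (∀ k, gap x k ≤ gap x 0) → gap x 0 ≤ M₀ →
      |q * α - p| ≤ (1 / (q : ℝ)) ^ N → ∃ ξ : ℝ → ℝ, ContDiff ℝ ∞ ξ ∧
        IsSmoothLift (fun z => F z + ξ (F z)) ∧ IsRotNumber (fun z => F z + ξ (F z)) α ∧
        SmoothlyLinearizable (fun z => F z + ξ (F z)) α ∧ ∀ z, WtAt r ξ z ε 1 := by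
  obtain ⟨κ, hκ, C, hC, A, hconj⟩ := exists_conjugacy L c r
  obtain ⟨K₁, hK₁, M₁, hM₁, N₁, hnear⟩ := exists_wtAt_near L c r A hκ hC
  obtain ⟨K₂, hK₂, N₂, hfar⟩ := exists_wtAt_far hL0 c r A hκ hC
  obtain ⟨Q, hQ⟩ := exists_nat_gt (max 4 (max K₂ (K₂ / ε)))
  refine ⟨min (1 / 4) (min M₁ (ε / K₁)), by positivity, max N₁ N₂, Q,
    fun {F p q x α} h hF hq hM hM0 hα => ?_⟩
  have hqQ : max 4 (max K₂ (K₂ / ε)) < q := hQ.trans (by exact_mod_cast hq)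
  have hq4 : 4 ≤ q := by exact_mod_cast ((le_max_left _ _).trans_lt hqQ).le
  have hqK : K₂ ≤ q := (((le_max_left _ _).trans (le_max_right _ _)).trans_lt hqQ).le
  have hqε : K₂ / ε ≤ q := (((le_max_right _ _).trans (le_max_right _ _)).trans_lt hqQ).le
  have hq0 : (0 : ℝ) < q := by exact_mod_cast h.pos
  have hq1 : 1 / (q : ℝ) ≤ 1 := by
    rw [div_le_one hq0]
    exact_mod_cast h.pos
  have hM4 := hM0.trans (min_le_left _ _)
  have hMM₁ := hM0.trans ((min_le_right _ _).trans (min_le_left _ _))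
  have hMε := hM0.trans ((min_le_right _ _).trans (min_le_right _ _))
  obtain ⟨B, hB, hB1, hBc, hBW, hκB, hSW⟩ := hconj h hF hq4 hM hM4
  obtain ⟨ξ, hξ, hper, hlift, hrot, hlin, heq⟩ := exists_displacement h.lift hB hB1 h.pos
    (fun z => hκ.trans_le (hκB z)) p α
  refine ⟨ξ, hξ, hlift, hrot, hlin, ?_⟩
  have hqM : 1 / (q : ℝ) ≤ gap x 0 := by
    rw [div_le_iff₀ hq0, mul_comm]
    exact h.one_le_mul_gap hM
  have hτ₁ : |q * α - p| ≤ gap x 0 ^ N₁ :=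
    hα.trans ((pow_le_pow_of_le_one (by positivity) hq1 (le_max_left _ _)).trans
      (pow_le_pow_left₀ (by positivity) hqM _))
  have hτ₂ : |q * α - p| ≤ (1 / (q : ℝ)) ^ N₂ :=
    hα.trans (pow_le_pow_of_le_one (by positivity) hq1 (le_max_right _ _))
  have hdom : ∀ z ∈ Set.Ico (x (-1)) (x (-1) + 1), WtAt r ξ z ε 1 := by
    intro z hz
    have hxq : x (q - 1) = x (-1) + 1 := by rw [← h.add_q, sub_eq_neg_add]
    rcases le_or_gt z (x 2) with hz2 | hz2
    · refine (hnear h hF (by omega) hM hMM₁ hB hBW hκB hSW hξ heq hτ₁ z ⟨hz.1, hz2⟩).mono ?_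
        zero_le_one
      rwa [le_div_iff₀ hK₁, mul_comm] at hMε
    · refine (hfar h hF hqK hB hBc hκB hSW hξ heq hτ₂ z ⟨hz2, hxq ▸ hz.2⟩).mono ?_ zero_le_one
      rw [div_le_iff₀ hε] at hqε
      rw [div_le_iff₀ hq0]
      linarith
  intro z i hi
  obtain ⟨y, hy, hyz⟩ := (periodic_iteratedDeriv hper i).exists_mem_Ico one_pos z (x (-1))
  rw [hyz]
  exact hdom y hy i hi

theorem exists_linearizable_near {f : ℝ → ℝ} (hf : IsSmoothLift f) {α : ℝ} (hirr : Irrational α)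
    (hLiouville : ¬ IsDiophantine α) (hρ : IsRotNumber f α) (r : ℕ) {ε : ℝ} (hε : 0 < ε) :
    ∃ g, IsSmoothLift g ∧ IsRotNumber g α ∧ SmoothlyLinearizable g α ∧
      ∀ i ≤ r, ∀ x, |iteratedDeriv i g x - iteratedDeriv i f x| ≤ ε := by
  obtain ⟨L, c, hctrl⟩ := hf.exists_ctrl
  obtain ⟨D, hD1, hD⟩ : ∃ D : ℝ, 1 ≤ D ∧ ∀ i < r, ∀ x, |iteratedDeriv i (deriv f) x| ≤ D := by
    have h1 : ∀ i, ∃ C, 0 ≤ C ∧ ∀ x, |iteratedDeriv i (deriv f) x| ≤ C := fun i =>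
      exists_bound_of_periodic (hf.contDiff_deriv.continuous_iteratedDeriv i
        (by exact_mod_cast le_top)) (periodic_iteratedDeriv hf.periodic_deriv i)
    choose C hC0 hC using h1
    refine ⟨1 + ∑ i ∈ Finset.range r, C i, ?_, fun i hi x => (hC i x).trans ?_⟩
    · linarith [Finset.sum_nonneg fun i (_ : i ∈ Finset.range r) => hC0 i]
    · linarith [Finset.single_le_sum (fun j _ => hC0 j) (Finset.mem_range.2 hi)]
  have hfac : (0 : ℝ) < r ! * D ^ r := by positivity
  obtain ⟨M₀, hM₀, N, Q₁, hdisp⟩ := IsOrbit.exists_small_displacement (hctrl 0).pos c r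
    (ε := ε / 2 / (r ! * D ^ r)) (by positivity)
  obtain ⟨ε₁, hε₁, Q₂, hgap⟩ := IsOrbit.exists_gap_upper_bound hirr L hM₀
  obtain ⟨Q₃, hQ₃⟩ := exists_nat_gt (4 / ε)
  obtain ⟨p, q, hq, hpq, hαε, hαN⟩ :=
    exists_good_approx hirr hLiouville (N + 2) (max Q₁ (max Q₂ Q₃)) hε₁
  have hqpos : 0 < q := by omega
  have hq0 : (0 : ℝ) < q := by exact_mod_cast hqpos
  have hq1 : 1 / (q : ℝ) ≤ 1 := by
    rw [div_le_one hq0]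
    exact_mod_cast hqpos
  have hτ : |q * α - p| ≤ (1 / (q : ℝ)) ^ (N + 1) := by
    have h1 : q * α - p = q * (α - p / q) := by field_simp
    rw [h1, abs_mul, abs_of_pos hq0]
    calc _ ≤ (q : ℝ) * (1 / (q : ℝ) ^ (N + 2)) := by gcongr
      _ = _ := by
        rw [one_div, one_div, inv_pow, pow_succ _ (N + 1)]
        field_simp
  obtain ⟨t, y, ht, hy⟩ := hf.exists_periodic hρ hqpos (p := p)
    ((hirr.natCast_mul hqpos.ne').ne_int p)
  obtain ⟨x₀, hx₀⟩ := (hf.add_const t).exists_isOrbit hqpos hpq hy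
  obtain ⟨m, hm⟩ := hx₀.exists_max_gap
  have hx := hx₀.shift m
  set F : ℝ → ℝ := fun z => f z + t with hFd
  have hF := hctrl t
  obtain ⟨ξ, hξ, hlift, hrot, hlin, hW⟩ := hdisp hx hF (by omega)
    (fun k => by rw [IsOrbit.gap_shift, IsOrbit.gap_shift, zero_add]; exact hm _)
    (hgap hx hF.nonlin_le hαε (by omega) 0)
    (hτ.trans (pow_le_pow_of_le_one (by positivity) hq1 (by omega)))
  refine ⟨fun z => F z + ξ (F z), hlift, hrot, hlin, fun i hi z => ?_⟩
  have hFs := hF.lift.contDiff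
  have hcomp : WtAt r (fun z => ξ (F z)) z (r ! * (ε / 2 / (r ! * D ^ r)) * D ^ r) 1 := by
    refine WtAt.comp hξ hFs hD1 zero_le_one (fun j hj => by simpa using hW (F z) j hj)
      fun j hj1 hj => ?_
    obtain ⟨j, rfl⟩ : ∃ j', j = j' + 1 := ⟨j - 1, by omega⟩
    have hdF : deriv F = deriv f := funext fun z => deriv_add_const t
    rw [iteratedDeriv_succ', hdF, one_pow, mul_one]
    exact hD j (by omega) z
  have hsum := (wtAt_const r t z).add contDiff_const (hξ.comp hFs) hcomp
  have hgf : (fun z => F z + ξ (F z)) = fun z => f z + (t + ξ (F z)) := by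
    ext z
    simp only [hFd]
    ring
  have hs : ContDiff ℝ ∞ fun z => t + ξ (F z) := contDiff_const.add (hξ.comp hFs)
  rw [hgf, iteratedDeriv_fun_add (hf.contDiff.contDiffAt.of_le (by exact_mod_cast le_top))
    (hs.contDiffAt.of_le (by exact_mod_cast le_top)), add_sub_cancel_left]
  refine (hsum i hi).trans ?_
  have hval : r ! * (ε / 2 / (r ! * D ^ r)) * D ^ r = ε / 2 := by field_simp
  have ht' : |t| ≤ ε / 2 := by
    have h1 : |q * α - p| ≤ 1 / (q : ℝ) :=
      hτ.trans (pow_le_of_le_one (by positivity) hq1 (by omega))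
    have h2 : 4 / ε < q := hQ₃.trans (by
      have : Q₃ < q := by omega
      exact_mod_cast this)
    rw [div_lt_iff₀ hε] at h2
    have h3 : 2 * (1 / (q : ℝ)) ≤ ε / 2 := by
      rw [mul_one_div, div_le_iff₀ hq0]
      linarith
    linarith
  rw [hval, one_pow, mul_one]
  linarith

/-- **Yoccoz's density theorem.** For every Liouville number `α` (irrational but not
Diophantine), every orientation-preserving `C^∞` circle diffeomorphism with rotation
number `α` is the limit, in the `C^∞` topology (uniform convergence of all derivatives),
of a sequence of `C^∞`-linearizable diffeomorphisms with rotation number `α`. -/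
theorem yoccoz_density_of_linearizable (α : ℝ) (hirr : Irrational α)
    (hLiouville : ¬ IsDiophantine α)
    (f : SmoothCircleDiffeoLift) (hρ : IsRotNumber f.toFun α) :
    ∃ g : ℕ → SmoothCircleDiffeoLift,
      (∀ k, IsRotNumber (g k).toFun α) ∧
      (∀ k, SmoothlyLinearizable (g k).toFun α) ∧
      ∀ r : ℕ, TendstoUniformly (fun k => iteratedDeriv r (g k).toFun)
        (iteratedDeriv r f.toFun) atTop := by
  have hf : IsSmoothLift f.toFun := ⟨f.smooth, f.deriv_pos, f.map_add_one⟩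
  have hex : ∀ n : ℕ, ∃ g, IsSmoothLift g ∧ IsRotNumber g α ∧ SmoothlyLinearizable g α ∧
      ∀ i ≤ n, ∀ x, |iteratedDeriv i g x - iteratedDeriv i f.toFun x| ≤ 1 / ((n : ℝ) + 1) :=
    fun n => exists_linearizable_near hf hirr hLiouville hρ n (by positivity)
  choose g hg hrot hlin hclose using hex
  refine ⟨fun n => ⟨g n, (hg n).contDiff, (hg n).deriv_pos, (hg n).map_add_one⟩, hrot, hlin,
    fun r => ?_⟩
  rw [Metric.tendstoUniformly_iff]
  intro ε hε
  filter_upwards [eventually_ge_atTop r,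
    (tendsto_one_div_add_atTop_nhds_zero_nat (𝕜 := ℝ)).eventually (gt_mem_nhds hε)] with n hn hnε x
  rw [dist_comm, Real.dist_eq]
  exact (hclose n r hn x).trans_lt hnε
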